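/- arXiv:0809.1922 — 5 statements merged into one kernel-verified Lean document; each statement's English description precedes it below -/
import Mathlib

section
/- Let (S,*,n) be an Okubo algebra over a field k of characteristic ≠ 3 containing a nonzero element x with n(x) = 0 and n(x, x*x) ≠ 0. Then there exists a nonzero element y ∈ S with n(y) = 0, n(y, y*y) ≠ 0, x*y = 0, and n(a, b) = 0 for every a ∈ {x, x*x} and b ∈ {y, y*y} (i.e., the subalgebras generated by x and by y, which are span{x, x*x} and span{y, y*y}, are orthogonal with respect to the polar form). -/
open QuadraticMap

section Trilinear

variable {k U : Type*} [Field k] [AddCommGroup U] [Module k U]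

theorem trilinear_eq_zero_of_span {a b c : U} (hs : Submodule.span k {a, b, c} = ⊤)
    (T : U →ₗ[k] U →ₗ[k] U →ₗ[k] k)
    (hT : ∀ u ∈ ({a, b, c} : Set U), ∀ v ∈ ({a, b, c} : Set U), ∀ w ∈ ({a, b, c} : Set U),
      T u v w = 0) : T = 0 := by
  refine LinearMap.ext_on hs fun u hu => ?_
  refine LinearMap.ext_on hs fun v hv => ?_
  exact LinearMap.ext_on hs fun w hw => by simpa using hT u hu v hv w hw

theorem span_triple_eq_top [FiniteDimensional k U] (hd : Module.finrank k U ≤ 3) {a b c : U}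
    (hab : LinearIndependent k ![a, b]) (hc : c ∉ Submodule.span k {a, b}) :
    Submodule.span k {a, b, c} = ⊤ := by
  have h : LinearIndependent k (Fin.snoc ![a, b] c : Fin 3 → U) :=
    linearIndependent_finSnoc.mpr ⟨hab, by rwa [Matrix.range_cons_cons_empty]⟩
  have hr : Set.range (Fin.snoc ![a, b] c : Fin 3 → U) = {a, b, c} := by
    ext x
    simp only [Fin.range_snoc, Matrix.range_cons_cons_empty, Set.mem_insert_iff,
      Set.mem_singleton_iff]
    tauto
  rw [← hr]
  refine h.span_eq_top_of_card_eq_finrank (le_antisymm h.fintype_card_le_finrank (by simpa))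

theorem exists_span_triple_eq_top [FiniteDimensional k U] (hd : Module.finrank k U ≤ 3) {a b : U}
    (hab : LinearIndependent k ![a, b]) :
    ∃ c, Submodule.span k {a, b, c} = ⊤ := by
  by_cases h : Submodule.span k {a, b} = ⊤
  · exact ⟨0, by rw [eq_top_iff, ← h]; exact Submodule.span_mono (by grind)⟩
  · obtain ⟨c, -, hc⟩ := SetLike.exists_of_lt (lt_top_iff_ne_top.mpr h)
    exact ⟨c, span_triple_eq_top hd hab hc⟩

variable {T : U →ₗ[k] U →ₗ[k] U →ₗ[k] k} {R : U →ₗ[k] U} {γ : k}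

theorem trilinear_antisymm (halt : ∀ u w, T (R u) u w = 0) (u v w : U) :
    T (R u) v w = -T (R v) u w := by
  have h1 := halt (u + v) w
  simp only [map_add, LinearMap.add_apply, halt] at h1
  linear_combination h1

theorem trilinear_orbit_eq_zero
    (hcyc : ∀ u v w, T u v w = T v w u) (halt : ∀ u w, T (R u) u w = 0)
    (hR : ∀ u, R (R (R u)) = γ • u) {y : U} (hy : T y y y = 0) :
    ∀ u ∈ ({y, R y, R (R y)} : Set U), ∀ v ∈ ({y, R y, R (R y)} : Set U),
      ∀ w ∈ ({y, R y, R (R y)} : Set U), T u v w = 0 := by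
  have hanti := trilinear_antisymm halt
  have h200 : T (R (R y)) y y = 0 := by
    rw [hanti, hcyc, halt, neg_zero]
  have h120 : T (R y) (R (R y)) y = 0 := by
    rw [hanti, hR, map_smul, LinearMap.smul_apply, LinearMap.smul_apply, hy, smul_zero, neg_zero]
  have h111 : T (R y) (R y) (R y) = 0 := by
    rw [hanti, hcyc, hcyc, h120, neg_zero]
  have h220 : T (R (R y)) (R (R y)) y = 0 := by
    rw [hanti, hR, map_smul, LinearMap.smul_apply, LinearMap.smul_apply, hcyc, halt,
      smul_zero, neg_zero]
  have h222 : T (R (R y)) (R (R y)) (R (R y)) = 0 := by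
    rw [hanti, hR, map_smul, LinearMap.smul_apply, LinearMap.smul_apply, hcyc, h120,
      smul_zero, neg_zero]
  have h1 := halt y
  have h2 := halt (R y)
  simp only [Set.mem_insert_iff, Set.mem_singleton_iff]
  rintro u (rfl | rfl | rfl) v (rfl | rfl | rfl) w (rfl | rfl | rfl) <;> grind

theorem trilinear_alternating (h3 : (3 : k) ≠ 0) {c : k} (hc : c ≠ 0)
    (hcyc : ∀ u v w, T u v w = T v w u) (halt : ∀ u w, T (R u) u w = 0)
    (hR : ∀ u, R (R u) = -(c • R u) - (c ^ 2) • u) (y z : U) :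
    T y y z = 0 ∧ T y (R y) z = 0 := by
  have hanti := trilinear_antisymm halt
  have hRR : ∀ z, T (R y) (R y) z = c ^ 2 * T y y z := fun z => by
    rw [hanti, hR]
    simp [halt]
  have hyR : ∀ z, T y (R y) z = - c * T y y z := fun z => by
    have h1 := halt (R y) z
    rw [hR] at h1
    simp only [map_sub, map_neg, map_smul, LinearMap.sub_apply, LinearMap.neg_apply,
      LinearMap.smul_apply, smul_eq_mul, hRR] at h1
    have : c ^ 2 * (T y (R y) z + c * T y y z) = 0 := by linear_combination -h1
    have := (mul_eq_zero.mp this).resolve_left (pow_ne_zero 2 hc)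
    linear_combination this
  have key : ∀ u v w, T (R u) v (R w) = T u (R (R v)) w := fun u v w => by
    rw [hanti, ← hcyc, hanti, neg_neg, ← hcyc]
  have h1 : T y y (R z) = c * T y y z := by
    have h := key z y y
    rw [hcyc, hcyc z, hyR, hR] at h
    simp only [map_sub, map_neg, map_smul, LinearMap.sub_apply, LinearMap.neg_apply,
      LinearMap.smul_apply, smul_eq_mul, halt] at h
    have h0 : c * (T y y (R z) - c * T y y z) = 0 := by linear_combination -h
    exact sub_eq_zero.mp ((mul_eq_zero.mp h0).resolve_left hc)
  have h2 : T (R y) (R y) z = T y y (R (R z)) := by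
    rw [hcyc, key, hcyc, hcyc]
  rw [hRR, hR] at h2
  simp only [map_sub, map_neg, map_smul, smul_eq_mul, h1] at h2
  have h4 : 3 * c ^ 2 * T y y z = 0 := by linear_combination h2
  have h5 := (mul_eq_zero.mp h4).resolve_left (mul_ne_zero h3 (pow_ne_zero 2 hc))
  exact ⟨h5, by rw [hyR, h5, mul_zero]⟩

theorem exists_cube_eq_and_map_map_eq {y : U} (hli : LinearIndependent k ![y, R y])
    (hγ : R (R (R y)) = γ • y) (hy : R (R y) ∈ Submodule.span k {y, R y}) :
    ∃ c : k, c ^ 3 = γ ∧ R (R y) = -(c • R y) - (c ^ 2) • y := by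
  obtain ⟨s, t, hst⟩ := Submodule.mem_span_pair.mp hy
  rw [LinearIndependent.pair_iff] at hli
  have h1 : (s * t - γ) • y + (s + t ^ 2) • R y = 0 := by
    rw [← hst, map_add, map_smul, map_smul, ← hst] at hγ
    linear_combination (norm := module) hγ
  obtain ⟨h2, h3⟩ := hli _ _ h1
  refine ⟨-t, by linear_combination h2 - t * h3, ?_⟩
  rw [← hst]
  linear_combination (norm := module) h3 • y

/-- The cubic form `T y y y` of a nonzero cyclic trilinear form in dimension at most three, with
`T (R u) u w = 0` for a nonscalar `R` whose cube is scalar, does not vanish identically. -/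
theorem trilinear_eq_zero [FiniteDimensional k U] (hd : Module.finrank k U ≤ 3)
    (h3 : (3 : k) ≠ 0) (hγ0 : γ ≠ 0)
    (hcyc : ∀ u v w, T u v w = T v w u) (halt : ∀ u w, T (R u) u w = 0)
    (hR : ∀ u, R (R (R u)) = γ • u) (hT : ∀ y, T y y y = 0)
    {y : U} (hy : LinearIndependent k ![y, R y]) : T = 0 := by
  by_cases hspan : ∀ z, R (R z) ∈ Submodule.span k {z, R z}
  · obtain ⟨c, hc, hyc⟩ := exists_cube_eq_and_map_map_eq hy (hR y) (hspan y)
    have hc0 : c ≠ 0 := by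
      rintro rfl
      exact hγ0 (by linear_combination -hc)
    have hquad : ∀ u, R (R u) = -(c • R u) - (c ^ 2) • u := by
      intro u
      by_contra hu
      set z := R (R u) + c • R u + c ^ 2 • u with hz
      have hz0 : z ≠ 0 := fun h => hu (by linear_combination (norm := module) h)
      have hRz : R z = c • z := by
        simp only [hz, map_add, map_smul, hR]
        linear_combination (norm := module) -hc • u
      obtain ⟨s, t, hst⟩ := Submodule.mem_span_pair.mp (hspan (y + z))
      simp only [map_add, map_smul, hRz, hyc] at hst
      have hrel : (s + t * c - c ^ 2) • z = (-c ^ 2 - s) • y + (-c - t) • R y := by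
        linear_combination (norm := module) hst
      have h1 := congrArg R hrel
      simp only [map_add, map_smul, hRz, hyc] at h1
      have h2 := congrArg R h1
      simp only [map_add, map_sub, map_neg, map_smul, hRz, hyc] at h2
      have h4 : (3 * c ^ 2 * (s + t * c - c ^ 2)) • z = 0 := by
        linear_combination (norm := module) h2 + c • h1 + c ^ 2 • hrel
      have h5 : s + t * c - c ^ 2 = 0 :=
        (mul_eq_zero.mp ((smul_eq_zero.mp h4).resolve_right hz0)).resolve_left
          (mul_ne_zero h3 (pow_ne_zero 2 hc0))
      rw [h5, zero_smul] at hrel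
      obtain ⟨h6, h7⟩ := LinearIndependent.pair_iff.mp hy _ _ hrel.symm
      exact mul_ne_zero h3 (pow_ne_zero 2 hc0) (by linear_combination -h5 - h6 - c * h7)
    obtain ⟨z, hz⟩ := exists_span_triple_eq_top hd hy
    have h1 := fun u w => (trilinear_alternating h3 hc0 hcyc halt hquad u w).1
    have h2 := fun u w => (trilinear_alternating h3 hc0 hcyc halt hquad u w).2
    refine trilinear_eq_zero_of_span hz T ?_
    simp only [Set.mem_insert_iff, Set.mem_singleton_iff]
    rintro u (rfl | rfl | rfl) v (rfl | rfl | rfl) w (rfl | rfl | rfl) <;> grind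
  · push Not at hspan
    obtain ⟨z, hz⟩ := hspan
    refine trilinear_eq_zero_of_span (span_triple_eq_top hd ?_ hz) T
      (trilinear_orbit_eq_zero hcyc halt hR (hT z))
    refine LinearIndependent.pair_iff.mpr fun s t hst => ?_
    have ht : t = 0 := by
      by_contra ht
      refine hz (Submodule.mem_span_pair.mpr ⟨0, -(t⁻¹ * s), ?_⟩)
      have h1 : R z = -(t⁻¹ * s) • z := by
        rw [← inv_smul_smul₀ ht (R z), eq_neg_of_add_eq_zero_right hst]
        module
      rw [zero_smul, zero_add, ← map_smul, ← h1]
    subst ht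
    rw [zero_smul, add_zero] at hst
    refine ⟨(smul_eq_zero.mp hst).resolve_right ?_, rfl⟩
    rintro rfl
    simp at hz

end Trilinear

/-- `mul` and `n` make `S` a symmetric composition algebra. -/
structure IsSymmetricComposition {k S : Type*} [Field k] [AddCommGroup S] [Module k S]
    (mul : S →ₗ[k] S →ₗ[k] S) (n : QuadraticForm k S) : Prop where
  nondeg : ∀ x : S, (∀ y : S, polar n x y = 0) → x = 0
  comp : ∀ x y : S, n (mul x y) = n x * n y
  assoc : ∀ x y z : S, polar n (mul x y) z = polar n x (mul y z)

namespace IsSymmetricComposition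

variable {k S : Type*} [Field k] [AddCommGroup S] [Module k S]
  {mul : S →ₗ[k] S →ₗ[k] S} {n : QuadraticForm k S}

theorem eq_of_polar (h : IsSymmetricComposition mul n) {a b : S}
    (hab : ∀ z, polar n a z = polar n b z) : a = b :=
  sub_eq_zero.mp <| h.nondeg _ fun z => by rw [polar_sub_left, hab, sub_self]

theorem assoc_left (h : IsSymmetricComposition mul n) (a b c : S) :
    polar n a (mul b c) = polar n c (mul a b) := by
  rw [← h.assoc, polar_comm]

theorem flip (h : IsSymmetricComposition mul n) : IsSymmetricComposition mul.flip n where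
  nondeg := h.nondeg
  comp a b := by rw [LinearMap.flip_apply, h.comp, mul_comm]
  assoc a b c := by
    rw [LinearMap.flip_apply, LinearMap.flip_apply, h.assoc_left a, h.assoc]

theorem polar_mul_left (h : IsSymmetricComposition mul n) (a b c : S) :
    polar n (mul a b) (mul a c) = n a * polar n b c := by
  simp only [polar, ← map_add, h.comp]
  ring

theorem mul_mul_self (h : IsSymmetricComposition mul n) (a b : S) :
    mul (mul a b) a = n a • b :=
  h.eq_of_polar fun z => by rw [h.assoc, h.polar_mul_left, polar_smul_left, smul_eq_mul]

theorem self_mul_mul (h : IsSymmetricComposition mul n) (a b : S) :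
    mul a (mul b a) = n a • b :=
  h.flip.mul_mul_self a b

theorem mul_mul_add (h : IsSymmetricComposition mul n) (a b c : S) :
    mul (mul a b) c + mul (mul c b) a = polar n a c • b := by
  have h1 := h.mul_mul_self (a + c) b
  have h2 := h.mul_mul_self a b
  have h3 := h.mul_mul_self c b
  simp only [map_add, LinearMap.add_apply] at h1
  simp only [polar, sub_smul, ← h1, ← h2, ← h3]
  abel

theorem mul_add_mul (h : IsSymmetricComposition mul n) (a b c : S) :
    mul a (mul b c) + mul c (mul b a) = polar n a c • b :=
  (h.flip.mul_mul_add a b c).symm ▸ add_comm _ _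


variable (mul n) in
/-- The elements `u` orthogonal to `x` with `x * u = 0`. -/
def leftKer (x : S) : Submodule k S := LinearMap.ker (mul x) ⊓ LinearMap.ker (n.polarBilin x)

theorem mem_leftKer {x u : S} : u ∈ leftKer mul n x ↔ mul x u = 0 ∧ polar n x u = 0 := by
  simp [leftKer]

variable {x : S}

theorem polar_sq_left (h : IsSymmetricComposition mul n) {u : S} (hu : u ∈ leftKer mul n x) :
    polar n (mul x x) u = 0 := by
  rw [h.assoc, (mem_leftKer.mp hu).1, polar_zero_right]

theorem map_eq_zero_of_mul_eq_zero (h : IsSymmetricComposition mul n) (hx : n x = 0)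
    (hα : polar n x (mul x x) ≠ 0) {y : S} (hy : mul x y = 0) : n y = 0 := by
  have h1 := h.mul_mul_add x y (mul x x)
  rw [hy, map_zero, LinearMap.zero_apply, zero_add] at h1
  have h2 := congrArg n h1
  rw [h.comp, hx, mul_zero, QuadraticMap.map_smul, smul_eq_mul] at h2
  exact (mul_eq_zero.mp h2.symm).resolve_left (mul_ne_zero hα hα)

theorem polar_eq_zero_of_mul_eq_zero (h : IsSymmetricComposition mul n) (hx : n x = 0)
    (hα : polar n x (mul x x) ≠ 0) {y z : S} (hy : mul x y = 0) (hz : mul x z = 0) :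
    polar n y z = 0 := by
  have h1 : mul x (y + z) = 0 := by rw [map_add, hy, hz, add_zero]
  simp [polar, h.map_eq_zero_of_mul_eq_zero hx hα, hy, hz, h1]

theorem mul_mem_leftKer (h : IsSymmetricComposition mul n) (hx : n x = 0) {u : S}
    (hu : polar n (mul x x) u = 0) : mul u x ∈ leftKer mul n x :=
  mem_leftKer.mpr ⟨by rw [h.self_mul_mul, hx, zero_smul],
    by rw [h.assoc_left, ← h.assoc, hu]⟩

theorem mul_mul_mem_leftKer (h : IsSymmetricComposition mul n) (hx : n x = 0) (u : S) :
    mul (mul u x) x ∈ leftKer mul n x :=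
  h.mul_mem_leftKer hx <| by
    rw [h.assoc_left, ← h.assoc, h.self_mul_mul, hx, zero_smul, polar_zero_left]

theorem sq_mul (h : IsSymmetricComposition mul n) {u : S} (hu : polar n x u = 0) :
    mul (mul x x) u = -mul (mul u x) x := by
  have h1 := h.mul_mul_add x x u
  rw [hu, zero_smul] at h1
  exact eq_neg_of_add_eq_zero_left h1

theorem mul_sq (h : IsSymmetricComposition mul n) {u : S} (hu : polar n x u = 0) :
    mul u (mul x x) = -mul x (mul x u) :=
  h.flip.sq_mul hu

theorem smul_eq_decomposition (h : IsSymmetricComposition mul n) (x y : S) :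
    polar n x (mul x x) • y = polar n (mul x x) y • x + polar n x y • mul x x
      - mul x (mul x (mul x y)) - mul (mul (mul y x) x) x := by
  have e1 := h.mul_mul_add x y (mul x x)
  have e2 := h.mul_add_mul x x (mul x y)
  have e3 := congrArg (mul.flip x) (h.mul_mul_add x x y)
  simp only [map_add, LinearMap.flip_apply, map_smul] at e3
  rw [← h.assoc] at e2
  linear_combination (norm := module) -e1 + e2 + e3

theorem linearMap_eq_zero (h : IsSymmetricComposition mul n) (hx : n x = 0)
    (hα : polar n x (mul x x) ≠ 0) {M : Type*} [AddCommGroup M] [Module k M] (F : S →ₗ[k] M)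
    (h1 : F x = 0) (h2 : F (mul x x) = 0) (hU : ∀ u ∈ leftKer mul n x, F u = 0)
    (hV : ∀ v ∈ leftKer mul.flip n x, F v = 0) (y : S) : F y = 0 := by
  have h3 := congrArg F (h.smul_eq_decomposition x y)
  have h4 := hV _ (h.flip.mul_mul_mem_leftKer hx (mul x y))
  rw [LinearMap.flip_apply, LinearMap.flip_apply] at h4
  rw [map_sub, map_sub, map_add, map_smul, map_smul, map_smul, h1, h2, h4,
    hU _ (h.mul_mul_mem_leftKer hx (mul y x))] at h3
  simpa [hα] using h3

theorem mul_cube (h : IsSymmetricComposition mul n) {u : S} (hu : u ∈ leftKer mul n x) :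
    mul (mul (mul u x) x) x = -polar n x (mul x x) • u := by
  have h1 := h.smul_eq_decomposition x u
  rw [h.polar_sq_left hu, (mem_leftKer.mp hu).1, (mem_leftKer.mp hu).2] at h1
  simp only [map_zero] at h1
  linear_combination (norm := module) h1

theorem mul_eq_zero_of_trilinear (h : IsSymmetricComposition mul n) (hx : n x = 0)
    (hα : polar n x (mul x x) ≠ 0)
    (hT : ∀ u ∈ leftKer mul n x, ∀ v ∈ leftKer mul n x, ∀ w ∈ leftKer mul n x,
      polar n (mul u v) w = 0) {u v : S} (hu : u ∈ leftKer mul n x) (hv : v ∈ leftKer mul n x) :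
    mul u v = 0 := by
  have h1 : mul (mul u v) x = 0 := by
    have h2 := h.mul_mul_add u v x
    rwa [(mem_leftKer.mp hv).1, polar_comm, (mem_leftKer.mp hu).2, map_zero,
      LinearMap.zero_apply, zero_smul, add_zero] at h2
  refine h.nondeg _ (h.linearMap_eq_zero hx hα (n.polarBilin (mul u v)) ?_ ?_ (hT u hu v hv) ?_)
  · have h2 := (mem_leftKer.mp (h.mul_mem_leftKer hx (h.polar_sq_left hv))).1
    exact (h.assoc _ _ _).trans (h.polar_eq_zero_of_mul_eq_zero hx hα (mem_leftKer.mp hu).1 h2)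
  · rw [polarBilin_apply_apply, ← h.assoc, h1, polar_zero_left]
  · intro w hw
    have h2 := h.flip.mul_cube hw
    simp only [LinearMap.flip_apply] at h2
    have h3 := h.assoc (mul u v) x (mul x (mul x w))
    rw [h1, polar_zero_left, h2, polar_smul_right] at h3
    simpa [hα] using h3

theorem not_linearIndependent_of_mul_eq_zero (h : IsSymmetricComposition mul n) (hx : n x = 0)
    (hα : polar n x (mul x x) ≠ 0)
    (hUU : ∀ u ∈ leftKer mul n x, ∀ v ∈ leftKer mul n x, mul u v = 0) {y : S}
    (hy : y ∈ leftKer mul n x) : ¬ LinearIndependent k ![y, mul y x] := by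
  intro hli
  have hyx : mul y x ∈ leftKer mul n x := h.mul_mem_leftKer hx (h.polar_sq_left hy)
  have hyx0 : mul y x ≠ 0 := hli.ne_zero 1
  obtain ⟨w, hw⟩ : ∃ w, polar n (mul y x) w ≠ 0 := by
    by_contra! hc
    exact hyx0 (h.nondeg _ hc)
  rw [h.assoc] at hw
  have hwx : mul (mul x w) x = 0 := by rw [h.mul_mul_self, hx, zero_smul]
  set w' := mul x w
  have key : ∀ v ∈ leftKer mul n x, ∃ s : k, v = s • mul (mul y x) x := by
    intro v hv
    have h1 := h.mul_mul_add y v w'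
    have h2 := h.mul_add_mul x w' v
    rw [hUU y hy v hv, map_zero, LinearMap.zero_apply, zero_add] at h1
    rw [hwx, map_zero, add_zero, (mem_leftKer.mp hv).2, zero_smul] at h2
    have h3 := congrArg (mul.flip y) (h.smul_eq_decomposition x (mul w' v))
    simp only [h2, map_zero, map_sub, map_add, map_smul, LinearMap.flip_apply, h1,
      hUU _ (h.mul_mul_mem_leftKer hx (mul (mul w' v) x)) y hy, (mem_leftKer.mp hy).1,
      h.sq_mul (mem_leftKer.mp hy).2, sub_zero, smul_zero, zero_add] at h3
    refine ⟨-((polar n x (mul x x) * polar n y w')⁻¹ * polar n x (mul w' v)), ?_⟩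
    rw [neg_smul, mul_smul, ← smul_neg, ← smul_neg, ← h3, ← mul_smul (polar n x (mul x x)),
      inv_smul_smul₀ (mul_ne_zero hα hw)]
  obtain ⟨s, hs⟩ := key y hy
  obtain ⟨t, ht⟩ := key _ hyx
  have h1 : t • y + (-s) • mul y x = 0 := by
    linear_combination (norm := module) t • hs - s • ht
  obtain ⟨rfl, h2⟩ := LinearIndependent.pair_iff.mp hli _ _ h1
  exact hyx0 (by rw [ht, zero_smul])

theorem finrank_leftKer_le (h : IsSymmetricComposition mul n) (hdim : Module.finrank k S = 8)
    (hx : n x = 0) (hα : polar n x (mul x x) ≠ 0) : Module.finrank k (leftKer mul n x) ≤ 3 := by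
  have : FiniteDimensional k S := .of_finrank_pos (by lia)
  have hsymm : LinearMap.IsSymm n.polarBilin := ⟨fun a b => polar_comm _ _ _⟩
  have hnd : LinearMap.Nondegenerate n.polarBilin :=
    hsymm.isRefl.nondegenerate_iff_separatingLeft.mpr h.nondeg
  have h1 : LinearMap.ker (mul x) ≤
      LinearMap.BilinForm.orthogonal n.polarBilin (LinearMap.ker (mul x)) :=
    fun a ha b hb => h.polar_eq_zero_of_mul_eq_zero hx hα hb ha
  have h2 := Submodule.finrank_mono h1
  rw [LinearMap.BilinForm.finrank_orthogonal hnd] at h2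
  have h3 : leftKer mul n x < LinearMap.ker (mul x) := by
    refine lt_of_le_of_ne inf_le_left fun he => hα ?_
    have h4 : mul x x ∈ LinearMap.ker (mul x) := by
      rw [LinearMap.mem_ker, h.self_mul_mul, hx, zero_smul]
    rw [← he] at h4
    exact (mem_leftKer.mp h4).2
  have := Submodule.finrank_lt_finrank_of_lt h3
  lia

theorem exists_mem_leftKer_ne_zero (h : IsSymmetricComposition mul n)
    (hdim : Module.finrank k S = 8)
    (hx : n x = 0) (hα : polar n x (mul x x) ≠ 0) : ∃ u ∈ leftKer mul n x, u ≠ 0 := by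
  by_contra! hU
  have hV : ∀ v ∈ leftKer mul.flip n x, v = 0 := fun v hv =>
    h.nondeg v <| h.linearMap_eq_zero hx hα (n.polarBilin v)
      ((polar_comm _ _ _).trans (mem_leftKer.mp hv).2)
      ((polar_comm _ _ _).trans (h.flip.polar_sq_left hv))
      (fun u hu => by rw [hU u hu, map_zero])
      fun w hw => h.flip.polar_eq_zero_of_mul_eq_zero hx hα (mem_leftKer.mp hv).1
        (mem_leftKer.mp hw).1
  have h1 : Submodule.span k {x, mul x x} = ⊤ := by
    rw [← Submodule.ker_mkQ (Submodule.span k {x, mul x x}), LinearMap.ker_eq_top]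
    refine LinearMap.ext (h.linearMap_eq_zero hx hα _ ?_ ?_ ?_ ?_)
    · exact (Submodule.Quotient.mk_eq_zero _).mpr (Submodule.subset_span (by simp))
    · exact (Submodule.Quotient.mk_eq_zero _).mpr (Submodule.subset_span (by simp))
    · exact fun u hu => by rw [hU u hu, map_zero]
    · exact fun v hv => by rw [hV v hv, map_zero]
  classical
  have h2 := (finrank_span_finset_le_card (R := k) {x, mul x x}).trans Finset.card_le_two
  rw [Set.finrank, Finset.coe_pair, h1, finrank_top, hdim] at h2
  lia

theorem mul_left_eq_smul (h : IsSymmetricComposition mul n) (hx : n x = 0)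
    (hα : polar n x (mul x x) ≠ 0) {c : k} (hc : ∀ u ∈ leftKer mul n x, mul u x = c • u) {v : S}
    (hv : v ∈ leftKer mul.flip n x) : mul x v = c • v := by
  have hz : mul x v - c • v ∈ leftKer mul.flip n x :=
    Submodule.sub_mem _ (h.flip.mul_mem_leftKer hx (h.flip.polar_sq_left hv))
      (Submodule.smul_mem _ c hv)
  refine sub_eq_zero.mp (h.nondeg _ (h.linearMap_eq_zero hx hα (n.polarBilin (mul x v - c • v))
    ((polar_comm _ _ _).trans (mem_leftKer.mp hz).2)
    ((polar_comm _ _ _).trans (h.flip.polar_sq_left hz)) ?_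
    fun w hw => h.flip.polar_eq_zero_of_mul_eq_zero hx hα (mem_leftKer.mp hz).1
        (mem_leftKer.mp hw).1))
  intro u hu
  rw [polarBilin_apply_apply, polar_sub_left, polar_comm, ← h.assoc, hc u hu, polar_smul_left,
    polar_smul_left, polar_comm n v, sub_self]

theorem idempotent_mul (h : IsSymmetricComposition mul n) (hx : n x = 0)
    (hα : polar n x (mul x x) ≠ 0) {c : k} (hc3 : c ^ 3 = -polar n x (mul x x))
    (hU : ∀ u ∈ leftKer mul n x, mul u x = c • u)
    (hV : ∀ v ∈ leftKer mul.flip n x, mul x v = c • v) {e : S}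
    (he : e = (c⁻¹) ^ 2 • mul x x - c⁻¹ • x) (y : S) : mul e y = polar n e y • e - y := by
  have hc0 : c ≠ 0 := by
    rintro rfl
    exact hα (by simpa using hc3.symm)
  have hxx : n (mul x x) = 0 := by rw [h.comp, hx, zero_mul]
  have hpx : polar n x x = 0 := by rw [polar_self, hx, smul_zero]
  have hpxx : polar n (mul x x) (mul x x) = 0 := by rw [polar_self, hxx, smul_zero]
  have h1 : mul x (mul x x) = 0 := by rw [h.self_mul_mul, hx, zero_smul]
  have h2 : mul (mul x x) x = 0 := by rw [h.mul_mul_self, hx, zero_smul]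
  have h3 : mul (mul x x) (mul x x) = polar n x (mul x x) • x := by
    have h4 := h.mul_mul_add x x (mul x x)
    rwa [h2, map_zero, LinearMap.zero_apply, add_zero] at h4
  have h5 := h.linearMap_eq_zero hx hα
    (mul e - (n.polarBilin e).smulRight e + LinearMap.id) ?_ ?_ ?_ ?_ y
  · simp only [LinearMap.add_apply, LinearMap.sub_apply, LinearMap.smulRight_apply,
      polarBilin_apply_apply, LinearMap.id_apply] at h5
    linear_combination (norm := module) h5
  all_goals
    simp only [LinearMap.add_apply, LinearMap.sub_apply, LinearMap.smulRight_apply,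
      polarBilin_apply_apply, LinearMap.id_apply]
  · simp only [he, map_sub, map_smul, LinearMap.sub_apply, LinearMap.smul_apply, polar_sub_left,
      polar_smul_left, hpx, polar_comm n (mul x x) x, ← neg_eq_iff_eq_neg.mpr hc3, h2, smul_eq_mul]
    match_scalars <;> field_simp <;> ring
  · simp only [he, map_sub, map_smul, LinearMap.sub_apply, LinearMap.smul_apply, polar_sub_left,
      polar_smul_left, hpxx, h1, h3, ← neg_eq_iff_eq_neg.mpr hc3, smul_eq_mul]
    match_scalars <;> field_simp <;> ring
  · intro u hu
    obtain ⟨hu1, hu2⟩ := mem_leftKer.mp hu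
    simp only [he, map_sub, map_smul, LinearMap.sub_apply, LinearMap.smul_apply, polar_sub_left,
      polar_smul_left, hu1, hu2, h.polar_sq_left hu, smul_zero, sub_zero, zero_smul,
      h.sq_mul hu2, hU u hu]
    match_scalars
    field_simp
    ring
  · intro v hv
    obtain ⟨hv1, hv2⟩ := mem_leftKer.mp hv
    rw [LinearMap.flip_apply] at hv1
    have hv3 := h.flip.polar_sq_left hv
    rw [LinearMap.flip_apply] at hv3
    simp only [he, map_sub, map_smul, LinearMap.sub_apply, LinearMap.smul_apply, polar_sub_left,
      polar_smul_left, hv1, hv2, hv3, smul_zero, sub_zero, zero_smul,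
      h.sq_mul hv2, hV v hv, LinearMap.zero_apply, map_zero]
    match_scalars
    field_simp
    ring

theorem exists_paraUnit (h : IsSymmetricComposition mul n) (hdim : Module.finrank k S = 8)
    (hx : n x = 0) (hα : polar n x (mul x x) ≠ 0) {c : k}
    (hc : ∀ u ∈ leftKer mul n x, mul u x = c • u) :
    ∃ e : S, ∀ y : S, mul e y = polar n e y • e - y ∧ mul y e = polar n e y • e - y := by
  obtain ⟨u, hu, hu0⟩ := h.exists_mem_leftKer_ne_zero hdim hx hα
  have hc3 : c ^ 3 = -polar n x (mul x x) := by
    have h1 := h.mul_cube hu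
    simp only [hc u hu, map_smul, LinearMap.smul_apply, smul_smul] at h1
    rw [← sub_eq_zero, ← sub_smul] at h1
    linear_combination (smul_eq_zero.mp h1).resolve_right hu0
  have hV := fun v hv => h.mul_left_eq_smul hx hα hc (v := v) hv
  exact ⟨_, fun y => ⟨h.idempotent_mul hx hα hc3 hc hV rfl y,
    h.flip.idempotent_mul hx hα hc3 hV hc rfl y⟩⟩

theorem exists_trilinear_ne_zero (h : IsSymmetricComposition mul n)
    (hdim : Module.finrank k S = 8) (h3 : (3 : k) ≠ 0)
    (hnopara : ¬ ∃ e : S, ∀ y : S,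
      mul e y = polar n e y • e - y ∧ mul y e = polar n e y • e - y)
    (hx : n x = 0) (hα : polar n x (mul x x) ≠ 0) :
    ∃ y ∈ leftKer mul n x, polar n (mul y y) y ≠ 0 := by
  by_contra! hT
  have : FiniteDimensional k S := .of_finrank_pos (by lia)
  let R : leftKer mul n x →ₗ[k] leftKer mul n x := (mul.flip x).restrict fun u hu =>
    h.mul_mem_leftKer hx (h.polar_sq_left hu)
  let T : leftKer mul n x →ₗ[k] leftKer mul n x →ₗ[k] leftKer mul n x →ₗ[k] k :=
    (mul.domRestrict₁₂ _ _).compr₂ (n.polarBilin.domRestrict₂ _)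
  by_cases hli : ∀ u, ¬ LinearIndependent k ![u, R u]
  · obtain ⟨c, hc⟩ := LinearMap.exists_eq_smul_id_of_forall_notLinearIndependent hli
    exact hnopara (h.exists_paraUnit hdim hx hα fun u hu =>
      congrArg Subtype.val (LinearMap.congr_fun hc ⟨u, hu⟩))
  · push Not at hli
    obtain ⟨y, hy⟩ := hli
    have hT0 : T = 0 := by
      refine trilinear_eq_zero (h.finrank_leftKer_le hdim hx hα) h3 (neg_ne_zero.mpr hα)
        (fun u v w => ?_) (fun u w => ?_) (fun u => Subtype.ext (h.mul_cube u.2))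
        (fun u => hT u u.2) hy
      · exact (h.assoc _ _ _).trans (polar_comm _ _ _)
      · change polar n (mul (mul (u : S) x) u) w = 0
        rw [h.mul_mul_self, h.map_eq_zero_of_mul_eq_zero hx hα (mem_leftKer.mp u.2).1, zero_smul,
          polar_zero_left]
    have hUU := fun u hu v hv => h.mul_eq_zero_of_trilinear hx hα (fun u hu v hv w hw =>
      LinearMap.congr_fun (LinearMap.congr_fun₂ hT0 ⟨u, hu⟩ ⟨v, hv⟩) ⟨w, hw⟩) (u := u) (v := v) hu
        hv
    refine h.not_linearIndependent_of_mul_eq_zero hx hα hUU y.2 ?_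
    have h1 : ![(y : S), mul y x] = Submodule.subtype _ ∘ ![y, R y] := by
      ext i
      fin_cases i <;> rfl
    rw [h1]
    exact hy.map' _ (Submodule.ker_subtype _)

theorem polar_sq_sq_of_mem_leftKer (h : IsSymmetricComposition mul n) {y : S}
    (hy : y ∈ leftKer mul n x) : polar n (mul x x) (mul y y) = 0 := by
  obtain ⟨h1, h2⟩ := mem_leftKer.mp hy
  have h3 := h.mul_add_mul x y y
  rw [h2, zero_smul] at h3
  rw [h.assoc, eq_neg_of_add_eq_zero_left h3, polar_neg_right, ← h.assoc, h1, polar_zero_left,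
    neg_zero]

end IsSymmetricComposition

/-- in an Okubo algebra over a field of characteristic ≠ 3, given
a nonzero `x` with `n(x) = 0 ≠ n(x, x*x)`, there is a nonzero `y` with
`n(y) = 0 ≠ n(y, y*y)`, `x * y = 0`, and the subalgebras generated by `x` and
`y` (spanned by `{x, x*x}` and `{y, y*y}`) orthogonal to each other. -/
theorem okubo_exists_orthogonal_element
    {k : Type*} [Field k] {S : Type*} [AddCommGroup S] [Module k S]
    (mul : S →ₗ[k] S →ₗ[k] S) (n : QuadraticForm k S)
    (hnondeg : ∀ x : S, (∀ y : S, polar n x y = 0) → x = 0)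
    (hcomp : ∀ x y : S, n (mul x y) = n x * n y)
    (hassoc : ∀ x y z : S, polar n (mul x y) z = polar n x (mul y z))
    (hdim : Module.finrank k S = 8)
    (hnopara : ¬ ∃ e : S, ∀ x : S,
      mul e x = polar n e x • e - x ∧ mul x e = polar n e x • e - x)
    (hchar : ringChar k ≠ 3)
    (x : S) (hx0 : x ≠ 0) (hxn : n x = 0) (hxa : polar n x (mul x x) ≠ 0) :
    ∃ y : S, y ≠ 0 ∧ n y = 0 ∧ polar n y (mul y y) ≠ 0 ∧ mul x y = 0 ∧
      ∀ a ∈ ({x, mul x x} : Set S), ∀ b ∈ ({y, mul y y} : Set S),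
        polar n a b = 0 := by
  have h : IsSymmetricComposition mul n := ⟨hnondeg, hcomp, hassoc⟩
  have h3 : (3 : k) ≠ 0 := fun h3 => by
    have hd : ringChar k ∣ 3 := ringChar.dvd (by exact_mod_cast h3)
    rcases (Nat.dvd_prime Nat.prime_three).mp hd with h1 | h1
    · exact CharP.ringChar_ne_one h1
    · exact hchar h1
  obtain ⟨y, hy, hT⟩ := h.exists_trilinear_ne_zero hdim h3 hnopara hxn hxa
  obtain ⟨h1, h2⟩ := IsSymmetricComposition.mem_leftKer.mp hy
  refine ⟨y, ?_, h.map_eq_zero_of_mul_eq_zero hxn hxa h1, by rwa [← hassoc], h1, ?_⟩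
  · rintro rfl
    simp at hT
  · rintro a (rfl | rfl) b (rfl | rfl)
    · exact h2
    · rw [← hassoc, h1, polar_zero_left]
    · exact h.polar_sq_left hy
    · exact h.polar_sq_sq_of_mem_leftKer hy
end

section
/- Let (S,*,n) be an Okubo algebra over a field k. Then S has isotropic norm (n(z) = 0 for some nonzero z) and contains a nonzero idempotent (e ≠ 0 with e*e = e) if and only if there exist x, y ∈ S with n(x) = 0, n(x, x*x) = 1, n(y) = 0, n(y, y*y) ≠ 0, x*y = 0, and n(a, b) = 0 for all a ∈ {x, x*x}, b ∈ {y, y*y}. (For the converse direction, x + x*x is then a nonzero idempotent of S.) -/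
open QuadraticMap

section SymmetricComposition

variable {k : Type*} [Field k] {S : Type*} [AddCommGroup S] [Module k S]

/-- `mul` and `n` form a symmetric composition algebra. -/
structure IsSymmComp (mul : S →ₗ[k] S →ₗ[k] S) (n : QuadraticForm k S) : Prop where
  nondeg : ∀ x : S, (∀ y : S, polar n x y = 0) → x = 0
  comp : ∀ x y : S, n (mul x y) = n x * n y
  assoc : ∀ x y z : S, polar n (mul x y) z = polar n x (mul y z)

variable {mul : S →ₗ[k] S →ₗ[k] S} {n : QuadraticForm k S}

namespace IsSymmComp

theorem ext_polar (H : IsSymmComp mul n) {a b : S} (h : ∀ z, polar n a z = polar n b z) :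
    a = b := by
  refine sub_eq_zero.1 (H.nondeg _ fun z => ?_)
  rw [polar_sub_left, h, sub_self]

theorem norm_add (n : QuadraticForm k S) (a b : S) : n (a + b) = n a + n b + polar n a b := by
  simp only [polar]; ring

theorem polar_same (n : QuadraticForm k S) (a : S) : polar n a a = 2 * n a := by
  simp

theorem polar_mul_left (H : IsSymmComp mul n) (a b c : S) :
    polar n (mul a b) (mul a c) = n a * polar n b c := by
  simp only [polar, ← map_add, H.comp]; ring

theorem polar_mul_right (H : IsSymmComp mul n) (a b c : S) :
    polar n (mul b a) (mul c a) = n a * polar n b c := by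
  simp only [polar, ← map_add, ← LinearMap.add_apply, H.comp]; ring

theorem assoc' (H : IsSymmComp mul n) (a b c : S) :
    polar n (mul a b) c = polar n b (mul c a) := by
  rw [polar_comm, ← H.assoc, polar_comm]

/-- `(a * b) * a = n(a) b` -/
theorem mul_mul_self (H : IsSymmComp mul n) (a b : S) : mul (mul a b) a = n a • b :=
  H.ext_polar fun z => by rw [H.assoc, H.polar_mul_left, polar_smul_left, smul_eq_mul]

/-- `a * (b * a) = n(a) b` -/
theorem self_mul_mul (H : IsSymmComp mul n) (a b : S) : mul a (mul b a) = n a • b :=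
  H.ext_polar fun z => by
    rw [polar_comm, ← H.assoc, H.polar_mul_right, polar_smul_left, smul_eq_mul, polar_comm]

/-- `(a * b) * c + (c * b) * a = n(a, c) b` -/
theorem mul_mul_add (H : IsSymmComp mul n) (a b c : S) :
    mul (mul a b) c + mul (mul c b) a = polar n a c • b := by
  have h := H.mul_mul_self (a + c) b
  have ha := H.mul_mul_self a b
  have hc := H.mul_mul_self c b
  simp only [map_add, LinearMap.add_apply, norm_add] at h
  linear_combination (norm := module) h - ha - hc

/-- `a * (b * c) + c * (b * a) = n(a, c) b` -/
theorem mul_add_mul (H : IsSymmComp mul n) (a b c : S) :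
    mul a (mul b c) + mul c (mul b a) = polar n a c • b := by
  have h := H.self_mul_mul (a + c) b
  have ha := H.self_mul_mul a b
  have hc := H.self_mul_mul c b
  simp only [map_add, LinearMap.add_apply, norm_add] at h
  linear_combination (norm := module) h - ha - hc

/-- Additive expansion of the cubic map `a ↦ n(a, a * a)`. -/
theorem cubic_add (H : IsSymmComp mul n) (a b : S) :
    polar n (a + b) (mul (a + b) (a + b)) = polar n a (mul a a) + polar n b (mul b b)
      + 3 * polar n b (mul a a) + 3 * polar n a (mul b b) := by
  have h1 : polar n a (mul a b) = polar n b (mul a a) := by rw [← H.assoc, polar_comm]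
  have h2 : polar n a (mul b a) = polar n b (mul a a) := by rw [← H.assoc', polar_comm]
  have h3 : polar n b (mul b a) = polar n a (mul b b) := by rw [← H.assoc, polar_comm]
  have h4 : polar n b (mul a b) = polar n a (mul b b) := by rw [← H.assoc', polar_comm]
  simp only [map_add, LinearMap.add_apply, polar_add_left, polar_add_right]
  linear_combination h1 + h2 + h3 + h4

end IsSymmComp

/-- `x` is isotropic with `n(x, x * x) = 1`; then `x` and `x * x` span a split
two-dimensional para-Hurwitz subalgebra. -/
structure IsSplitElt (mul : S →ₗ[k] S →ₗ[k] S) (n : QuadraticForm k S) (x : S) : Prop where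
  norm : n x = 0
  cubic : polar n x (mul x x) = 1

/-- The Peirce component attached to `x`: elements orthogonal to `x` and `x * x` that `x`
annihilates from the left. -/
structure IsPeirce (mul : S →ₗ[k] S →ₗ[k] S) (n : QuadraticForm k S) (x y : S) : Prop where
  orth : polar n y x = 0
  orth_sq : polar n y (mul x x) = 0
  mul_left : mul x y = 0

namespace IsSplitElt

variable {x : S}

theorem mul_sq (h : IsSplitElt mul n x) (H : IsSymmComp mul n) : mul x (mul x x) = 0 := by
  rw [H.self_mul_mul, h.norm, zero_smul]

theorem sq_mul (h : IsSplitElt mul n x) (H : IsSymmComp mul n) : mul (mul x x) x = 0 := by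
  rw [H.mul_mul_self, h.norm, zero_smul]

theorem sq_sq (h : IsSplitElt mul n x) (H : IsSymmComp mul n) :
    mul (mul x x) (mul x x) = x := by
  have := H.mul_add_mul (mul x x) x x
  rwa [h.mul_sq H, map_zero, add_zero, polar_comm, h.cubic, one_smul] at this

theorem sq (h : IsSplitElt mul n x) (H : IsSymmComp mul n) : IsSplitElt mul n (mul x x) where
  norm := by rw [H.comp, h.norm, zero_mul]
  cubic := by rw [h.sq_sq H, polar_comm, h.cubic]

theorem polar_self (h : IsSplitElt mul n x) : polar n x x = 0 := by
  rw [IsSymmComp.polar_same, h.norm, mul_zero]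

end IsSplitElt

namespace IsPeirce

variable {x y w v : S}

theorem mul_sq (hy : IsPeirce mul n x y) (H : IsSymmComp mul n) : mul y (mul x x) = 0 := by
  have := H.mul_add_mul x x y
  rwa [hy.mul_left, map_zero, zero_add, polar_comm, hy.orth, zero_smul] at this

theorem mul_sq_mul (hy : IsPeirce mul n x y) (h : IsSplitElt mul n x) (H : IsSymmComp mul n) :
    mul (mul (mul x x) y) x = y := by
  have := H.mul_mul_add (mul x x) y x
  rwa [hy.mul_left, map_zero, LinearMap.zero_apply, add_zero, polar_comm, h.cubic,
    one_smul] at this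

theorem mul_mul (hy : IsPeirce mul n x y) (H : IsSymmComp mul n) :
    mul (mul y x) x = - mul (mul x x) y := by
  have := H.mul_mul_add y x x
  rw [hy.orth, zero_smul] at this
  exact eq_neg_of_add_eq_zero_left this

theorem mul_right (hy : IsPeirce mul n x y) (h : IsSplitElt mul n x) (H : IsSymmComp mul n) :
    IsPeirce mul n x (mul y x) where
  orth := by rw [H.assoc, hy.orth_sq]
  orth_sq := by rw [H.assoc, h.mul_sq H, polar_zero_right]
  mul_left := by rw [H.self_mul_mul, h.norm, zero_smul]

theorem sq_mul (hy : IsPeirce mul n x y) (h : IsSplitElt mul n x) (H : IsSymmComp mul n) :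
    IsPeirce mul n x (mul (mul x x) y) where
  orth := by rw [H.assoc', h.mul_sq H, polar_zero_right]
  orth_sq := by rw [H.assoc', h.sq_sq H, hy.orth]
  mul_left := by
    have := H.mul_add_mul x (mul x x) y
    rwa [h.sq_mul H, map_zero, add_zero, polar_comm, hy.orth, zero_smul] at this

theorem polar_eq_zero (hy : IsPeirce mul n x y) (hw : IsPeirce mul n x w)
    (h : IsSplitElt mul n x) (H : IsSymmComp mul n) : polar n y w = 0 := by
  rw [← hy.mul_sq_mul h H, H.assoc, hw.mul_left, polar_zero_right]

theorem norm_eq_zero (hy : IsPeirce mul n x y)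
    (h : IsSplitElt mul n x) (H : IsSymmComp mul n) : n y = 0 := by
  rw [← hy.mul_sq_mul h H, H.comp, h.norm, mul_zero]

/-- The product of two elements of a Peirce component lies in the opposite one. -/
theorem mul_mem (hy : IsPeirce mul n x y) (hw : IsPeirce mul n x w)
    (h : IsSplitElt mul n x) (H : IsSymmComp mul n) :
    IsPeirce mul n (mul x x) (mul y w) where
  orth := by rw [H.assoc, hw.mul_sq H, polar_zero_right]
  orth_sq := by rw [h.sq_sq H, H.assoc, hy.polar_eq_zero (hw.mul_right h H) h H]
  mul_left := by
    have := H.mul_add_mul (mul x x) y w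
    rwa [hy.mul_sq H, map_zero, add_zero, polar_comm, hw.orth_sq, zero_smul] at this

theorem add (hy : IsPeirce mul n x y) (hw : IsPeirce mul n x w) : IsPeirce mul n x (y + w) where
  orth := by rw [polar_add_left, hy.orth, hw.orth, add_zero]
  orth_sq := by rw [polar_add_left, hy.orth_sq, hw.orth_sq, add_zero]
  mul_left := by rw [map_add, hy.mul_left, hw.mul_left, add_zero]

theorem smul (hy : IsPeirce mul n x y) (t : k) : IsPeirce mul n x (t • y) where
  orth := by rw [polar_smul_left, hy.orth, smul_zero]
  orth_sq := by rw [polar_smul_left, hy.orth_sq, smul_zero]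
  mul_left := by rw [map_smul, hy.mul_left, smul_zero]

end IsPeirce

namespace IsSplitElt

variable {x : S}

/-- Everything is the sum of an element of the span of `x`, `x * x` and elements of the two
opposite Peirce components. -/
theorem exists_decomp (h : IsSplitElt mul n x) (H : IsSymmComp mul n) (z : S) :
    ∃ (α β : k) (y v : S), IsPeirce mul n x y ∧ IsPeirce mul n (mul x x) v ∧
      z = α • x + β • mul x x + y + v := by
  obtain ⟨z₀, hz₀⟩ : ∃ z₀, z₀ = z - polar n z (mul x x) • x - polar n z x • mul x x := ⟨_, rfl⟩
  have hx : polar n z₀ x = 0 := by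
    rw [hz₀]
    simp only [polar_sub_left, polar_smul_left, smul_eq_mul, h.polar_self,
      polar_comm n (mul x x) x, h.cubic]
    ring
  have hx' : polar n z₀ (mul x x) = 0 := by
    rw [hz₀]
    simp only [polar_sub_left, polar_smul_left, smul_eq_mul, (h.sq H).polar_self, h.cubic]
    ring
  refine ⟨polar n z (mul x x), polar n z x, mul (mul (mul x x) z₀) x,
    mul (mul x z₀) (mul x x), ⟨?_, ?_, ?_⟩, ⟨?_, ?_, ?_⟩, ?_⟩
  · rw [H.assoc, H.assoc', h.sq_sq H, polar_comm, polar_comm, hx]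
  · rw [H.assoc, h.mul_sq H, polar_zero_right]
  · rw [H.self_mul_mul, h.norm, zero_smul]
  · rw [H.assoc, h.sq_sq H, H.assoc', hx']
  · rw [h.sq_sq H, H.assoc, h.sq_mul H, polar_zero_right]
  · rw [H.self_mul_mul, (h.sq H).norm, zero_smul]
  · have := H.mul_mul_add (mul x x) z₀ x
    rw [polar_comm, h.cubic, one_smul] at this
    linear_combination (norm := module) -this - hz₀

/-- An element is determined by its pairings with `x`, `x * x` and the Peirce components. -/
theorem ext_peirce (h : IsSplitElt mul n x) (H : IsSymmComp mul n) {a b : S}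
    (hx : polar n a x = polar n b x) (hx' : polar n a (mul x x) = polar n b (mul x x))
    (hU : ∀ y, IsPeirce mul n x y → polar n a y = polar n b y)
    (hV : ∀ v, IsPeirce mul n (mul x x) v → polar n a v = polar n b v) : a = b := by
  refine H.ext_polar fun z => ?_
  obtain ⟨α, β, y, v, hy, hv, rfl⟩ := h.exists_decomp H z
  simp only [polar_add_right, polar_smul_right, hx, hx', hU y hy, hV v hv]

end IsSplitElt

namespace IsPeirce

variable {x y w v : S}

theorem of_sq_sq (hy : IsPeirce mul n (mul (mul x x) (mul x x)) y) (h : IsSplitElt mul n x)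
    (H : IsSymmComp mul n) : IsPeirce mul n x y := by
  rwa [h.sq_sq H] at hy

theorem exists_polar_eq_one (hy : IsPeirce mul n x y) (h : IsSplitElt mul n x)
    (H : IsSymmComp mul n) (h0 : y ≠ 0) : ∃ v, IsPeirce mul n (mul x x) v ∧ polar n y v = 1 := by
  by_contra! hc
  refine h0 (h.ext_peirce H ?_ ?_ (fun w hw => ?_) fun v hv => ?_)
  · rw [hy.orth, polar_zero_left]
  · rw [hy.orth_sq, polar_zero_left]
  · rw [hy.polar_eq_zero hw h H, polar_zero_left]
  · by_contra hne
    rw [polar_zero_left] at hne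
    refine hc ((polar n y v)⁻¹ • v) (hv.smul _) ?_
    rw [polar_smul_right, smul_eq_mul, inv_mul_cancel₀ hne]

/-- Two elements of a Peirce component agree if they pair equally with the opposite one. -/
theorem ext (hy : IsPeirce mul n x y) (hw : IsPeirce mul n x w) (h : IsSplitElt mul n x)
    (H : IsSymmComp mul n)
    (hV : ∀ v, IsPeirce mul n (mul x x) v → polar n y v = polar n w v) : y = w := by
  refine h.ext_peirce H ?_ ?_ (fun u hu => ?_) hV
  · rw [hy.orth, hw.orth]
  · rw [hy.orth_sq, hw.orth_sq]
  · rw [hy.polar_eq_zero hu h H, hw.polar_eq_zero hu h H]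

/-- The product of elements of opposite Peirce components is a multiple of `x`. -/
theorem mul_opposite (hy : IsPeirce mul n x y) (hv : IsPeirce mul n (mul x x) v)
    (h : IsSplitElt mul n x) (H : IsSymmComp mul n) :
    mul y v = polar n y (mul v (mul x x)) • x := by
  have hvx : mul v x = 0 := by simpa only [h.sq_sq H] using hv.mul_sq H
  have h' := h.sq H
  refine h.ext_peirce H ?_ ?_ (fun w hw => ?_) fun u hu => ?_
  · rw [H.assoc, hvx, polar_smul_left, h.polar_self, polar_zero_right, smul_zero]
  · rw [H.assoc, polar_smul_left, h.cubic, smul_eq_mul, mul_one]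
  · rw [H.assoc', polar_smul_left, polar_comm n x, hw.orth, smul_zero,
      hv.polar_eq_zero (hw.mul_mem hy h H) h' H]
  · rw [H.assoc, polar_smul_left, polar_comm n x, ← h.sq_sq H, hu.orth_sq, smul_zero,
      hy.polar_eq_zero ((hv.mul_mem hu h' H).of_sq_sq h H) h H]

/-- Elements of square zero in a Peirce component are eigenvectors of right multiplication
by `x`. -/
theorem exists_mul_eq_smul (hy : IsPeirce mul n x y) (h : IsSplitElt mul n x)
    (H : IsSymmComp mul n) (hyy : mul y y = 0) : ∃ t : k, mul y x = t • y := by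
  by_cases h0 : y = 0
  · exact ⟨0, by simp [h0]⟩
  obtain ⟨v, hv, hyv⟩ := hy.exists_polar_eq_one h H h0
  have h1 := H.mul_add_mul v y y
  rw [hyy, map_zero, zero_add, hy.mul_opposite hv h H, polar_comm n v, hyv, one_smul, map_smul] at h1
  have hc : polar n y (mul v (mul x x)) ≠ 0 := by
    intro hc
    rw [hc, zero_smul] at h1
    exact h0 h1.symm
  refine ⟨(polar n y (mul v (mul x x)))⁻¹, ?_⟩
  exact (eq_inv_smul_iff₀ hc).2 h1

end IsPeirce

namespace IsSplitElt

variable {x : S}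

/-- If all squares in the Peirce component vanish, right multiplication by `x` is a scalar on
it. -/
theorem exists_scalar (h : IsSplitElt mul n x) (H : IsSymmComp mul n)
    (hsq : ∀ y, IsPeirce mul n x y → mul y y = 0) :
    ∃ a : k, a ^ 3 = -1 ∧ ∀ y, IsPeirce mul n x y → mul y x = a • y := by
  by_cases hU : ∀ y, IsPeirce mul n x y → y = 0
  · exact ⟨-1, by ring, fun y hy => by simp [hU y hy]⟩
  push Not at hU
  obtain ⟨w, hw, hw0⟩ := hU
  obtain ⟨a, ha⟩ := hw.exists_mul_eq_smul h H (hsq w hw)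
  refine ⟨a, ?_, fun y hy => ?_⟩
  · have h1 := hw.mul_sq_mul h H
    rw [← neg_eq_iff_eq_neg.2 (hw.mul_mul H)] at h1
    simp only [ha, map_smul, map_neg, LinearMap.smul_apply, LinearMap.neg_apply, smul_smul] at h1
    have h2 : (a ^ 3 + 1) • w = 0 := by linear_combination (norm := module) -h1
    exact eq_neg_of_add_eq_zero_left ((smul_eq_zero.1 h2).resolve_right hw0)
  · obtain ⟨b, hb⟩ := hy.exists_mul_eq_smul h H (hsq y hy)
    obtain ⟨c, hc⟩ := (hy.add hw).exists_mul_eq_smul h H (hsq _ (hy.add hw))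
    rw [map_add, LinearMap.add_apply, ha, hb] at hc
    have h1 : (b - c) • y = (c - a) • w := by linear_combination (norm := module) hc
    by_cases hbc : b = c
    · rw [hbc, sub_self, zero_smul] at h1
      have := (smul_eq_zero.1 h1.symm).resolve_right hw0
      rw [hb, hbc, sub_eq_zero.1 this]
    · have hy' : y = ((b - c)⁻¹ * (c - a)) • w := by
        rw [mul_smul, ← h1, smul_smul, inv_mul_cancel₀ (sub_ne_zero.2 hbc), one_smul]
      rw [hy', map_smul, LinearMap.smul_apply, ha, smul_comm]

/-- If right multiplication by `x` is a scalar on the Peirce component, there is a para-unit. -/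
theorem exists_paraUnit (h : IsSplitElt mul n x) (H : IsSymmComp mul n) {a : k}
    (ha : a ^ 3 = -1) (hU : ∀ y, IsPeirce mul n x y → mul y x = a • y) :
    ∃ e : S, ∀ z : S, mul e z = polar n e z • e - z ∧ mul z e = polar n e z • e - z := by
  have h' := h.sq H
  have hU' : ∀ y, IsPeirce mul n x y → mul (mul x x) y = -(a ^ 2) • y := fun y hy => by
    have h1 := hy.mul_mul H
    rw [hU y hy, map_smul, LinearMap.smul_apply, hU y hy] at h1
    linear_combination (norm := module) h1
  have hV : ∀ v, IsPeirce mul n (mul x x) v → mul v (mul x x) = -(a ^ 2) • v := fun v hv => by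
    refine (hv.mul_right h' H).ext (hv.smul _) h' H fun y hy => ?_
    have hy := hy.of_sq_sq h H
    rw [H.assoc, hU' y hy, polar_smul_left, polar_smul_right]
  have hV' : ∀ v, IsPeirce mul n (mul x x) v → mul x v = a • v := fun v hv => by
    have := hv.sq_mul h' H
    rw [h.sq_sq H] at this
    refine this.ext (hv.smul _) h' H fun y hy => ?_
    have hy := hy.of_sq_sq h H
    rw [H.assoc', hU y hy, polar_smul_left, polar_smul_right]
  refine ⟨a ^ 2 • x - a • mul x x, fun z => ?_⟩
  obtain ⟨α, β, y, v, hy, hv, rfl⟩ := h.exists_decomp H z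
  have hvx : mul v x = 0 := by simpa only [h.sq_sq H] using hv.mul_sq H
  have e1 : polar n x v = 0 := by rw [polar_comm, ← h.sq_sq H, hv.orth_sq]
  have e2 : polar n (mul x x) v = 0 := by rw [polar_comm, hv.orth]
  have e3 : polar n x y = 0 := by rw [polar_comm, hy.orth]
  have e4 : polar n (mul x x) y = 0 := by rw [polar_comm, hy.orth_sq]
  have e5 : polar n (mul x x) x = 1 := by rw [polar_comm, h.cubic]
  have a4 : a ^ 4 = -a := by linear_combination a * ha
  simp only [map_add, map_sub, map_smul, LinearMap.add_apply, LinearMap.sub_apply,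
    LinearMap.smul_apply, polar_add_right, polar_sub_left, polar_smul_left, polar_smul_right,
    smul_eq_mul, e1, e2, e3, e4, e5, h.cubic, h.polar_self, h'.polar_self, hvx, hy.mul_left,
    hv.mul_left, hU y hy, hU' y hy, hV v hv, hV' v hv, hy.mul_sq H, h.mul_sq H, h.sq_mul H,
    h.sq_sq H]
  constructor
  · match_scalars
    · linear_combination β * ha
    · linear_combination α * ha - β * a4
    · linear_combination ha
    · linear_combination ha
  · match_scalars
    · linear_combination β * ha
    · linear_combination ha
    · linear_combination α * ha - β * a4
    · linear_combination ha

/-- In characteristic not three, if the cubic map vanishes on a Peirce component, so does the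
squaring map. -/
theorem mul_self_eq_zero (h : IsSplitElt mul n x) (H : IsSymmComp mul n) (h3 : (3 : k) ≠ 0)
    (hg : ∀ y, IsPeirce mul n x y → polar n y (mul y y) = 0) {y : S}
    (hy : IsPeirce mul n x y) : mul y y = 0 := by
  have hq : ∀ a b, IsPeirce mul n x a → IsPeirce mul n x b →
      polar n b (mul a a) + polar n a (mul b b) = 0 := fun a b ha hb => by
    have h1 := H.cubic_add a b
    rw [hg _ (ha.add hb), hg _ ha, hg _ hb] at h1
    refine (mul_eq_zero.1 ?_).resolve_left h3
    linear_combination -h1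
  have hanti : ∀ a b, IsPeirce mul n x a → IsPeirce mul n x b →
      mul a b + mul b a = 0 := fun a b ha hb => by
    refine h.ext_peirce H ?_ ?_ (fun c hc => ?_) fun v hv => ?_
    · have h1 := ((ha.mul_mem hb h H).add (hb.mul_mem ha h H)).orth_sq
      rw [h.sq_sq H] at h1
      rw [h1, polar_zero_left]
    · rw [((ha.mul_mem hb h H).add (hb.mul_mem ha h H)).orth, polar_zero_left]
    · have h1 := hq _ c (ha.add hb) hc
      have h2 := hq _ c ha hc
      have h4 := hq _ c hb hc
      simp only [map_add, LinearMap.add_apply, polar_add_left, polar_add_right] at h1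
      rw [polar_zero_left, polar_comm, polar_add_right]
      linear_combination h1 - h2 - h4
    · rw [((ha.mul_mem hb h H).add (hb.mul_mem ha h H)).polar_eq_zero hv (h.sq H) H,
        polar_zero_left]
  have key : ∀ a, IsPeirce mul n x a → mul (mul a x) (mul a x) = 0 := fun a ha => by
    have hw := (ha.mul_right h H).mul_right h H
    have h1 := H.mul_mul_add a x (mul a x)
    rw [ha.polar_eq_zero (ha.mul_right h H) h H, zero_smul] at h1
    have h2 := hanti _ _ hw ha
    have h4 := H.mul_mul_self (mul (mul a x) x) x
    have h5 : mul (mul (mul a x) x) x = -a := by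
      rw [ha.mul_mul H, map_neg, LinearMap.neg_apply, ha.mul_sq_mul h H]
    rw [h5, hw.norm_eq_zero h H, zero_smul, map_neg, LinearMap.neg_apply] at h4
    linear_combination (norm := module) h1 - h2 - h4
  rw [← hy.mul_sq_mul h H]
  exact key _ (hy.sq_mul h H)

/-- A symmetric composition algebra without para-unit that contains an element `x` as in
`IsSplitElt` contains such an element whose Peirce component carries a nonzero cubic form. -/
theorem exists_cubic_ne_zero (h : IsSplitElt mul n x) (H : IsSymmComp mul n)
    (hno : ¬ ∃ e : S, ∀ z : S, mul e z = polar n e z • e - z ∧ mul z e = polar n e z • e - z) :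
    ∃ x y : S, IsSplitElt mul n x ∧ IsPeirce mul n x y ∧ polar n y (mul y y) ≠ 0 := by
  by_contra! hc
  have hs : ∃ s, IsPeirce mul n x s ∧ mul s s ≠ 0 := by
    by_contra! hs
    obtain ⟨a, ha, hU⟩ := h.exists_scalar H hs
    exact hno (h.exists_paraUnit H ha hU)
  obtain ⟨s, hs, hss⟩ := hs
  by_cases h3 : (3 : k) = 0
  swap
  · exact hss (h.mul_self_eq_zero H h3 (fun y hy => hc x y h hy) hs)
  have h' := h.sq H
  obtain ⟨w, hw, hw1⟩ := (hs.mul_mem hs h H).exists_polar_eq_one h' H hss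
  have hw := hw.of_sq_sq h H
  have hadd : ∀ a b : S, polar n (a + b) (mul (a + b) (a + b))
      = polar n a (mul a a) + polar n b (mul b b) := fun a b => by
    rw [H.cubic_add, h3]; ring
  have hsx := hs.mul_right h H
  have hxs : IsSplitElt mul n (x + s) := by
    constructor
    · rw [IsSymmComp.norm_add, h.norm, hs.norm_eq_zero h H, polar_comm, hs.orth]; ring
    · rw [hadd, h.cubic, hc x s h hs, add_zero]
  have hsq : mul (x + s) (x + s) = mul x x + mul s x + mul s s := by
    simp only [map_add, LinearMap.add_apply, hs.mul_left]; abel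
  have hy : mul (w - x) (x + s) = mul w x + mul w s + -mul x x := by
    simp only [map_add, map_sub, LinearMap.sub_apply, hs.mul_left]; abel
  have hp : IsPeirce mul n (x + s) (mul (w - x) (x + s)) := by
    refine ⟨?_, ?_, ?_⟩
    · have h1 := (hs.mul_mem hs h H).orth_sq
      rw [h.sq_sq H, polar_comm] at h1
      rw [H.assoc, hsq]
      simp only [polar_add_right, polar_sub_left, hw.orth_sq, h.cubic,
        hw.polar_eq_zero hsx h H, polar_comm n x (mul s x), hsx.orth, h1, polar_comm n w, hw1]
      ring
    · rw [H.assoc, hxs.mul_sq H, polar_zero_right]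
    · rw [H.self_mul_mul, hxs.norm, zero_smul]
  have h1 := hc _ _ hxs hp
  rw [hy, hadd, hadd, hc _ _ h (hw.mul_right h H), hc _ _ h' (hw.mul_mem hs h H)] at h1
  simp [h.sq_sq H, polar_comm n _ x, h.cubic] at h1

/-- `x + x * x` is a nonzero idempotent. -/
theorem add_sq (h : IsSplitElt mul n x) (H : IsSymmComp mul n) :
    x + mul x x ≠ 0 ∧ mul (x + mul x x) (x + mul x x) = x + mul x x := by
  constructor
  · intro h0
    have h1 := h.polar_self
    have h2 := h.cubic
    have h4 : polar n x (x + mul x x) = 1 := by rw [polar_add_right, h1, h2, zero_add]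
    rw [h0, polar_zero_right] at h4
    exact zero_ne_one h4
  · simp only [map_add, LinearMap.add_apply, h.mul_sq H, h.sq_mul H, h.sq_sq H]
    abel

end IsSplitElt

/-- `e` is an idempotent of norm one. -/
structure IsNormOneIdem (mul : S →ₗ[k] S →ₗ[k] S) (n : QuadraticForm k S) (e : S) : Prop where
  idem : mul e e = e
  norm : n e = 1

/-- The element `f` satisfies the para-unit law with respect to `e`; equivalently, it commutes
with the idempotent `e`. -/
structure IsFixed (mul : S →ₗ[k] S →ₗ[k] S) (n : QuadraticForm k S) (e f : S) : Prop where
  left : mul e f = polar n e f • e - f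
  right : mul f e = polar n e f • e - f

/-- The element `u` is orthogonal to `e` and in the kernel of `1 + τ + τ²`, where `τ` is the
order three automorphism `u ↦ e * (e * u)`. -/
structure IsTraceless (mul : S →ₗ[k] S →ₗ[k] S) (n : QuadraticForm k S) (e u : S) : Prop where
  orth : polar n e u = 0
  left_add_right : mul e u + mul u e = u

/-- The map `1 + τ + τ²`, where `τ` is the order three automorphism `z ↦ e * (e * z)`. -/
def orbitSum (mul : S →ₗ[k] S →ₗ[k] S) (n : QuadraticForm k S) (e z : S) : S :=
  z + (2 * polar n e z) • e - mul e z - mul z e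

namespace IsNormOneIdem

variable {e : S}

theorem of_ne_zero (H : IsSymmComp mul n) (h0 : e ≠ 0) (he : mul e e = e) :
    IsNormOneIdem mul n e := by
  refine ⟨he, ?_⟩
  have h1 := H.mul_mul_self e e
  rw [he, he] at h1
  have h2 : (n e - 1) • e = 0 := by rw [sub_smul, one_smul, ← h1, sub_self]
  exact sub_eq_zero.1 ((smul_eq_zero.1 h2).resolve_right h0)

theorem polar_self (he : IsNormOneIdem mul n e) : polar n e e = 2 := by
  rw [IsSymmComp.polar_same, he.norm, mul_one]

theorem mul_mul (he : IsNormOneIdem mul n e) (H : IsSymmComp mul n) (z : S) :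
    mul (mul e z) e = z := by rw [H.mul_mul_self, he.norm, one_smul]

theorem mul_mul' (he : IsNormOneIdem mul n e) (H : IsSymmComp mul n) (z : S) :
    mul e (mul z e) = z := by rw [H.self_mul_mul, he.norm, one_smul]

theorem left_left (he : IsNormOneIdem mul n e) (H : IsSymmComp mul n) (z : S) :
    mul e (mul e z) = polar n e z • e - mul z e := by
  have := H.mul_add_mul e e z
  rw [he.idem] at this
  exact eq_sub_of_add_eq this

theorem right_right (he : IsNormOneIdem mul n e) (H : IsSymmComp mul n) (z : S) :
    mul (mul z e) e = polar n e z • e - mul e z := by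
  have := H.mul_mul_add e e z
  rw [he.idem] at this
  exact eq_sub_of_add_eq' this

theorem polar_left (he : IsNormOneIdem mul n e) (H : IsSymmComp mul n) (z : S) :
    polar n e (mul e z) = polar n e z := by rw [← H.assoc, he.idem]

theorem polar_right (he : IsNormOneIdem mul n e) (H : IsSymmComp mul n) (z : S) :
    polar n e (mul z e) = polar n e z := by rw [← H.assoc', he.idem, polar_comm]

theorem polar_orbitSum (he : IsNormOneIdem mul n e) (H : IsSymmComp mul n) (z : S) :
    polar n e (orbitSum mul n e z) = 3 * polar n e z := by
  simp only [orbitSum, polar_add_right, polar_sub_right, polar_smul_right, smul_eq_mul,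
    he.polar_self, he.polar_left H, he.polar_right H]
  ring

theorem isFixed_orbitSum (he : IsNormOneIdem mul n e) (H : IsSymmComp mul n) (z : S) :
    IsFixed mul n e (orbitSum mul n e z) := by
  constructor <;> rw [he.polar_orbitSum H] <;>
  · simp only [orbitSum, map_add, map_sub, map_smul, LinearMap.add_apply, LinearMap.sub_apply,
      LinearMap.smul_apply, he.idem, he.left_left H, he.right_right H, he.mul_mul H,
      he.mul_mul' H]
    module

theorem polar_orbitSum_comm (H : IsSymmComp mul n) (a b : S) :
    polar n (orbitSum mul n e a) b = polar n a (orbitSum mul n e b) := by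
  simp only [orbitSum, polar_add_left, polar_sub_left, polar_smul_left, polar_add_right,
    polar_sub_right, polar_smul_right, smul_eq_mul, H.assoc a e b, H.assoc' e a b,
    polar_comm n a e]
  ring

theorem orbitSum_of_isFixed {f : S} (hf : IsFixed mul n e f) : orbitSum mul n e f = (3 : k) • f := by
  rw [orbitSum, hf.left, hf.right]; module

/-- A traceless element of norm `-1` produces an element as in `IsSplitElt`. -/
theorem isSplitElt (he : IsNormOneIdem mul n e) (H : IsSymmComp mul n) {u : S}
    (hu : IsTraceless mul n e u) (hn : n u = -1) : IsSplitElt mul n (-(e + u)) := by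
  have h1 : polar n (mul e u) (mul u e) = -polar n e (mul u u) := by
    rw [polar_comm, H.assoc, he.left_left H, hu.orth, zero_smul, zero_sub, polar_neg_right,
      ← H.assoc, polar_comm]
  have h2 : polar n e (mul u u) = -1 := by
    have := IsSymmComp.norm_add n (mul e u) (mul u e)
    rw [hu.left_add_right, H.comp, H.comp, he.norm, hn, h1] at this
    linear_combination this
  have h4 : polar n u (mul u u) = 0 := by
    have h5 : polar n u (mul u u) = polar n (mul e u + mul u e) (mul u u) := by
      rw [hu.left_add_right]
    rw [h5, polar_add_left, H.assoc, H.self_mul_mul, polar_comm n (mul u e), ← H.assoc,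
      H.mul_mul_self, polar_smul_right, polar_smul_left, polar_comm n u e, hu.orth]
    simp
  have h5 : mul (e + u) (e + u) = e + u + mul u u := by
    simp only [map_add, LinearMap.add_apply, he.idem]
    linear_combination (norm := module) hu.left_add_right
  have h6 : n (e + u) = 0 := by
    rw [IsSymmComp.norm_add, he.norm, hn, hu.orth]; ring
  constructor
  · rw [QuadraticMap.map_neg, h6]
  · rw [map_neg, LinearMap.map_neg₂, neg_neg, polar_neg_left, h5, polar_add_right,
      IsSymmComp.polar_same, h6, polar_add_left, h2, h4]
    ring

end IsNormOneIdem

namespace IsTraceless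

variable {e u w : S}

theorem add (hu : IsTraceless mul n e u) (hw : IsTraceless mul n e w) :
    IsTraceless mul n e (u + w) where
  orth := by rw [polar_add_right, hu.orth, hw.orth, add_zero]
  left_add_right := by
    simp only [map_add, LinearMap.add_apply]
    linear_combination (norm := module) hu.left_add_right + hw.left_add_right

theorem smul (hu : IsTraceless mul n e u) (t : k) : IsTraceless mul n e (t • u) where
  orth := by rw [polar_smul_right, hu.orth, smul_zero]
  left_add_right := by
    simp only [map_smul, LinearMap.smul_apply, ← smul_add, hu.left_add_right]

theorem of_orbitSum (ho : polar n e u = 0) (hs : orbitSum mul n e u = 0) :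
    IsTraceless mul n e u where
  orth := ho
  left_add_right := by
    rw [orbitSum, ho] at hs
    linear_combination (norm := module) -hs

end IsTraceless

namespace IsFixed

variable {e f g u : S}

theorem add (hf : IsFixed mul n e f) (hg : IsFixed mul n e g) : IsFixed mul n e (f + g) := by
  constructor <;>
  simp only [map_add, LinearMap.add_apply, polar_add_right, hf.left, hg.left, hf.right,
    hg.right] <;> module

theorem smul (hf : IsFixed mul n e f) (t : k) : IsFixed mul n e (t • f) := by
  constructor <;>
  simp only [map_smul, LinearMap.smul_apply, polar_smul_right, hf.left, hf.right,
    smul_eq_mul] <;> module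

theorem polar_eq_zero (hf : IsFixed mul n e f) (hu : IsTraceless mul n e u)
    (H : IsSymmComp mul n) (h3 : (3 : k) ≠ 0) : polar n f u = 0 := by
  have h1 : polar n f u = polar n f (mul e u) + polar n f (mul u e) := by
    rw [← polar_add_right, hu.left_add_right]
  rw [← H.assoc, ← H.assoc', hf.left, hf.right, polar_sub_left, polar_smul_left,
    hu.orth] at h1
  refine (mul_eq_zero.1 ?_).resolve_left h3
  simp only [smul_zero] at h1
  linear_combination h1

theorem mul_traceless (hf : IsFixed mul n e f) (hu : IsTraceless mul n e u)
    (H : IsSymmComp mul n) (h3 : (3 : k) ≠ 0) : IsTraceless mul n e (mul f u) := by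
  have h0 := hf.polar_eq_zero hu H h3
  constructor
  · rw [← H.assoc, hf.left, polar_sub_left, polar_smul_left, hu.orth, h0]; simp
  · have h1 := H.mul_add_mul e f u
    have h2 := H.mul_mul_add f u e
    have h4 := H.mul_mul_add u e f
    rw [hu.orth, hf.right] at h1
    rw [polar_comm] at h2
    rw [polar_comm, h0, hf.right] at h4
    have h5 : mul (mul e u) f + mul (mul u e) f = mul u f := by
      rw [← LinearMap.add_apply, ← map_add, hu.left_add_right]
    have h6 := congrArg (polar n e f • ·) hu.left_add_right
    simp only [map_sub, map_smul, LinearMap.sub_apply, LinearMap.smul_apply, smul_add] at h1 h2 h4 h6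
    linear_combination (norm := module) h1 + h2 + h4 - h5 - h6

end IsFixed

namespace IsNormOneIdem

variable {e : S}

theorem exists_traceless_of_ne (he : IsNormOneIdem mul n e) (H : IsSymmComp mul n)
    (h3 : (3 : k) ≠ 0)
    (hno : ¬ ∃ e : S, ∀ z : S, mul e z = polar n e z • e - z ∧ mul z e = polar n e z • e - z)
    {z : S} (hz0 : z ≠ 0) (hz : n z = 0) : ∃ u, IsTraceless mul n e u ∧ n u = -1 := by
  have htl : ∀ z, IsTraceless mul n e ((3 : k) • z - orbitSum mul n e z) := fun z => by
    have hf := he.isFixed_orbitSum H z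
    constructor
    · rw [polar_sub_right, he.polar_orbitSum H, polar_smul_right, smul_eq_mul, sub_self]
    · simp only [map_sub, map_smul, LinearMap.sub_apply, LinearMap.smul_apply, hf.left, hf.right,
        he.polar_orbitSum H]
      rw [orbitSum]
      module
  have hperp : ∀ {f u}, IsFixed mul n e f → IsTraceless mul n e u → polar n f u = 0 :=
    fun hf hu => hf.polar_eq_zero hu H h3
  have hsplit : ∀ s : S, ∃ f u, IsFixed mul n e f ∧ IsTraceless mul n e u ∧ s = f + u :=
    fun s => ⟨(3 : k)⁻¹ • orbitSum mul n e s, (3 : k)⁻¹ • ((3 : k) • s - orbitSum mul n e s),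
      (he.isFixed_orbitSum H s).smul _, (htl s).smul _, by
        rw [smul_sub, smul_smul, inv_mul_cancel₀ h3]; module⟩
  have hmul : ∀ {f u}, IsFixed mul n e f → IsTraceless mul n e u → n f ≠ 0 → n u = - n f →
      ∃ u, IsTraceless mul n e u ∧ n u = -1 := fun {f u} hf hu h0 hn => by
    refine ⟨(n f)⁻¹ • mul f u, (hf.mul_traceless hu H h3).smul _, ?_⟩
    rw [QuadraticMap.map_smul, H.comp, hn, smul_eq_mul]
    field_simp
  obtain ⟨q, p, hq, hp, rfl⟩ := hsplit z
  rw [IsSymmComp.norm_add, hperp hq hp, add_zero] at hz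
  by_cases hq0 : n q = 0
  swap
  · exact hmul hq hp hq0 (eq_neg_of_add_eq_zero_right hz)
  have hp0 : n p = 0 := by rw [hq0, zero_add] at hz; exact hz
  by_cases hp' : p = 0
  · have hW : ∃ w, IsTraceless mul n e w ∧ n w ≠ 0 := by
      by_contra! hW
      refine hno ⟨e, fun z => ?_⟩
      suffices h : IsFixed mul n e z from ⟨h.left, h.right⟩
      obtain ⟨f, u, hf, hu, rfl⟩ := hsplit z
      suffices h : u = 0 by rwa [h, add_zero]
      refine H.nondeg u fun s => ?_
      obtain ⟨g, w, hg, hw, rfl⟩ := hsplit s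
      have := IsSymmComp.norm_add n u w
      rw [hW _ (hu.add hw), hW _ hu, hW _ hw] at this
      rw [polar_add_right, polar_comm, hperp hg hu]
      linear_combination -this
    obtain ⟨w, hw, hw0⟩ := hW
    have hr : ∃ r, IsFixed mul n e r ∧ polar n q r ≠ 0 := by
      by_contra! hr
      have hq' : q = 0 := H.nondeg q fun s => by
        obtain ⟨g, w, hg, hw, rfl⟩ := hsplit s
        rw [polar_add_right, hr g hg, hperp hq hw, add_zero]
      exact hz0 (by rw [hq', hp', add_zero])
    obtain ⟨r, hr, hqr⟩ := hr
    have hn : n (((-n w - n r) * (polar n q r)⁻¹) • q + r) = -n w := by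
      rw [IsSymmComp.norm_add, QuadraticMap.map_smul, polar_smul_left, hq0, smul_eq_mul,
        smul_eq_mul, mul_assoc _ _ (polar n q r), inv_mul_cancel₀ hqr]
      ring
    exact hmul ((hq.smul _).add hr) hw (by rw [hn]; exact neg_ne_zero.2 hw0) (by rw [hn, neg_neg])
  · have hr : ∃ r, IsTraceless mul n e r ∧ polar n p r ≠ 0 := by
      by_contra! hr
      refine hp' (H.nondeg p fun s => ?_)
      obtain ⟨g, w, hg, hw, rfl⟩ := hsplit s
      rw [polar_add_right, hr w hw, polar_comm, hperp hg hp, add_zero]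
    obtain ⟨r, hr, hpr⟩ := hr
    refine ⟨((-1 - n r) * (polar n p r)⁻¹) • p + r, (hp.smul _).add hr, ?_⟩
    rw [IsSymmComp.norm_add, QuadraticMap.map_smul, polar_smul_left, hp0, smul_eq_mul,
      smul_eq_mul, mul_assoc _ _ (polar n p r), inv_mul_cancel₀ hpr]
    ring

/-- Characteristic three: an isotropic element killed by `1 + τ + τ²` and not orthogonal to `e`
suffices. -/
theorem exists_traceless_of_isotropic (he : IsNormOneIdem mul n e)
    (h3 : (3 : k) = 0) {c : k} (hc : c ≠ 0) {z : S} (hz : n z = 0) (hez : polar n e z = c)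
    (hsum : orbitSum mul n e z = 0) : ∃ u, IsTraceless mul n e u ∧ n u = -1 := by
  refine ⟨e + c⁻¹ • z, .of_orbitSum ?_ ?_, ?_⟩
  · rw [polar_add_right, polar_smul_right, hez, he.polar_self, smul_eq_mul, inv_mul_cancel₀ hc]
    linear_combination h3
  · have h1 := congrArg (c⁻¹ • ·) hsum
    have h2 : (3 : k) • e = 0 := by rw [h3, zero_smul]
    simp only [orbitSum, smul_zero] at h1
    simp only [orbitSum, map_add, map_smul, LinearMap.add_apply, LinearMap.smul_apply, he.idem,
      polar_add_right, polar_smul_right, he.polar_self, smul_eq_mul]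
    linear_combination (norm := module) h1 + h2
  · rw [IsSymmComp.norm_add, QuadraticMap.map_smul, polar_smul_right, hz, hez, he.norm,
      smul_eq_mul, smul_eq_mul, inv_mul_cancel₀ hc]
    linear_combination h3

theorem exists_traceless_of_eq (he : IsNormOneIdem mul n e) (H : IsSymmComp mul n)
    (h3 : (3 : k) = 0) {z : S} (hz0 : z ≠ 0) (hz : n z = 0) :
    ∃ u, IsTraceless mul n e u ∧ n u = -1 := by
  have h2 : (2 : k) ≠ 0 := fun h2 => one_ne_zero (α := k) (by linear_combination h3 - h2)
  by_cases ha : ∃ a, polar n a (orbitSum mul n e a) ≠ 0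
  · obtain ⟨a, ha⟩ := ha
    obtain ⟨f, hfa⟩ : ∃ f, f = orbitSum mul n e a := ⟨_, rfl⟩
    have hf : IsFixed mul n e f := hfa ▸ he.isFixed_orbitSum H a
    rw [← hfa] at ha
    have hef : polar n e f = 0 := by rw [hfa, he.polar_orbitSum H, h3, zero_mul]
    have hl : mul e f = -f := by rw [hf.left, hef, zero_smul, zero_sub]
    have hr : mul f e = -f := by rw [hf.right, hef, zero_smul, zero_sub]
    have hnf : n f = 0 := by
      have h1 : polar n f f = 0 := by
        nth_rw 1 [hfa]
        rw [polar_orbitSum_comm H, orbitSum_of_isFixed hf, h3, zero_smul, polar_zero_right]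
      rw [IsSymmComp.polar_same] at h1
      exact (mul_eq_zero.1 h1).resolve_left h2
    have hff : mul f f = 0 := by
      have h1 := H.mul_mul_add f f e
      have h4 := he.left_left H (mul f f)
      have h5 : polar n e (mul f f) = 0 := by
        rw [← H.assoc, hl, polar_neg_left, IsSymmComp.polar_same, hnf]; simp
      have h6 := H.mul_add_mul e f f
      rw [hl, polar_comm, hef] at h1
      rw [hr, hef] at h6
      simp only [map_neg, LinearMap.neg_apply, zero_smul] at h1 h6
      have h7 : mul e (mul f f) = mul f f := by linear_combination (norm := module) h6
      have h8 : mul (mul f f) e = mul f f := by linear_combination (norm := module) h1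
      rw [h7, h7, h5, h8, zero_smul, zero_sub] at h4
      have h9 : (2 : k) • mul f f = 0 := by linear_combination (norm := module) h4
      exact (smul_eq_zero.1 h9).resolve_left h2
    refine he.exists_traceless_of_isotropic h3 (c := -polar n a f) (neg_ne_zero.2 ha)
      (z := mul f a) ?_ ?_ ?_
    · rw [H.comp, hnf, zero_mul]
    · rw [← H.assoc, hl, polar_neg_left, polar_comm]
    · have e1 := H.mul_add_mul e f a
      have e2 := H.mul_mul_add f a e
      have e3 : polar n e (mul f a) = -polar n a f := by
        rw [← H.assoc, hl, polar_neg_left, polar_comm]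
      have e4 := H.mul_mul_add a e f
      have e5 : mul f f = mul (orbitSum mul n e a) f := by rw [← hfa]
      have e6 : (3 : k) • (polar n e a • f) = 0 := by rw [h3, zero_smul]
      have e7 : (3 : k) • (polar n a f • e) = 0 := by rw [h3, zero_smul]
      rw [hr] at e1 e4
      rw [polar_comm, hef] at e2
      simp only [hff, orbitSum, map_add, map_sub, map_smul, LinearMap.add_apply,
        LinearMap.sub_apply, LinearMap.smul_apply, hl, map_neg, LinearMap.neg_apply] at e1 e2 e4 e5
      rw [orbitSum, e3]
      linear_combination (norm := module) -e1 - e2 - e4 + e5 - e6 - e7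
  · push Not at ha
    have hzero : ∀ a, orbitSum mul n e a = 0 := fun a => by
      refine H.nondeg _ fun b => ?_
      have h1 := ha (a + b)
      have hadd : orbitSum mul n e (a + b) = orbitSum mul n e a + orbitSum mul n e b := by
        simp only [orbitSum, map_add, LinearMap.add_apply, polar_add_right]; module
      rw [hadd] at h1
      simp only [polar_add_left, polar_add_right, ha] at h1
      rw [← polar_orbitSum_comm H a b, polar_comm n b] at h1
      refine (mul_eq_zero.1 ?_).resolve_left h2
      linear_combination h1
    have hez : mul e z ≠ 0 := fun h0 => hz0 (by
      rw [← he.mul_mul H z, h0, map_zero, LinearMap.zero_apply])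
    obtain ⟨r, hr⟩ : ∃ r, polar n (mul e z) r ≠ 0 := by
      by_contra! hr
      exact hez (H.nondeg _ hr)
    exact he.exists_traceless_of_isotropic h3 hr (z := mul z r) (by rw [H.comp, hz, zero_mul])
      (H.assoc e z r).symm (hzero _)

/-- An isotropic symmetric composition algebra without para-unit and with a nonzero idempotent
contains an element as in `IsSplitElt`. -/
theorem exists_isSplitElt (he : IsNormOneIdem mul n e) (H : IsSymmComp mul n)
    (hno : ¬ ∃ e : S, ∀ z : S, mul e z = polar n e z • e - z ∧ mul z e = polar n e z • e - z)
    {z : S} (hz0 : z ≠ 0) (hz : n z = 0) : ∃ x, IsSplitElt mul n x := by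
  obtain ⟨u, hu, hn⟩ : ∃ u, IsTraceless mul n e u ∧ n u = -1 := by
    by_cases h3 : (3 : k) = 0
    · exact he.exists_traceless_of_eq H h3 hz0 hz
    · exact he.exists_traceless_of_ne H h3 hno hz0 hz
  exact ⟨_, he.isSplitElt H hu hn⟩

end IsNormOneIdem

end SymmetricComposition

/-- an Okubo algebra has isotropic norm and a nonzero idempotent
if and only if it contains a "standard pair" `(x, y)` with `n(x, x*x) = 1`.
For the converse direction, `x + x*x` is a nonzero idempotent. -/
theorem okubo_isotropic_with_idempotent_iff
    {k : Type*} [Field k] {S : Type*} [AddCommGroup S] [Module k S]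
    (mul : S →ₗ[k] S →ₗ[k] S) (n : QuadraticForm k S)
    (hnondeg : ∀ x : S, (∀ y : S, polar n x y = 0) → x = 0)
    (hcomp : ∀ x y : S, n (mul x y) = n x * n y)
    (hassoc : ∀ x y z : S, polar n (mul x y) z = polar n x (mul y z))
    (hdim : Module.finrank k S = 8)
    (hnopara : ¬ ∃ e : S, ∀ x : S,
      mul e x = polar n e x • e - x ∧ mul x e = polar n e x • e - x) :
    (((∃ z : S, z ≠ 0 ∧ n z = 0) ∧ (∃ e : S, e ≠ 0 ∧ mul e e = e)) ↔
      (∃ x y : S, n x = 0 ∧ polar n x (mul x x) = 1 ∧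
        n y = 0 ∧ polar n y (mul y y) ≠ 0 ∧ mul x y = 0 ∧
        ∀ a ∈ ({x, mul x x} : Set S), ∀ b ∈ ({y, mul y y} : Set S),
          polar n a b = 0)) ∧
    (∀ x : S, n x = 0 → polar n x (mul x x) = 1 →
      x + mul x x ≠ 0 ∧ mul (x + mul x x) (x + mul x x) = x + mul x x) := by
  have H : IsSymmComp mul n := ⟨hnondeg, hcomp, hassoc⟩
  refine ⟨⟨?_, ?_⟩, fun x h0 h1 => IsSplitElt.add_sq ⟨h0, h1⟩ H⟩
  · rintro ⟨⟨z, hz0, hz⟩, e, he0, he⟩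
    obtain ⟨x₀, hx₀⟩ := (IsNormOneIdem.of_ne_zero H he0 he).exists_isSplitElt H hnopara hz0 hz
    obtain ⟨x, y, hx, hy, hg⟩ := hx₀.exists_cubic_ne_zero H hnopara
    refine ⟨x, y, hx.norm, hx.cubic, hy.norm_eq_zero hx H, hg, hy.mul_left, ?_⟩
    have hyy := hy.mul_mem hy hx H
    have hyx := hyy.orth_sq
    rw [hx.sq_sq H] at hyx
    rintro a (rfl | rfl) b (rfl | rfl) <;> rw [polar_comm]
    exacts [hy.orth, hyx, hy.orth_sq, hyy.orth]
  · rintro ⟨x, y, h0, h1, -⟩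
    refine ⟨⟨x, ?_, h0⟩, _, IsSplitElt.add_sq ⟨h0, h1⟩ H⟩
    rintro rfl
    simp at h1
end

section
/- Let (S,*,n) be an Okubo algebra over a field k with a nontrivial grading S = ⊕_{g∈G} S_g by a group G such that the identity component S_1 is two-dimensional and contains no nonzero idempotent. Then the support of the grading is a subgroup of G of order 3: there is g ∈ G with g³ = 1, g ≠ 1, S = S_1 ⊕ S_g ⊕ S_{g²}, and dim S_g = dim S_{g²} = 3. Moreover the restriction of n to S_1 is isotropic, and there exist x ∈ S_1 and a homogeneous element y ∈ S_g ∪ S_{g²} such that n(x) = 0, α := n(x, x*x) is not a cube in k (in particular α ≠ 0), S_1 = span{x, x*x}, n(y) = 0, n(y, y*y) ≠ 0, n(a, b) = 0 for all a ∈ {x, x*x}, b ∈ {y, y*y}, and x*y = 0. -/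
open QuadraticMap

namespace SymmetricComposition

/-- The laws of a symmetric composition algebra with product `mul` and norm `n`. -/
structure IsSymmetricComposition {k S : Type*} [Field k] [AddCommGroup S] [Module k S]
    (mul : S →ₗ[k] S →ₗ[k] S) (n : QuadraticForm k S) : Prop where
  nondeg : ∀ x : S, (∀ y : S, polar n x y = 0) → x = 0
  comp : ∀ x y : S, n (mul x y) = n x * n y
  assoc : ∀ x y z : S, polar n (mul x y) z = polar n x (mul y z)

section Algebra

variable {k S : Type*} [Field k] [AddCommGroup S] [Module k S]
  {mul : S →ₗ[k] S →ₗ[k] S} {n : QuadraticForm k S}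

theorem polar_add_l (x y z : S) : polar n (x + y) z = polar n x z + polar n y z :=
  QuadraticMap.polar_add_left n x y z

theorem polar_add_r (x y z : S) : polar n x (y + z) = polar n x y + polar n x z :=
  QuadraticMap.polar_add_right n x y z

theorem polar_smul_l (a : k) (x y : S) : polar n (a • x) y = a * polar n x y := by
  simp [QuadraticMap.polar_smul_left]

theorem polar_smul_r (a : k) (x y : S) : polar n x (a • y) = a * polar n x y := by
  simp [QuadraticMap.polar_smul_right]

theorem polar_self_eq (x : S) : polar n x x = 2 * n x := by
  have h := QuadraticMap.polar_self n x
  rw [h, two_nsmul, two_mul]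

theorem norm_add (x y : S) : n (x + y) = n x + n y + polar n x y := by
  simp only [polar]; ring

theorem norm_smul' (a : k) (x : S) : n (a • x) = a ^ 2 * n x := by
  rw [QuadraticMap.map_smul, smul_eq_mul, pow_two]

namespace IsSymmetricComposition

variable (h : IsSymmetricComposition mul n)
include h

theorem eq_of_polar {x y : S} (hxy : ∀ z, polar n x z = polar n y z) : x = y := by
  rw [← sub_eq_zero]
  refine h.nondeg _ fun z => ?_
  rw [QuadraticMap.polar_sub_left, hxy, sub_self]

theorem polar_mul_left (x y z : S) : polar n (mul x y) (mul x z) = n x * polar n y z := by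
  simp only [polar, ← map_add, h.comp]; ring

theorem polar_mul_right (x y z : S) : polar n (mul y x) (mul z x) = n x * polar n y z := by
  have : mul y x + mul z x = mul (y + z) x := by simp
  simp only [polar, this, h.comp]; ring

theorem mul_mul_self (x y : S) : mul (mul x y) x = n x • y := by
  refine h.eq_of_polar fun z => ?_
  rw [h.assoc, h.polar_mul_left, polar_smul_l]

theorem self_mul_mul (x y : S) : mul x (mul y x) = n x • y := by
  refine h.eq_of_polar fun z => ?_
  rw [polar_comm, ← h.assoc, h.polar_mul_right, polar_smul_l, polar_comm n z y]

theorem mul_mul_add (x y z : S) :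
    mul (mul x y) z + mul (mul z y) x = polar n x z • y := by
  have h1 := h.mul_mul_self (x + z) y
  have h2 := h.mul_mul_self x y
  have h3 := h.mul_mul_self z y
  rw [norm_add, add_smul, add_smul, ← h2, ← h3] at h1
  simp only [map_add, LinearMap.add_apply] at h1
  rw [← add_right_inj (mul (mul x y) x + mul (mul z y) z), ← h1]
  abel

theorem mul_mul_add' (x y z : S) :
    mul x (mul y z) + mul z (mul y x) = polar n x z • y := by
  have h1 := h.self_mul_mul (x + z) y
  have h2 := h.self_mul_mul x y
  have h3 := h.self_mul_mul z y
  rw [norm_add, add_smul, add_smul, ← h2, ← h3] at h1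
  simp only [map_add, LinearMap.add_apply] at h1
  rw [← add_right_inj (mul x (mul y x) + mul z (mul y z)), ← h1]
  abel

theorem sq_mul_sq (x : S) :
    mul (mul x x) (mul x x) = polar n x (mul x x) • x - n x • mul x x := by
  have h1 := h.mul_mul_add x x (mul x x)
  rw [h.mul_mul_self, map_smul, LinearMap.smul_apply] at h1
  exact eq_sub_of_add_eq h1

theorem cyclic (x y z : S) : polar n (mul x y) z = polar n (mul y z) x := by
  rw [h.assoc, polar_comm]

/-- An element of the span of `x` and `x * x` whose square is a multiple of itself. -/
theorem sq_of_root {x : S} {t : k}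
    (ht : polar n x (mul x x) = t ^ 3 - 3 * t * n x) :
    mul (mul x x + t • x) (mul x x + t • x) = (t ^ 2 - n x) • (mul x x + t • x) := by
  simp only [map_add, LinearMap.add_apply, map_smul, LinearMap.smul_apply, h.sq_mul_sq,
    h.mul_mul_self, h.self_mul_mul, ht]
  module

theorem norm_sq_add_smul (x : S) (t : k) :
    n (mul x x + t • x) = n x ^ 2 + t * polar n x (mul x x) + t ^ 2 * n x := by
  rw [norm_add, h.comp, norm_smul', polar_smul_r, polar_comm n (mul x x) x]; ring

end IsSymmetricComposition

end Algebra

section LinearAlgebra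

variable {k V : Type*} [Field k] [AddCommGroup V] [Module k V]

theorem linearIndependent_of_cube {T : Module.End k V} {u : V} (hu : u ≠ 0) {α : k}
    (hα : ¬ ∃ c : k, c ^ 3 = α) (hT : T (T (T u)) = -(α • u)) :
    LinearIndependent k ![u, T u, T (T u)] := by
  open Polynomial in
  have hirr : Irreducible (X ^ 3 - C (-α) : k[X]) := by
    refine X_pow_sub_C_irreducible_of_prime Nat.prime_three fun b hb => hα ⟨-b, ?_⟩
    rw [← neg_neg α, ← hb]; ring
  rw [Fintype.linearIndependent_iff]
  intro f hf
  simp only [Fin.sum_univ_three, Matrix.cons_val_zero, Matrix.cons_val_one, Matrix.cons_val] at hf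
  open Polynomial in
  set q : k[X] := C (f 2) * X ^ 2 + C (f 1) * X + C (f 0) with hq
  have hqu : Polynomial.aeval T q u = 0 := by
    simp [hq, pow_two, Module.algebraMap_end_apply]
    rw [← hf]; abel
  have hpu : Polynomial.aeval T (Polynomial.X ^ 3 - Polynomial.C (-α)) u = 0 := by
    simp [pow_succ, hT, Module.algebraMap_end_apply]
  have hq0 : q = 0 := by
    by_contra hne
    have hnd : ¬ (Polynomial.X ^ 3 - Polynomial.C (-α)) ∣ q := by
      intro hd
      have h1 := Polynomial.natDegree_le_of_dvd hd hne
      rw [Polynomial.natDegree_X_pow_sub_C] at h1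
      have h2 : q.natDegree ≤ 2 := Polynomial.natDegree_quadratic_le
      omega
    obtain ⟨a, b, hab⟩ := (hirr.coprime_iff_not_dvd).2 hnd
    apply hu
    have := congrArg (fun r => Polynomial.aeval T r u) hab
    rw [map_add, map_mul, map_mul, LinearMap.add_apply, Module.End.mul_apply,
      Module.End.mul_apply, hpu, hqu, map_zero, map_zero, add_zero, map_one] at this
    exact this.symm
  have c0 := congrArg (fun r => Polynomial.coeff r 0) hq0
  have c1 := congrArg (fun r => Polynomial.coeff r 1) hq0
  have c2 := congrArg (fun r => Polynomial.coeff r 2) hq0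
  simp [hq, Polynomial.coeff_X, Polynomial.coeff_C] at c0 c1 c2
  intro i
  fin_cases i <;> assumption

/-- If `T ^ 3` satisfies an irreducible quadratic `X ^ 2 + α X + β` on a nonzero space of dimension
at most three, then a root of this quadratic is the cube of some `a + b X` modulo it. -/
theorem exists_cube_root_mod_quadratic [FiniteDimensional k V] [Nontrivial V]
    (hV : Module.finrank k V ≤ 3) (T : Module.End k V) {α β : k}
    (hirr : ∀ r : k, r ^ 2 + α * r + β ≠ 0)
    (hT : ∀ v, (T ^ 3) ((T ^ 3) v) = -(α • (T ^ 3) v) - β • v) :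
    ∃ a b : k, a ^ 3 - 3 * a * b ^ 2 * β + b ^ 3 * α * β = 0 ∧
      3 * a ^ 2 * b - 3 * a * b ^ 2 * α + b ^ 3 * (α ^ 2 - β) = 1 := by
  have hTs : ∀ v, T ((T ^ 3) v) = (T ^ 3) (T v) := by
    intro v; simp [pow_succ]
  have hTTT : ∀ v, T (T (T v)) = (T ^ 3) v := by
    intro v; simp [pow_succ]
  generalize T ^ 3 = s at hTs hTTT hT
  have hN : ∀ c d : k, c ^ 2 - c * d * α + d ^ 2 * β = 0 → c = 0 ∧ d = 0 := by
    intro c d hcd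
    by_cases hd : d = 0
    · subst hd; simpa using hcd
    · refine absurd ?_ (hirr (-(c / d)))
      field_simp
      linear_combination hcd
  have key : ∀ c d : k, ∀ v : V, (c - d * α) • (c • v + d • s v) - d • s (c • v + d • s v)
      = (c ^ 2 - c * d * α + d ^ 2 * β) • v := by
    intro c d v
    simp only [map_add, map_smul, hT]
    module
  have hind : ∀ v : V, v ≠ 0 → ∀ c d : k, c • v + d • s v = 0 → c = 0 ∧ d = 0 := by
    intro v hv c d hcd
    have := key c d v
    rw [hcd, map_zero, smul_zero, smul_zero, sub_zero] at this
    exact hN c d ((smul_eq_zero.1 this.symm).resolve_right hv)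
  obtain ⟨u, hu⟩ := exists_ne (0 : V)
  have hdep : ¬ LinearIndependent k ![u, s u, T u, s (T u)] := by
    intro hli
    have := hli.fintype_card_le_finrank
    simp at this
    omega
  rw [Fintype.not_linearIndependent_iff] at hdep
  obtain ⟨f, hf, i, hi⟩ := hdep
  simp only [Fin.sum_univ_four, Matrix.cons_val_zero, Matrix.cons_val_one, Matrix.cons_val] at hf
  have hcd : f 2 ^ 2 - f 2 * f 3 * α + f 3 ^ 2 * β ≠ 0 := by
    intro h0
    obtain ⟨h2, h3⟩ := hN _ _ h0
    rw [h2, h3, zero_smul, zero_smul, add_zero, add_zero] at hf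
    obtain ⟨h0, h1⟩ := hind u hu _ _ hf
    exact hi (by fin_cases i <;> assumption)
  obtain ⟨a, b, hab⟩ : ∃ a b : k, T u = a • u + b • s u := by
    have h1 := key (f 2) (f 3) (T u)
    have h2 : f 2 • T u + f 3 • s (T u) = -(f 0 • u + f 1 • s u) := by
      rw [eq_neg_iff_add_eq_zero, ← hf]; abel
    rw [h2] at h1
    set N := f 2 ^ 2 - f 2 * f 3 * α + f 3 ^ 2 * β
    refine ⟨N⁻¹ * (-(f 2 - f 3 * α) * f 0 - f 3 * f 1 * β),
      N⁻¹ * (-(f 2 - f 3 * α) * f 1 + f 3 * f 0 - f 3 * f 1 * α), ?_⟩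
    rw [← inv_smul_smul₀ hcd (T u), ← h1]
    simp only [map_add, map_smul, map_neg, hT]
    module
  refine ⟨a, b, ?_⟩
  have h3 := hTTT u
  simp only [hab, map_add, map_sub, map_neg, map_smul, hTs, hT] at h3
  rw [← sub_eq_zero] at h3
  have h4 : (a ^ 3 - 3 * a * b ^ 2 * β + b ^ 3 * α * β) • u +
      (3 * a ^ 2 * b - 3 * a * b ^ 2 * α + b ^ 3 * (α ^ 2 - β) - 1) • s u = 0 := by
    rw [← h3]; module
  obtain ⟨h5, h6⟩ := hind u hu _ _ h4
  exact ⟨h5, sub_eq_zero.1 h6⟩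

end LinearAlgebra

section Grading

variable {k S : Type*} [Field k] [AddCommGroup S] [Module k S]

theorem eq_of_mem_of_mem {ι : Type*} [DecidableEq ι]
    {B : ι → Submodule k S} (hB : DirectSum.IsInternal B) {i j : ι} {x : S} (hx : x ≠ 0)
    (hi : x ∈ B i) (hj : x ∈ B j) : i = j := by
  by_contra hne
  exact hx (Submodule.disjoint_def.1 (hB.submodule_iSupIndep.pairwiseDisjoint hne) x hi hj)

variable {mul : S →ₗ[k] S →ₗ[k] S} {n : QuadraticForm k S}
  {G : Type*} [Group G] [DecidableEq G] {A : G → Submodule k S}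

/-- The data of a graded symmetric composition algebra with two-dimensional identity component
that has no nonzero idempotent. -/
structure IsGradedWithoutIdempotent (mul : S →ₗ[k] S →ₗ[k] S) (n : QuadraticForm k S)
    (A : G → Submodule k S) : Prop extends IsSymmetricComposition mul n where
  internal : DirectSum.IsInternal A
  mul_mem : ∀ g h : G, ∀ x ∈ A g, ∀ y ∈ A h, mul x y ∈ A (g * h)
  finrank_eq : Module.finrank k S = 8
  finrank_one : Module.finrank k (A 1) = 2
  eq_zero_of_idem : ∀ e ∈ A 1, mul e e = e → e = 0

namespace IsGradedWithoutIdempotent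

variable (h : IsGradedWithoutIdempotent mul n A)
include h

theorem finite : Module.Finite k S :=
  Module.finite_of_finrank_pos (by rw [h.finrank_eq]; norm_num)

theorem one_mul_mem {g : G} {x y : S} (hx : x ∈ A 1) (hy : y ∈ A g) : mul x y ∈ A g := by
  simpa using h.mul_mem 1 g x hx y hy

theorem mul_one_mem {g : G} {x y : S} (hx : x ∈ A g) (hy : y ∈ A 1) : mul x y ∈ A g := by
  simpa using h.mul_mem g 1 x hx y hy

theorem exists_ne_zero : ∃ x ∈ A 1, x ≠ 0 := by
  refine (A 1).exists_mem_ne_zero_of_ne_bot fun hb => ?_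
  have := h.finrank_one
  rw [hb, finrank_bot] at this
  omega

theorem eq_zero_of_sq {x : S} {c : k} (hx : x ∈ A 1) (hc : c ≠ 0) (hsq : mul x x = c • x) :
    x = 0 := by
  have := h.eq_zero_of_idem (c⁻¹ • x) ((A 1).smul_mem _ hx) (by
    simp only [map_smul, LinearMap.smul_apply, hsq, inv_smul_smul₀ hc])
  exact (smul_eq_zero.1 this).resolve_left (inv_ne_zero hc)

theorem polar_eq_zero {a b : G} (hab : a * b ≠ 1) {x z : S} (hx : x ∈ A a) (hz : z ∈ A b) :
    polar n x z = 0 := by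
  obtain ⟨y, hy, hy0⟩ := h.exists_ne_zero
  have hba : b * a ≠ 1 := fun hba => hab (mul_eq_one_comm.1 hba)
  have h1 := h.mul_mul_add x y z
  have h2 : mul (mul x y) z ∈ A (a * b) := h.mul_mem _ _ _ (h.mul_one_mem hx hy) _ hz
  have h3 : mul (mul z y) x ∈ A (b * a) := h.mul_mem _ _ _ (h.mul_one_mem hz hy) _ hx
  have hd : Disjoint (A 1) (⨆ i ∈ ({a * b, b * a} : Set G), A i) :=
    h.internal.submodule_iSupIndep.disjoint_biSup (by
      simp only [Set.mem_insert_iff, Set.mem_singleton_iff]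
      rintro (h' | h')
      · exact hab h'.symm
      · exact hba h'.symm)
  have h4 : polar n x z • y = 0 := by
    refine Submodule.disjoint_def.1 hd _ ((A 1).smul_mem _ hy) ?_
    rw [← h1, iSup_pair]
    exact Submodule.add_mem_sup h2 h3
  exact (smul_eq_zero.1 h4).resolve_right hy0

theorem eq_zero_of_polar {g : G} {x : S} (hx : x ∈ A g)
    (hz : ∀ z ∈ A g⁻¹, polar n x z = 0) : x = 0 := by
  refine h.nondeg x fun y => ?_
  have hy : y ∈ ⨆ i, A i := h.internal.submodule_iSup_eq_top ▸ Submodule.mem_top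
  induction hy using Submodule.iSup_induction' with
  | mem i w hw =>
    by_cases hi : i = g⁻¹
    · exact hz w (hi ▸ hw)
    · exact h.polar_eq_zero (fun hgi => hi (eq_inv_of_mul_eq_one_right hgi)) hx hw
  | zero => exact QuadraticMap.polar_zero_right n x
  | add v w _ _ hv hw => rw [polar_add_r, hv, hw, add_zero]

theorem exists_polar_ne_zero {g : G} {x : S} (hx : x ∈ A g) (hx0 : x ≠ 0) :
    ∃ z ∈ A g⁻¹, polar n x z ≠ 0 := by
  by_contra! hc
  exact hx0 (h.eq_zero_of_polar hx hc)

theorem finrank_le_finrank_inv (g : G) :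
    Module.finrank k (A g) ≤ Module.finrank k (A g⁻¹) := by
  have := h.finite
  let f : A g →ₗ[k] Module.Dual k (A g⁻¹) :=
    ((polarBilin n).domRestrict₁₂ (A g) (A g⁻¹))
  have hf : Function.Injective f := by
    rw [injective_iff_map_eq_zero]
    intro x hx
    refine Subtype.ext (h.eq_zero_of_polar x.2 fun z hz => ?_)
    exact LinearMap.congr_fun hx ⟨z, hz⟩
  exact (LinearMap.finrank_le_finrank_of_injective hf).trans_eq Subspace.dual_finrank_eq

theorem finrank_inv (g : G) : Module.finrank k (A g⁻¹) = Module.finrank k (A g) := by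
  refine le_antisymm ?_ (h.finrank_le_finrank_inv g)
  have := h.finrank_le_finrank_inv g⁻¹
  rwa [inv_inv] at this

theorem finrank_one_sup {g : G} (hg : g ≠ 1) (hgi : g⁻¹ ≠ g) :
    Module.finrank k ↥(A 1 ⊔ A g ⊔ A g⁻¹) = 2 + 2 * Module.finrank k (A g) := by
  have := h.finite
  have hd1 : Disjoint (A 1) (A g) := h.internal.submodule_iSupIndep.pairwiseDisjoint hg.symm
  have hd2 : Disjoint (A g⁻¹) (⨆ i ∈ ({1, g} : Set G), A i) :=
    h.internal.submodule_iSupIndep.disjoint_biSup (by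
      simp only [Set.mem_insert_iff, Set.mem_singleton_iff, inv_eq_one, not_or]
      exact ⟨hg, hgi⟩)
  rw [iSup_pair] at hd2
  have e1 := Submodule.finrank_sup_add_finrank_inf_eq (A 1) (A g)
  have e2 := Submodule.finrank_sup_add_finrank_inf_eq (A 1 ⊔ A g) (A g⁻¹)
  rw [hd1.eq_bot, finrank_bot, h.finrank_one] at e1
  rw [hd2.symm.eq_bot, finrank_bot, h.finrank_inv] at e2
  omega

theorem finrank_le_two_of_inv_eq {g : G} (hgi : g⁻¹ = g) : Module.finrank k (A g) ≤ 2 := by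
  have := h.finite
  by_cases hz : ∃ z ∈ A g, n z ≠ 0
  · obtain ⟨z, hz, hnz⟩ := hz
    have hgg : g * g = 1 := by nth_rewrite 1 [← hgi]; exact inv_mul_cancel g
    let f : A g →ₗ[k] A 1 :=
      LinearMap.restrict (mul z) (fun w hw => hgg ▸ h.mul_mem g g z hz w hw)
    have hf : Function.Injective f := by
      rw [injective_iff_map_eq_zero]
      intro w hw
      have hw' : mul z (w : S) = 0 := congrArg Subtype.val hw
      have := h.mul_mul_self z (w : S)
      rw [hw', map_zero, LinearMap.zero_apply] at this
      exact Subtype.ext ((smul_eq_zero.1 this.symm).resolve_left hnz)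
    exact (LinearMap.finrank_le_finrank_of_injective hf).trans_eq h.finrank_one
  · push Not at hz
    have hb : A g = ⊥ := by
      rw [Submodule.eq_bot_iff]
      intro x hx
      refine h.eq_zero_of_polar hx fun z hz' => ?_
      rw [hgi] at hz'
      simp [polar, hz _ ((A g).add_mem hx hz'), hz _ hx, hz _ hz']
    rw [hb, finrank_bot]; omega

theorem finrank_le_three {g : G} (hg : g ≠ 1) : Module.finrank k (A g) ≤ 3 := by
  have := h.finite
  by_cases hgi : g⁻¹ = g
  · have := h.finrank_le_two_of_inv_eq hgi; omega
  · have h1 := h.finrank_one_sup hg hgi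
    have h2 := Submodule.finrank_le (A 1 ⊔ A g ⊔ A g⁻¹)
    rw [h.finrank_eq] at h2
    omega

/-! ### The norm on the identity component is isotropic -/

/-- In the anisotropic case the square of an element of the identity component is not one of its
multiples. -/
theorem sq_add_smul_ne_zero (haniso : ∀ z ∈ A 1, n z = 0 → z = 0) {x : S} (hx : x ∈ A 1)
    (hx0 : x ≠ 0) (t : k) : mul x x + t • x ≠ 0 := by
  intro h0
  have h1 : mul x x = (-t) • x := by rw [neg_smul]; exact eq_neg_of_add_eq_zero_left h0
  by_cases ht : t = 0
  · rw [ht, neg_zero, zero_smul] at h1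
    have h2 := h.comp x x
    rw [h1, QuadraticMap.map_zero] at h2
    exact hx0 (haniso x hx (mul_self_eq_zero.1 h2.symm))
  · exact hx0 (h.eq_zero_of_sq hx (neg_ne_zero.2 ht) h1)

/-- The values `polar n x (x * x)` that would yield an idempotent do not occur. -/
theorem polar_sq_ne (haniso : ∀ z ∈ A 1, n z = 0 → z = 0) {x : S} (hx : x ∈ A 1)
    (hx0 : x ≠ 0) (t : k) : polar n x (mul x x) ≠ t ^ 3 - 3 * t * n x := by
  intro ht
  have hmem : mul x x + t • x ∈ A 1 :=
    (A 1).add_mem (h.one_mul_mem hx hx) ((A 1).smul_mem _ hx)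
  have hne := h.sq_add_smul_ne_zero haniso hx hx0 t
  refine hne (h.eq_zero_of_sq hmem (c := t ^ 2 - n x) ?_ (h.sq_of_root ht))
  intro h0
  refine hne (haniso _ hmem ?_)
  rw [h.norm_sq_add_smul, ht]
  linear_combination (t ^ 2 - n x) * h0

theorem exists_isotropic (hnt : ∃ g, g ≠ 1 ∧ A g ≠ ⊥) : ∃ x ∈ A 1, x ≠ 0 ∧ n x = 0 := by
  have := h.finite
  by_contra! hc
  have haniso : ∀ z ∈ A 1, n z = 0 → z = 0 := fun z hz hn => by
    by_contra hz0; exact hc z hz hz0 hn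
  obtain ⟨x, hx, hx0⟩ := h.exists_ne_zero
  have hν : n x ≠ 0 := hc x hx hx0
  obtain ⟨g, hg, hAg⟩ := hnt
  have : Nontrivial (A g) := Submodule.nontrivial_iff_ne_bot.2 hAg
  have hxx := h.one_mul_mem hx hx
  let T : Module.End k (A g) :=
    LinearMap.restrict (mul.flip x) (fun w hw => h.mul_one_mem hw hx)
  have hTv : ∀ v : A g, ((T v : A g) : S) = mul v x := fun v => rfl
  have hirr : ∀ r : k, r ^ 2 + polar n x (mul x x) * r + n x ^ 3 ≠ 0 := by
    intro r hr
    refine h.sq_add_smul_ne_zero haniso hx hx0 (r / n x) (haniso _ ?_ ?_)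
    · exact (A 1).add_mem hxx ((A 1).smul_mem _ hx)
    · rw [h.norm_sq_add_smul]
      field_simp
      linear_combination hr
  have hcube : ∀ v : S, v ∈ A g → mul (mul (mul v x) x) x =
      -(polar n x (mul x x) • v) - mul x (mul x (mul x v)) := by
    intro v hv
    have e1 := h.mul_mul_add x x v
    have e2 := h.mul_mul_add x v (mul x x)
    have e3 := h.mul_mul_add' x x (mul x v)
    rw [h.polar_eq_zero (by simpa using hg) hx hv, zero_smul] at e1
    rw [h.polar_eq_zero (by simpa using hg) hx (h.one_mul_mem hx hv), zero_smul] at e3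
    rw [eq_neg_of_add_eq_zero_right e1, map_neg, LinearMap.neg_apply,
      eq_neg_of_add_eq_zero_left e3, ← e2, eq_neg_of_add_eq_zero_right e3]
    abel
  have hT : ∀ v, (T ^ 3) ((T ^ 3) v) = -(polar n x (mul x x) • (T ^ 3) v) - n x ^ 3 • v := by
    intro v
    apply Subtype.ext
    have e : (((T ^ 3) v : A g) : S) = mul (mul (mul (v : S) x) x) x := by
      simp [pow_succ, hTv]
    have e' : (((T ^ 3) ((T ^ 3) v) : A g) : S)
        = mul (mul (mul (((T ^ 3) v : A g) : S) x) x) x := by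
      simp [pow_succ, hTv]
    rw [e', hcube _ (Subtype.mem _)]
    simp only [Submodule.coe_sub, Submodule.coe_neg, Submodule.coe_smul]
    rw [e, h.self_mul_mul, map_smul, h.self_mul_mul, map_smul, map_smul, h.self_mul_mul]
    module
  obtain ⟨a, b, e0, e1⟩ := exists_cube_root_mod_quadratic (h.finrank_le_three hg) T hirr hT
  set α := polar n x (mul x x) with hα
  set ν := n x with hν'
  set q := a ^ 2 - a * b * α + b ^ 2 * ν ^ 3 with hq
  set p := 2 * a - b * α with hp
  set d0 := a ^ 3 - 3 * a * b ^ 2 * ν ^ 3 + b ^ 3 * α * ν ^ 3 with hd0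
  set d1 := 3 * a ^ 2 * b - 3 * a * b ^ 2 * α + b ^ 3 * (α ^ 2 - ν ^ 3) with hd1
  have hq3 : q ^ 3 = ν ^ 3 := by
    have : q ^ 3 = d0 ^ 2 - d0 * d1 * α + d1 ^ 2 * ν ^ 3 := by
      rw [hq, hd0, hd1]; ring
    rw [this, e0, e1]; ring
  have hp3 : p ^ 3 - 3 * p * q = -α := by
    have : p ^ 3 - 3 * p * q = 2 * d0 - d1 * α := by
      rw [hp, hq, hd0, hd1]; ring
    rw [this, e0, e1]; ring
  refine h.polar_sq_ne haniso hx hx0 (-(q / ν) * p) ?_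
  have hζ : (q / ν) ^ 3 = 1 := by rw [div_pow, hq3, div_self (pow_ne_zero _ hν)]
  have hζν : (q / ν) * ν = q := div_mul_cancel₀ _ hν
  rw [← hα, ← hν']
  linear_combination hp3 + p ^ 3 * hζ - 3 * p * hζν

/-! ### The isotropic case -/

theorem mem_span_of_polar_eq_zero {x w : S} (hx : x ∈ A 1) (hx0 : x ≠ 0) (hnx : n x = 0)
    (hw : w ∈ A 1) (hxw : polar n x w = 0) : ∃ c : k, w = c • x := by
  have := h.finite
  by_contra! hc
  have hli : LinearIndependent k ![x, w] := by
    rw [LinearIndependent.pair_iff' hx0]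
    exact fun a ha => hc a ha.symm
  have hle : Submodule.span k (Set.range ![x, w]) ≤ A 1 := by
    rw [Submodule.span_le]
    rintro _ ⟨i, rfl⟩
    fin_cases i
    · exact hx
    · exact hw
  have heq := Submodule.eq_of_le_of_finrank_eq hle (by
    rw [finrank_span_eq_card hli, h.finrank_one]; simp)
  refine hx0 (h.eq_zero_of_polar hx fun z hz => ?_)
  rw [inv_one, ← heq, Matrix.range_cons, Matrix.range_cons, Matrix.range_empty, Set.union_empty,
    Set.singleton_union, Submodule.mem_span_pair] at hz
  obtain ⟨a, b, rfl⟩ := hz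
  rw [polar_add_r, polar_smul_r, polar_smul_r, polar_self_eq, hnx, hxw]; ring

theorem polar_sq_ne_zero {x : S} (hx : x ∈ A 1) (hx0 : x ≠ 0) (hnx : n x = 0) :
    polar n x (mul x x) ≠ 0 := by
  intro h0
  obtain ⟨c, hc⟩ := h.mem_span_of_polar_eq_zero hx hx0 hnx (h.one_mul_mem hx hx) h0
  by_cases hc0 : c = 0
  · rw [hc0, zero_smul] at hc
    obtain ⟨z, hz, hxz⟩ := h.exists_polar_ne_zero hx hx0
    rw [inv_one] at hz
    obtain ⟨d, hd⟩ := h.mem_span_of_polar_eq_zero hx hx0 hnx (h.one_mul_mem hz hx) (by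
      rw [polar_comm, h.assoc, hc, QuadraticMap.polar_zero_right])
    have := h.mul_mul_add x x z
    rw [hc, map_zero, LinearMap.zero_apply, zero_add, hd, map_smul, LinearMap.smul_apply, hc,
      smul_zero] at this
    exact (smul_ne_zero hxz hx0) this.symm
  · exact hx0 (h.eq_zero_of_sq hx hc0 hc)

theorem not_cube {x : S} (hx : x ∈ A 1) (hx0 : x ≠ 0) (hnx : n x = 0) :
    ¬ ∃ c : k, c ^ 3 = polar n x (mul x x) := by
  rintro ⟨c, hc⟩
  have hne := h.polar_sq_ne_zero hx hx0 hnx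
  have hc0 : c ≠ 0 := by
    rintro rfl
    exact hne (by rw [← hc]; simp)
  have hroot := h.sq_of_root (x := x) (t := c) (by rw [hnx, ← hc]; ring)
  rw [hnx, sub_zero] at hroot
  have hz := h.eq_zero_of_sq ((A 1).add_mem (h.one_mul_mem hx hx) ((A 1).smul_mem c hx))
    (pow_ne_zero 2 hc0) hroot
  apply hne
  rw [eq_neg_of_add_eq_zero_left hz, ← neg_smul, polar_smul_r, polar_self_eq, hnx]; ring

theorem eq_span {x : S} (hx : x ∈ A 1) (hx0 : x ≠ 0) (hnx : n x = 0) :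
    A 1 = Submodule.span k {x, mul x x} := by
  have := h.finite
  have hli : LinearIndependent k ![x, mul x x] := by
    rw [LinearIndependent.pair_iff' hx0]
    intro a ha
    refine h.polar_sq_ne_zero hx hx0 hnx ?_
    rw [← ha, polar_smul_r, polar_self_eq, hnx]; ring
  have hr : Set.range ![x, mul x x] = {x, mul x x} := by
    rw [Matrix.range_cons, Matrix.range_cons, Matrix.range_empty, Set.union_empty,
      Set.singleton_union]
  rw [← hr]
  refine (Submodule.eq_of_le_of_finrank_eq ?_ ?_).symm
  · rw [hr, Submodule.span_le]
    rintro _ (rfl | rfl)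
    · exact hx
    · exact h.one_mul_mem hx hx
  · rw [finrank_span_eq_card hli, h.finrank_one]; simp

theorem exists_annihilated (hnt : ∃ g, g ≠ 1 ∧ A g ≠ ⊥) {x : S} (hx : x ∈ A 1)
    (hnx : n x = 0) : ∃ g : G, g ≠ 1 ∧ ∃ u ∈ A g, u ≠ 0 ∧ mul x u = 0 := by
  obtain ⟨g, hg, hAg⟩ := hnt
  obtain ⟨z, hz, hz0⟩ := (A g).exists_mem_ne_zero_of_ne_bot hAg
  by_contra! hc
  have hkill : ∀ g : G, g ≠ 1 → ∀ z ∈ A g, mul z x = 0 := by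
    intro g hg z hz
    by_contra hzx
    refine hc g hg _ (h.mul_one_mem hz hx) hzx ?_
    rw [h.self_mul_mul, hnx, zero_smul]
  have hxz : mul x z = 0 := by
    refine h.eq_zero_of_polar (h.one_mul_mem hx hz) fun w hw => ?_
    rw [h.cyclic, h.cyclic,
      hkill _ (inv_ne_one.2 hg) w hw, QuadraticMap.polar_zero_left]
  exact hc g hg z hz hz0 hxz

section Annihilated

variable {g : G} (hg : g ≠ 1) {x : S} (hx : x ∈ A 1)
include hg hx

theorem mul_sq_eq_neg {u : S} (hu : u ∈ A g) : mul (mul u x) x = -mul (mul x x) u := by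
  have e := h.mul_mul_add x x u
  rw [h.polar_eq_zero (by simpa using hg) hx hu, zero_smul] at e
  exact eq_neg_of_add_eq_zero_right e

theorem mul_cube_eq {u : S} (hu : u ∈ A g) (hxu : mul x u = 0) :
    mul (mul (mul u x) x) x = -(polar n x (mul x x) • u) := by
  have e := h.mul_mul_add x u (mul x x)
  rw [hxu, map_zero, LinearMap.zero_apply, zero_add] at e
  rw [h.mul_sq_eq_neg hg hx hu, map_neg, LinearMap.neg_apply, e]

theorem linearIndependent_of_annihilated (hx0 : x ≠ 0) (hnx : n x = 0) {u : S} (hu : u ∈ A g)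
    (hu0 : u ≠ 0) (hxu : mul x u = 0) :
    LinearIndependent k ![u, mul u x, mul (mul u x) x] :=
  linearIndependent_of_cube (T := mul.flip x) hu0 (h.not_cube hx hx0 hnx)
    (h.mul_cube_eq hg hx hu hxu)

theorem span_eq_of_annihilated (hx0 : x ≠ 0) (hnx : n x = 0) {u : S} (hu : u ∈ A g)
    (hu0 : u ≠ 0) (hxu : mul x u = 0) :
    Submodule.span k {u, mul u x, mul (mul u x) x} = A g ∧ Module.finrank k (A g) = 3 := by
  have := h.finite
  have hli := h.linearIndependent_of_annihilated hg hx hx0 hnx hu hu0 hxu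
  have hr : Set.range ![u, mul u x, mul (mul u x) x] = {u, mul u x, mul (mul u x) x} := by
    rw [Matrix.range_cons, Matrix.range_cons, Matrix.range_cons, Matrix.range_empty,
      Set.union_empty, Set.singleton_union, Set.singleton_union]
  have hle : Submodule.span k {u, mul u x, mul (mul u x) x} ≤ A g := by
    rw [Submodule.span_le]
    have h1 := h.mul_one_mem hu hx
    rintro _ (rfl | rfl | rfl)
    · exact hu
    · exact h1
    · exact h.mul_one_mem h1 hx
  have h3 : Module.finrank k (Submodule.span k {u, mul u x, mul (mul u x) x}) = 3 := by
    rw [← hr, finrank_span_eq_card hli]; simp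
  have heq : Submodule.span k {u, mul u x, mul (mul u x) x} = A g :=
    Submodule.eq_of_le_of_finrank_le hle (by rw [h3]; exact h.finrank_le_three hg)
  exact ⟨heq, heq ▸ h3⟩

theorem mul_eq_zero_of_annihilated (hx0 : x ≠ 0) (hnx : n x = 0) {u : S} (hu : u ∈ A g)
    (hu0 : u ≠ 0) (hxu : mul x u = 0) {v : S} (hv : v ∈ A g) : mul x v = 0 := by
  rw [← (h.span_eq_of_annihilated hg hx hx0 hnx hu hu0 hxu).1, Submodule.mem_span_triple] at hv
  obtain ⟨a, b, c, rfl⟩ := hv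
  simp [hxu, h.self_mul_mul, hnx]

theorem sq_ne_zero_of_annihilated (hx0 : x ≠ 0) (hnx : n x = 0) {u : S} (hu : u ∈ A g)
    (hu0 : u ≠ 0) (hxu : mul x u = 0) : mul u u ≠ 0 := by
  intro huu
  obtain ⟨w, hw, hwu⟩ := h.exists_polar_ne_zero hu hu0
  have e := h.mul_mul_add u u w
  rw [huu, map_zero, LinearMap.zero_apply, zero_add] at e
  have hmem : mul w u ∈ A 1 := by simpa using h.mul_mem _ _ w hw u hu
  rw [h.eq_span hx hx0 hnx, Submodule.mem_span_pair] at hmem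
  obtain ⟨a, b, hab⟩ := hmem
  rw [← hab, map_add, LinearMap.add_apply, map_smul, map_smul, LinearMap.smul_apply,
    LinearMap.smul_apply, hxu, smul_zero, zero_add] at e
  have hli := h.linearIndependent_of_annihilated hg hx hx0 hnx hu hu0 hxu
  rw [Fintype.linearIndependent_iff] at hli
  refine hwu (hli ![polar n u w, 0, b] ?_ 0)
  simp only [Fin.sum_univ_three, Matrix.cons_val_zero, Matrix.cons_val_one, Matrix.cons_val,
    h.mul_sq_eq_neg hg hx hu]
  rw [← e]; module

/-- The trilinear form `n (u * v, w)` under right multiplication by `x` in the last argument. -/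
theorem polar_mul_mul_right {u v w : S} (hv : v ∈ A g) :
    polar n (mul u v) (mul w x) = -polar n (mul v (mul u x)) w := by
  have e := h.mul_mul_add' x u v
  rw [h.polar_eq_zero (by simpa using hg) hx hv, zero_smul] at e
  rw [polar_comm, h.assoc, eq_neg_of_add_eq_zero_left e, QuadraticMap.polar_neg_right, polar_comm]

theorem exists_polar_sq_ne_zero (hx0 : x ≠ 0) (hnx : n x = 0) {u : S} (hu : u ∈ A g)
    (hu0 : u ≠ 0) (hxu : mul x u = 0) (hg3 : g ^ 3 = 1) :
    ∃ y ∈ A g, polar n y (mul y y) ≠ 0 := by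
  by_contra! hc
  have hθ := h.mul_one_mem hu hx
  have h3 : ∀ v ∈ A g, 3 * polar n (mul u u) v = 0 := by
    intro v hv
    set α := polar n x (mul x x) with hα
    have hα0 : α ≠ 0 := h.polar_sq_ne_zero hx hx0 hnx
    have hα1 : 1 - α ≠ 0 := fun h0 => h.not_cube hx hx0 hnx ⟨1, by rw [← hα]; linear_combination h0⟩
    have key : ∀ t : k, 3 * t * (polar n (mul u u) v + t * polar n (mul v v) u) = 0 := by
      intro t
      have e := hc (u + t • v) ((A g).add_mem hu ((A g).smul_mem t hv))
      have eu := hc u hu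
      have ev := hc v hv
      simp only [map_add, map_smul, LinearMap.add_apply, LinearMap.smul_apply, polar_add_l,
        polar_add_r, polar_smul_l, polar_smul_r] at e
      rw [← h.assoc] at e eu ev
      have c1 : polar n u (mul u v) = polar n (mul u u) v := (h.assoc u u v).symm
      have c2 : polar n u (mul v u) = polar n (mul u u) v := by
        rw [polar_comm, h.cyclic, h.cyclic]
      have c3 : polar n v (mul u u) = polar n (mul u u) v := polar_comm _ _ _
      have c4 : polar n u (mul v v) = polar n (mul v v) u := polar_comm _ _ _
      have c5 : polar n v (mul v u) = polar n (mul v v) u := (h.assoc v v u).symm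
      have c6 : polar n v (mul u v) = polar n (mul v v) u := by
        rw [polar_comm, h.cyclic, h.cyclic]
      rw [c1, c2, c3, c4, c5, c6, eu, ← h.assoc, ev] at e
      linear_combination e
    have k1 := key 1
    have kα := key α
    have : (α * (1 - α)) * (3 * polar n (mul u u) v) = 0 := by
      linear_combination kα - α ^ 2 * k1
    exact (mul_eq_zero.1 this).resolve_left (mul_ne_zero hα0 hα1)
  have h20 : 2 * polar n (mul u u) (mul u x) = 0 := by
    have e := h.polar_mul_mul_right hg hx (u := u) (w := u) hu
    rw [← h.cyclic u u (mul u x)] at e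
    linear_combination e
  have h21 : 2 * polar n (mul u u) (mul (mul u x) x) = 0 := by
    have e1 := h.polar_mul_mul_right hg hx (u := u) (w := mul u x) hu
    have e2 := h.polar_mul_mul_right hg hx (u := u) (w := u) hθ
    rw [h.cyclic (mul u x) (mul u x) u, h.cyclic (mul u x) u (mul u x)] at e2
    linear_combination 2 * e1 - e2
  refine h.sq_ne_zero_of_annihilated hg hx hx0 hnx hu hu0 hxu ?_
  have hinv : (g * g)⁻¹ = g := by
    rw [inv_eq_iff_mul_eq_one, ← pow_two, ← pow_succ, hg3]
  refine h.eq_zero_of_polar (h.mul_mem _ _ u hu u hu) fun v hv => ?_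
  rw [hinv, ← (h.span_eq_of_annihilated hg hx hx0 hnx hu hu0 hxu).1,
    Submodule.mem_span_triple] at hv
  obtain ⟨a, b, c, rfl⟩ := hv
  have e0 : polar n (mul u u) u = 0 := by rw [polar_comm]; exact hc u hu
  have e1 : polar n (mul u u) (mul u x) = 0 := by linear_combination h3 _ hθ - h20
  have e2 : polar n (mul u u) (mul (mul u x) x) = 0 := by
    linear_combination h3 _ (h.mul_one_mem hθ hx) - h21
  rw [polar_add_r, polar_add_r, polar_smul_r, polar_smul_r, polar_smul_r, e0, e1, e2]; ring

end Annihilated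

end IsGradedWithoutIdempotent

end Grading

end SymmetricComposition

/-- a nontrivial group grading of an Okubo algebra whose identity
component is two-dimensional without nonzero idempotents has support a subgroup
of order 3, with three-dimensional nonidentity components; the norm restricted
to the identity component is isotropic, and there is a standard pair `(x, y)`
with `x` in the identity component spanning it together with `x*x`,
`α = n(x, x*x)` not a cube, and `y` homogeneous. -/
theorem okubo_grading_two_dim_identity_component
    {k : Type*} [Field k] {S : Type*} [AddCommGroup S] [Module k S]
    (mul : S →ₗ[k] S →ₗ[k] S) (n : QuadraticForm k S)
    (hnondeg : ∀ x : S, (∀ y : S, polar n x y = 0) → x = 0)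
    (hcomp : ∀ x y : S, n (mul x y) = n x * n y)
    (hassoc : ∀ x y z : S, polar n (mul x y) z = polar n x (mul y z))
    (hdim : Module.finrank k S = 8)
    (hnopara : ¬ ∃ e : S, ∀ x : S,
      mul e x = polar n e x • e - x ∧ mul x e = polar n e x • e - x)
    {G : Type*} [Group G] [DecidableEq G]
    (A : G → Submodule k S)
    (hdecomp : DirectSum.IsInternal A)
    (hgrmul : ∀ g h : G, ∀ x ∈ A g, ∀ y ∈ A h, mul x y ∈ A (g * h))
    (hnontriv : A 1 ≠ ⊤)
    (hdim1 : Module.finrank k (A 1) = 2)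
    (hnoidem : ¬ ∃ e : S, e ∈ A 1 ∧ e ≠ 0 ∧ mul e e = e) :
    ∃ g : G, g ≠ 1 ∧ g ^ 3 = 1 ∧
      (∀ h : G, h ≠ 1 → h ≠ g → h ≠ g ^ 2 → A h = ⊥) ∧
      Module.finrank k (A g) = 3 ∧ Module.finrank k (A (g ^ 2)) = 3 ∧
      (∃ z ∈ A 1, z ≠ 0 ∧ n z = 0) ∧
      ∃ x ∈ A 1, ∃ y : S, (y ∈ A g ∨ y ∈ A (g ^ 2)) ∧
        n x = 0 ∧
        (¬ ∃ c : k, c ^ 3 = polar n x (mul x x)) ∧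
        A 1 = Submodule.span k {x, mul x x} ∧
        n y = 0 ∧ polar n y (mul y y) ≠ 0 ∧
        (∀ a ∈ ({x, mul x x} : Set S), ∀ b ∈ ({y, mul y y} : Set S),
          polar n a b = 0) ∧
        mul x y = 0 := by
  have h : SymmetricComposition.IsGradedWithoutIdempotent mul n A :=
    { nondeg := hnondeg
      comp := hcomp
      assoc := hassoc
      internal := hdecomp
      mul_mem := hgrmul
      finrank_eq := hdim
      finrank_one := hdim1
      eq_zero_of_idem := fun e he hee => by_contra fun he0 => hnoidem ⟨e, he, he0, hee⟩ }
  have := h.finite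
  have hnt : ∃ g, g ≠ 1 ∧ A g ≠ ⊥ := by
    by_contra! hc
    refine hnontriv (eq_top_iff.2 ?_)
    rw [← hdecomp.submodule_iSup_eq_top]
    refine iSup_le fun g => ?_
    by_cases hg : g = 1
    · rw [hg]
    · rw [hc g hg]; exact bot_le
  obtain ⟨x, hx, hx0, hnx⟩ := h.exists_isotropic hnt
  obtain ⟨g, hg, u, hu, hu0, hxu⟩ := h.exists_annihilated hnt hx hnx
  have hdg := (h.span_eq_of_annihilated hg hx hx0 hnx hu hu0 hxu).2
  have hgi : g⁻¹ ≠ g := fun hgi => by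
    have := h.finrank_le_two_of_inv_eq hgi
    omega
  have htop : A 1 ⊔ A g ⊔ A g⁻¹ = ⊤ := by
    refine Submodule.eq_top_of_finrank_eq ?_
    rw [h.finrank_one_sup hg hgi, hdg, hdim]
  have hother : ∀ a : G, a ≠ 1 → a ≠ g → a ≠ g⁻¹ → A a = ⊥ := by
    intro a h1 h2 h3
    have hd : Disjoint (A a) (⨆ i ∈ ({1, g, g⁻¹} : Set G), A i) :=
      hdecomp.submodule_iSupIndep.disjoint_biSup (by simp [h1, h2, h3])
    rw [iSup_insert, iSup_pair, ← sup_assoc, htop] at hd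
    exact disjoint_top.1 hd
  have hsq : g ^ 2 = g⁻¹ := by
    by_contra hne
    refine h.sq_ne_zero_of_annihilated hg hx hx0 hnx hu hu0 hxu ?_
    have hmem := h.mul_mem g g u hu u hu
    rw [← pow_two, hother (g ^ 2) ?_ ?_ hne] at hmem
    · exact (Submodule.mem_bot k).1 hmem
    · intro h1
      rw [pow_two] at h1
      exact hgi (inv_eq_of_mul_eq_one_right h1)
    · intro h1
      rw [pow_two] at h1
      exact hg (mul_eq_left.1 h1)
  have hg3 : g ^ 3 = 1 := by rw [pow_succ, hsq, inv_mul_cancel]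
  obtain ⟨y, hy, hyy⟩ := h.exists_polar_sq_ne_zero hg hx hx0 hnx hu hu0 hxu hg3
  have hyy2 : mul y y ∈ A (g ^ 2) := pow_two g ▸ h.mul_mem g g y hy y hy
  have hny : n y = 0 := by
    have e := h.mul_mul_self y x
    have hmem : mul (mul y x) y ∈ A (g ^ 2) :=
      pow_two g ▸ h.mul_mem g g _ (h.mul_one_mem hy hx) y hy
    rw [e] at hmem
    by_contra hne
    have := SymmetricComposition.eq_of_mem_of_mem hdecomp (smul_ne_zero hne hx0) hmem
      ((A 1).smul_mem _ hx)
    rw [hsq, inv_eq_one] at this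
    exact hg this
  refine ⟨g, hg, hg3, fun a h1 h2 h3 => hother a h1 h2 (hsq ▸ h3), hdg, ?_, ⟨x, hx, hx0, hnx⟩,
    x, hx, y, Or.inl hy, hnx, h.not_cube hx hx0 hnx, h.eq_span hx hx0 hnx, hny, hyy, ?_,
    h.mul_eq_zero_of_annihilated hg hx hx0 hnx hu hu0 hxu hy⟩
  · rw [hsq, h.finrank_inv, hdg]
  · have hort : ∀ a ∈ A 1, ∀ b ∈ ({y, mul y y} : Set S), polar n a b = 0 := by
      rintro a ha _ (rfl | rfl)
      · exact h.polar_eq_zero (by simpa using hg) ha hy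
      · exact h.polar_eq_zero (by simpa [hsq] using hg) ha hyy2
    rintro _ (rfl | rfl)
    · exact hort _ hx
    · exact hort _ (h.one_mul_mem hx hx)
end

section
/- (Principle of Local Triality) Let (S,*,n) be an eight-dimensional symmetric composition algebra over a field k of characteristic ≠ 2. Then tri(S,*,n) is a Lie subalgebra of o(S,n)³, and the projection π₀ : tri(S,*,n) → o(S,n), (d₀,d₁,d₂) ↦ d₀, is a bijective homomorphism of Lie algebras (i.e., a Lie algebra isomorphism onto o(S,n)). -/
open QuadraticMap

section SymmetricComposition

variable {k : Type*} [Field k] {S : Type*} [AddCommGroup S] [Module k S]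

/-- The axioms of a symmetric composition algebra with product `mul` and norm `n`. -/
structure IsSymmetricComposition_s13 (mul : S →ₗ[k] S →ₗ[k] S) (n : QuadraticForm k S) : Prop where
  nondeg : ∀ x : S, (∀ y : S, polar n x y = 0) → x = 0
  comp : ∀ x y : S, n (mul x y) = n x * n y
  assoc : ∀ x y z : S, polar n (mul x y) z = polar n x (mul y z)

/-- The endomorphism `w ↦ (x * w) * u`. For `x` orthogonal to `u`, these endomorphisms generate
an action of the Clifford algebra of the orthogonal complement of `u`. -/
def spinAction (mul : S →ₗ[k] S →ₗ[k] S) (u x : S) : Module.End k S :=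
  mul.flip u ∘ₗ mul x

/-- The endomorphism `x ↦ n(a, x) b - n(b, x) a`. -/
def orthogonalGenerator (n : QuadraticForm k S) (a b : S) : Module.End k S :=
  (polarBilin n a).smulRight b - (polarBilin n b).smulRight a

/-- The second component `x ↦ n(a, b) / 2 • x - (b * x) * a` of the triple with first component
`orthogonalGenerator n a b`. -/
def trialityLeft (mul : S →ₗ[k] S →ₗ[k] S) (n : QuadraticForm k S) (a b : S) : Module.End k S :=
  (2⁻¹ * polar n a b) • LinearMap.id - mul.flip a ∘ₗ mul b

/-- The third component `x ↦ n(a, b) / 2 • x - a * (x * b)` of the triple with first component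
`orthogonalGenerator n a b`. -/
def trialityRight (mul : S →ₗ[k] S →ₗ[k] S) (n : QuadraticForm k S) (a b : S) : Module.End k S :=
  (2⁻¹ * polar n a b) • LinearMap.id - mul a ∘ₗ mul.flip b

@[simp]
theorem spinAction_apply (mul : S →ₗ[k] S →ₗ[k] S) (u x w : S) :
    spinAction mul u x w = mul (mul x w) u := rfl

@[simp]
theorem orthogonalGenerator_apply (n : QuadraticForm k S) (a b x : S) :
    orthogonalGenerator n a b x = polar n a x • b - polar n b x • a := rfl

@[simp]
theorem trialityLeft_apply (mul : S →ₗ[k] S →ₗ[k] S) (n : QuadraticForm k S) (a b x : S) :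
    trialityLeft mul n a b x = (2⁻¹ * polar n a b) • x - mul (mul b x) a := rfl

@[simp]
theorem trialityRight_apply (mul : S →ₗ[k] S →ₗ[k] S) (n : QuadraticForm k S) (a b x : S) :
    trialityRight mul n a b x = (2⁻¹ * polar n a b) • x - mul a (mul x b) := rfl

namespace IsSymmetricComposition_s13

variable {mul : S →ₗ[k] S →ₗ[k] S} {n : QuadraticForm k S}

theorem ext_polar (h : IsSymmetricComposition_s13 mul n) {x y : S}
    (hxy : ∀ z, polar n x z = polar n y z) : x = y := by
  rw [← sub_eq_zero]
  refine h.nondeg _ fun z => ?_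
  rw [polar_sub_left, hxy, sub_self]

theorem polar_mul_left_s13 (h : IsSymmetricComposition_s13 mul n) (x y z : S) :
    polar n (mul x y) (mul x z) = n x * polar n y z := by
  simp only [polar, ← map_add, h.comp]
  ring

theorem polar_mul_right (h : IsSymmetricComposition_s13 mul n) (x y z : S) :
    polar n (mul y x) (mul z x) = n x * polar n y z := by
  simp only [polar, ← LinearMap.add_apply, ← map_add, h.comp]
  ring

theorem polar_mul_add_polar_mul (h : IsSymmetricComposition_s13 mul n) (a b x y : S) :
    polar n (mul b x) (mul a y) + polar n (mul b y) (mul a x) = polar n a b * polar n x y := by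
  have key := h.polar_mul_left_s13 (a + b) x y
  have ha := h.polar_mul_left_s13 a x y
  have hb := h.polar_mul_left_s13 b x y
  simp only [map_add, LinearMap.add_apply, polar_add_left, polar_add_right] at key
  rw [polar_comm n (mul b y)]
  rw [QuadraticMap.map_add n a b] at key
  linear_combination key - ha - hb

theorem polar_mul_right_add (h : IsSymmetricComposition_s13 mul n) (a b x y : S) :
    polar n (mul x b) (mul y a) + polar n (mul x a) (mul y b) = polar n a b * polar n x y := by
  have key := h.polar_mul_right (a + b) x y
  have ha := h.polar_mul_right a x y
  have hb := h.polar_mul_right b x y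
  simp only [map_add, polar_add_left, polar_add_right] at key
  rw [QuadraticMap.map_add n a b] at key
  linear_combination key - ha - hb

theorem mul_mul_self_s13 (h : IsSymmetricComposition_s13 mul n) (x y : S) :
    mul (mul x y) x = n x • y := by
  refine h.ext_polar fun z => ?_
  rw [h.assoc, h.polar_mul_left_s13, polar_smul_left, smul_eq_mul]

theorem self_mul_mul_s13 (h : IsSymmetricComposition_s13 mul n) (x y : S) :
    mul x (mul y x) = n x • y := by
  refine h.ext_polar fun z => ?_
  rw [polar_comm, ← h.assoc, h.polar_mul_right, polar_smul_left, smul_eq_mul, polar_comm]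

theorem mul_mul_add_s13 (h : IsSymmetricComposition_s13 mul n) (x y z : S) :
    mul (mul x z) y + mul (mul y z) x = polar n x y • z := by
  have key := h.mul_mul_self_s13 (x + y) z
  have hx := h.mul_mul_self_s13 x z
  have hy := h.mul_mul_self_s13 y z
  simp only [map_add, LinearMap.add_apply, QuadraticMap.map_add n] at key
  linear_combination (norm := module) key - hx - hy

theorem mul_add_mul_s13 (h : IsSymmetricComposition_s13 mul n) (x y z : S) :
    mul x (mul z y) + mul y (mul z x) = polar n x y • z := by
  have key := h.self_mul_mul_s13 (x + y) z
  have hx := h.self_mul_mul_s13 x z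
  have hy := h.self_mul_mul_s13 y z
  simp only [map_add, LinearMap.add_apply, QuadraticMap.map_add n] at key
  linear_combination (norm := module) key - hx - hy

theorem mul_mul_middle (h : IsSymmetricComposition_s13 mul n) (a x y : S) :
    mul (mul y a) (mul a x) = polar n a (mul x y) • a - n a • mul x y := by
  have key := h.mul_add_mul_s13 (mul y a) x a
  rw [h.self_mul_mul_s13, map_smul] at key
  have hp : polar n (mul y a) x = polar n a (mul x y) := by
    rw [h.assoc, polar_comm, h.assoc]
  rw [hp] at key
  linear_combination (norm := module) key

theorem mul_mul_middle_add (h : IsSymmetricComposition_s13 mul n) (a b x y : S) :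
    mul (mul y a) (mul b x) + mul (mul y b) (mul a x) =
      polar n a (mul x y) • b + polar n b (mul x y) • a - polar n a b • mul x y := by
  have key := h.mul_mul_middle (a + b) x y
  have ha := h.mul_mul_middle a x y
  have hb := h.mul_mul_middle b x y
  simp only [map_add, LinearMap.add_apply, QuadraticMap.map_add n, polar_add_left] at key
  linear_combination (norm := module) key - ha - hb

theorem orthogonalGenerator_mul (h : IsSymmetricComposition_s13 mul n) (h2 : (2 : k) ≠ 0)
    (a b x y : S) :
    orthogonalGenerator n a b (mul x y) =
      mul (trialityLeft mul n a b x) y + mul x (trialityRight mul n a b y) := by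
  simp only [orthogonalGenerator_apply, trialityLeft_apply, trialityRight_apply, map_sub,
    LinearMap.sub_apply, map_smul, LinearMap.smul_apply]
  have h₁ := h.mul_mul_add_s13 (mul b x) y a
  have h₂ := h.mul_add_mul_s13 x (mul y b) a
  have h₃ := h.mul_mul_middle_add a b x y
  rw [h.assoc] at h₁
  rw [← h.assoc, polar_comm n (mul x y)] at h₂
  have hhalf : (2⁻¹ * polar n a b) • mul x y + (2⁻¹ * polar n a b) • mul x y =
      polar n a b • mul x y := by
    rw [← add_smul]
    congr 1
    field_simp
    ring
  linear_combination (norm := module) h₁ + h₂ - h₃ - hhalf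

theorem polar_trialityLeft (h : IsSymmetricComposition_s13 mul n) (h2 : (2 : k) ≠ 0) (a b x y : S) :
    polar n (trialityLeft mul n a b x) y + polar n x (trialityLeft mul n a b y) = 0 := by
  simp only [trialityLeft_apply, polar_sub_left, polar_sub_right, polar_smul_left,
    polar_smul_right, smul_eq_mul]
  have key := h.polar_mul_add_polar_mul a b x y
  rw [h.assoc, polar_comm n x (mul (mul b y) a), h.assoc (mul b y)]
  field_simp
  linear_combination -2 * key

theorem polar_trialityRight (h : IsSymmetricComposition_s13 mul n) (h2 : (2 : k) ≠ 0) (a b x y : S) :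
    polar n (trialityRight mul n a b x) y + polar n x (trialityRight mul n a b y) = 0 := by
  simp only [trialityRight_apply, polar_sub_left, polar_sub_right, polar_smul_left,
    polar_smul_right, smul_eq_mul]
  have h₁ : polar n (mul a (mul x b)) y + polar n x (mul a (mul y b)) =
      polar n a b * polar n x y := by
    have key := h.polar_mul_right_add a b x y
    rw [polar_comm n (mul a _), ← h.assoc y, ← h.assoc x a, polar_comm n (mul y a) (mul x b)]
    exact key
  field_simp
  linear_combination -2 * h₁

theorem spinAction_spinAction (h : IsSymmetricComposition_s13 mul n) {u x : S}
    (hx : polar n x u = 0) (y w : S) :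
    spinAction mul u x (spinAction mul u y w) = -(n u • mul (mul y w) x) := by
  have key := h.mul_mul_add_s13 x u (mul (mul y w) u)
  rw [hx, zero_smul, h.self_mul_mul_s13, map_smul, LinearMap.smul_apply] at key
  exact eq_neg_of_add_eq_zero_left key

theorem spinAction_anticomm (h : IsSymmetricComposition_s13 mul n) {u x y : S}
    (hx : polar n x u = 0) (hy : polar n y u = 0) (hxy : polar n x y = 0) (w : S) :
    spinAction mul u x (spinAction mul u y w) = -spinAction mul u y (spinAction mul u x w) := by
  have key := h.mul_mul_add_s13 x y w
  rw [hxy, zero_smul] at key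
  rw [h.spinAction_spinAction hx, h.spinAction_spinAction hy, eq_neg_of_add_eq_zero_left key,
    smul_neg, neg_neg]

theorem polar_spinAction_left (h : IsSymmetricComposition_s13 mul n) {u x : S}
    (hx : polar n x u = 0) (s t : S) :
    polar n (spinAction mul u x s) t = -polar n s (spinAction mul u x t) := by
  have key := h.polar_mul_add_polar_mul u x s t
  rw [polar_comm n u x, hx, zero_mul] at key
  rw [spinAction_apply, spinAction_apply, h.assoc (mul x s), polar_comm n s, h.assoc (mul x t)]
  exact eq_neg_of_add_eq_zero_left key

theorem polar_spinAction_spinAction (h : IsSymmetricComposition_s13 mul n) (u v x y : S) :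
    polar n (spinAction mul u x v) (spinAction mul u y v) = n u * n v * polar n x y := by
  rw [spinAction_apply, spinAction_apply, h.polar_mul_right, h.polar_mul_right, mul_assoc]

theorem polar_spinAction_self (h : IsSymmetricComposition_s13 mul n) (u v x : S) :
    polar n (spinAction mul u x v) v = n v * polar n x u := by
  rw [spinAction_apply, h.assoc, h.polar_mul_right]

theorem exists_spinAction_eq (h : IsSymmetricComposition_s13 mul n) {u v : S} (hu : n u ≠ 0)
    (hv : n v ≠ 0) (w : S) : ∃ x, spinAction mul u x v = w := by
  refine ⟨(n u * n v)⁻¹ • mul v (mul u w), ?_⟩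
  simp only [spinAction_apply, map_smul, LinearMap.smul_apply, h.mul_mul_self_s13, smul_smul]
  rw [mul_assoc, mul_comm (n v), inv_mul_cancel₀ (mul_ne_zero hu hv), one_smul]

theorem spinAction_injective (h : IsSymmetricComposition_s13 mul n) {u x : S} (hu : n u ≠ 0)
    (hx : n x ≠ 0) {w : S} (hw : spinAction mul u x w = 0) : w = 0 := by
  have h₁ := h.self_mul_mul_s13 u (mul x w)
  rw [spinAction_apply] at hw
  rw [hw, map_zero, eq_comm, smul_eq_zero_iff_right hu] at h₁
  have h₂ := h.mul_mul_self_s13 x w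
  rwa [h₁, map_zero, LinearMap.zero_apply, eq_comm, smul_eq_zero_iff_right hx] at h₂

theorem polarBilin_nondegenerate (h : IsSymmetricComposition_s13 mul n) :
    LinearMap.BilinForm.Nondegenerate (polarBilin n) := by
  refine ⟨fun x hx => h.nondeg x hx, fun x hx => h.nondeg x fun y => ?_⟩
  rw [polar_comm]
  exact hx y

/-- In dimension eight, the orthogonal complement of a subspace of dimension at most four is
not totally isotropic as soon as the subspace itself is not. -/
theorem exists_orthogonal_ne_zero (h : IsSymmetricComposition_s13 mul n)
    (hdim : Module.finrank k S = 8) {u : S} (hu : n u ≠ 0) (p q r : S) :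
    ∃ x, n x ≠ 0 ∧ polar n x u = 0 ∧ polar n x p = 0 ∧ polar n x q = 0 ∧ polar n x r = 0 := by
  have : FiniteDimensional k S := Module.finite_of_finrank_pos (by omega)
  let B : LinearMap.BilinForm k S := polarBilin n
  have hB : B.Nondegenerate := h.polarBilin_nondegenerate
  have hrefl : B.IsRefl := fun x y hxy => (polar_comm n y x).trans hxy
  let W := Submodule.span k (Set.range ![u, p, q, r])
  have hmem : ∀ i, ![u, p, q, r] i ∈ W := fun i => Submodule.subset_span ⟨i, rfl⟩
  have hW : Module.finrank k W ≤ 4 := finrank_range_le_card ![u, p, q, r]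
  by_contra! hcon
  have hiso : ∀ x ∈ B.orthogonal W, n x = 0 := by
    intro x hx
    by_contra hne
    have hx' : ∀ i, polar n x (![u, p, q, r] i) = 0 := fun i =>
      (polar_comm n _ _).trans (hx _ (hmem i))
    exact hcon x hne (hx' 0) (hx' 1) (hx' 2) (hx' 3)
  have hle : B.orthogonal W ≤ W := by
    refine le_trans ?_ (LinearMap.BilinForm.orthogonal_orthogonal hB hrefl W).le
    intro x hx y hy
    change polar n y x = 0
    rw [polar, hiso _ (add_mem hy hx), hiso _ hx, hiso _ hy, sub_zero, sub_zero]
  have heq : B.orthogonal W = W := by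
    refine Submodule.eq_of_le_of_finrank_le hle ?_
    rw [LinearMap.BilinForm.finrank_orthogonal hB, hdim]
    omega
  exact hu (hiso u (heq.symm.le (hmem 0)))

/-- A skew endomorphism commuting with the even Clifford action `w ↦ (x * w) * y` vanishes. -/
theorem eq_zero_of_commutes (h : IsSymmetricComposition_s13 mul n) (h2 : (2 : k) ≠ 0)
    (hdim : Module.finrank k S = 8) {f : Module.End k S}
    (hskew : ∀ x, polar n (f x) x = 0)
    (hf : ∀ x y w, f (mul (mul x w) y) = mul (mul x (f w)) y) {u : S} (hu : n u ≠ 0) :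
    f u = 0 := by
  have hJ : ∀ x w, f (spinAction mul u x w) = spinAction mul u x (f w) := fun x w => hf x u w
  have horth : ∀ {x}, polar n (spinAction mul u x u) u = 0 → polar n x u = 0 := fun {x} hx => by
    rw [h.polar_spinAction_self] at hx
    exact (mul_eq_zero_iff_left hu).mp hx
  obtain ⟨a, ha⟩ := h.exists_spinAction_eq hu hu (f u)
  have hau : polar n a u = 0 := horth (ha ▸ hskew u)
  obtain ⟨b, hb, hbu, hba, -, -⟩ := h.exists_orthogonal_ne_zero hdim hu a a a
  obtain ⟨t, ht⟩ := h.exists_spinAction_eq hu hu (spinAction mul u b (spinAction mul u a u))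
  obtain ⟨c, hc, hcu, hca, hcb, hct⟩ := h.exists_orthogonal_ne_zero hdim hu a b t
  obtain ⟨d, hd⟩ := h.exists_spinAction_eq hu hu (spinAction mul u b (spinAction mul u c u))
  have hdu : polar n d u = 0 := by
    apply horth
    rw [hd, h.polar_spinAction_left hbu, h.polar_spinAction_spinAction, hcb, mul_zero, neg_zero]
  have hda : polar n d a = 0 := by
    have key := h.polar_spinAction_spinAction u u d a
    rw [hd, h.polar_spinAction_left hbu, ← ht, h.polar_spinAction_spinAction, hct, mul_zero,
      neg_zero] at key
    simpa [hu] using key.symm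
  have h₁ : f (spinAction mul u d u) =
      -spinAction mul u b (spinAction mul u c (f u)) := by
    rw [hJ, ← ha, h.spinAction_anticomm hdu hau hda, hd,
      h.spinAction_anticomm hau hbu ((polar_comm n a b).trans hba),
      h.spinAction_anticomm hau hcu ((polar_comm n a c).trans hca), map_neg, neg_neg]
  have h₂ : f (spinAction mul u d u) = spinAction mul u b (spinAction mul u c (f u)) := by
    rw [hd, hJ, hJ]
  have h₃ : spinAction mul u b (spinAction mul u c (f u)) = 0 := by
    rw [h₂, eq_neg_iff_add_eq_zero, ← two_smul k, smul_eq_zero_iff_right h2] at h₁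
    exact h₁
  exact h.spinAction_injective hu hc (h.spinAction_injective hu hb h₃)

theorem exists_ne_zero (h : IsSymmetricComposition_s13 mul n) [Nontrivial S] : ∃ u, n u ≠ 0 := by
  by_contra! hcon
  obtain ⟨x, hx⟩ := exists_ne (0 : S)
  exact hx (h.nondeg x fun y => by simp only [polar, hcon, sub_zero])

/-- Vectors of nonzero norm span, so a linear map killing all of them is zero. -/
theorem eq_zero_of_forall_ne_zero [Nontrivial S] (h : IsSymmetricComposition_s13 mul n)
    (h2 : (2 : k) ≠ 0) {f : Module.End k S} (hf : ∀ u, n u ≠ 0 → f u = 0) (x : S) : f x = 0 := by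
  obtain ⟨u, hu⟩ := h.exists_ne_zero
  by_cases hx : n x = 0
  · by_cases hadd : n (x + u) = 0
    · have hsub : n (x - u) ≠ 0 := by
        intro hsub
        have h₁ : polar n x u = -n u := by rw [polar, hadd, hx]; ring
        have h₂ : polar n x (-u) = -n u := by
          rw [polar, ← sub_eq_add_neg, hsub, hx, QuadraticMap.map_neg]; ring
        rw [polar_neg_right, h₁] at h₂
        apply mul_ne_zero h2 hu
        linear_combination h₂
      have := hf _ hsub
      rwa [map_sub, hf u hu, sub_zero] at this
    · have := hf _ hadd
      rwa [map_add, hf u hu, add_zero] at this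
  · exact hf x hx

/-- A triality triple with vanishing first component vanishes. -/
theorem triality_eq_zero (h : IsSymmetricComposition_s13 mul n) (h2 : (2 : k) ≠ 0)
    (hdim : Module.finrank k S = 8) {f g : Module.End k S}
    (hf : ∀ x y, polar n (f x) y + polar n x (f y) = 0)
    (hg : ∀ x y, polar n (g x) y + polar n x (g y) = 0)
    (hfg : ∀ x y, mul (f x) y + mul x (g y) = 0) : f = 0 ∧ g = 0 := by
  have : Nontrivial S := Module.nontrivial_of_finrank_pos (R := k) (by omega)
  have hfmul : ∀ y z, f (mul y z) = mul (g y) z := fun y z => by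
    refine h.ext_polar fun x => ?_
    have h₁ := congrArg (polar n · z) (hfg x y)
    simp only [polar_add_left, polar_zero_left, h.assoc] at h₁
    rw [polar_comm n _ x, polar_comm n _ x]
    linear_combination hf x (mul y z) - h₁
  have hgmul : ∀ z x, g (mul z x) = mul z (f x) := fun z x => by
    refine h.ext_polar fun y => ?_
    have h₁ := congrArg (polar n z) (hfg x y)
    simp only [polar_add_right, polar_zero_right, ← h.assoc] at h₁
    linear_combination hg (mul z x) y - h₁
  have hskew : ∀ x, polar n (f x) x = 0 := fun x => by
    have := hf x x
    rw [polar_comm n x, ← two_mul] at this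
    exact (mul_eq_zero_iff_left h2).mp this
  have hf0 : ∀ x, f x = 0 := h.eq_zero_of_forall_ne_zero h2 fun u hu =>
    h.eq_zero_of_commutes h2 hdim hskew (fun x y w => by rw [hfmul, hgmul]) hu
  obtain ⟨u, hu⟩ := h.exists_ne_zero
  refine ⟨LinearMap.ext hf0, LinearMap.ext fun y => ?_⟩
  have h₁ := hfg u y
  rw [hf0, map_zero, LinearMap.zero_apply, zero_add] at h₁
  have h₂ := h.mul_mul_self_s13 u (g y)
  rwa [h₁, map_zero, LinearMap.zero_apply, eq_comm, smul_eq_zero_iff_right hu] at h₂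

/-- A skew endomorphism is a combination of the generators `x ↦ n(a, x) b - n(b, x) a`. -/
theorem exists_eq_sum_orthogonalGenerator [FiniteDimensional k S]
    (h : IsSymmetricComposition_s13 mul n) (h2 : (2 : k) ≠ 0) {f : Module.End k S}
    (hf : ∀ x y, polar n (f x) y + polar n x (f y) = 0) :
    ∃ a b : Fin (Module.finrank k S) → S,
      f = (2⁻¹ : k) • ∑ i, orthogonalGenerator n (a i) (b i) := by
  have hB := h.polarBilin_nondegenerate
  let e := Module.finBasis k S
  let e' := LinearMap.BilinForm.dualBasis (polarBilin n) hB e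
  have he' : ∀ x, ∑ i, polar n x (e i) • e' i = x := fun x => by
    simpa [e'] using e'.sum_repr x
  have he : ∀ x, ∑ i, polar n (e' i) x • e i = x := fun x => by
    refine h.ext_polar fun z => ?_
    conv_rhs => rw [← he' z]
    simp only [← polarBilin_apply_apply, map_sum, LinearMap.sum_apply, map_smul,
      LinearMap.smul_apply, smul_eq_mul]
    refine Finset.sum_congr rfl fun i _ => ?_
    simp only [polarBilin_apply_apply]
    rw [polar_comm n z, polar_comm n (e' i), mul_comm]
  refine ⟨e', fun i => f (e i), LinearMap.ext fun x => ?_⟩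
  have h₁ : ∑ i, polar n (e' i) x • f (e i) = f x := by
    conv_rhs => rw [← he x]
    simp only [map_sum, map_smul]
  have h₂ : ∑ i, polar n (f (e i)) x • e' i = -f x := by
    conv_rhs => rw [← he' (f x)]
    rw [← Finset.sum_neg_distrib]
    refine Finset.sum_congr rfl fun i _ => ?_
    rw [← neg_smul, eq_neg_of_add_eq_zero_left (hf (e i) x), polar_comm n (f x)]
  simp only [LinearMap.smul_apply, LinearMap.sum_apply, orthogonalGenerator_apply,
    Finset.sum_sub_distrib, h₁, h₂]
  rw [sub_neg_eq_add, ← two_smul k, smul_smul, inv_mul_cancel₀ h2, one_smul]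

/-- Every skew endomorphism is the first component of a triality triple. -/
theorem exists_triality [FiniteDimensional k S] (h : IsSymmetricComposition_s13 mul n)
    (h2 : (2 : k) ≠ 0) {f : Module.End k S}
    (hf : ∀ x y, polar n (f x) y + polar n x (f y) = 0) :
    ∃ f₁ f₂ : Module.End k S,
      (∀ x y, polar n (f₁ x) y + polar n x (f₁ y) = 0) ∧
      (∀ x y, polar n (f₂ x) y + polar n x (f₂ y) = 0) ∧
      ∀ x y, f (mul x y) = mul (f₁ x) y + mul x (f₂ y) := by
  obtain ⟨a, b, rfl⟩ := h.exists_eq_sum_orthogonalGenerator h2 hf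
  refine ⟨(2⁻¹ : k) • ∑ i, trialityLeft mul n (a i) (b i),
    (2⁻¹ : k) • ∑ i, trialityRight mul n (a i) (b i), fun x y => ?_, fun x y => ?_,
    fun x y => ?_⟩
  · simp only [← polarBilin_apply_apply, LinearMap.smul_apply, LinearMap.sum_apply, map_smul,
      map_sum]
    rw [← smul_add, ← Finset.sum_add_distrib, Finset.sum_eq_zero, smul_zero]
    exact fun i _ => h.polar_trialityLeft h2 (a i) (b i) x y
  · simp only [← polarBilin_apply_apply, LinearMap.smul_apply, LinearMap.sum_apply, map_smul,
      map_sum]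
    rw [← smul_add, ← Finset.sum_add_distrib, Finset.sum_eq_zero, smul_zero]
    exact fun i _ => h.polar_trialityRight h2 (a i) (b i) x y
  · simp only [LinearMap.smul_apply, LinearMap.sum_apply, map_smul, map_sum]
    rw [← smul_add, ← Finset.sum_add_distrib]
    congr 1
    exact Finset.sum_congr rfl fun i _ => h.orthogonalGenerator_mul h2 (a i) (b i) x y

end IsSymmetricComposition_s13

end SymmetricComposition

/-- Principle of Local Triality: for an eight-dimensional
symmetric composition algebra in characteristic ≠ 2, the triality Lie algebra
`tri(S,*,n)` is a Lie subalgebra of `o(S,n)³` (closed under addition, scalar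
multiplication and the componentwise commutator bracket), and the projection
onto the first component is a bijection onto `o(S,n)`; since the bracket is
componentwise, this projection is a Lie algebra isomorphism. -/
theorem triality_projection_bijective
    {k : Type*} [Field k] {S : Type*} [AddCommGroup S] [Module k S]
    (hchar : ringChar k ≠ 2)
    (mul : S →ₗ[k] S →ₗ[k] S) (n : QuadraticForm k S)
    (hnondeg : ∀ x : S, (∀ y : S, polar n x y = 0) → x = 0)
    (hcomp : ∀ x y : S, n (mul x y) = n x * n y)
    (hassoc : ∀ x y z : S, polar n (mul x y) z = polar n x (mul y z))
    (hdim : Module.finrank k S = 8) :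
    ∀ (inO : Module.End k S → Prop)
      (inTri : Module.End k S × Module.End k S × Module.End k S → Prop),
      (∀ d : Module.End k S,
        inO d ↔ ∀ x y : S, polar n (d x) y + polar n x (d y) = 0) →
      (∀ T : Module.End k S × Module.End k S × Module.End k S,
        inTri T ↔ (inO T.1 ∧ inO T.2.1 ∧ inO T.2.2 ∧
          ∀ x y : S, T.1 (mul x y) = mul (T.2.1 x) y + mul x (T.2.2 y))) →
      ((∀ T T', inTri T → inTri T' → inTri (T + T')) ∧
       (∀ (c : k) T, inTri T → inTri (c • T)) ∧
       (∀ T T', inTri T → inTri T' →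
          inTri (T.1 * T'.1 - T'.1 * T.1,
                 T.2.1 * T'.2.1 - T'.2.1 * T.2.1,
                 T.2.2 * T'.2.2 - T'.2.2 * T.2.2)) ∧
       (∀ T T', inTri T → inTri T' → T.1 = T'.1 → T = T') ∧
       (∀ d₀ : Module.End k S, inO d₀ →
          ∃ d₁ d₂ : Module.End k S, inTri (d₀, d₁, d₂))) := by
  intro inO inTri hO hTri
  have h : IsSymmetricComposition_s13 mul n := ⟨hnondeg, hcomp, hassoc⟩
  have h2 : (2 : k) ≠ 0 := Ring.two_ne_zero hchar
  have : FiniteDimensional k S := Module.finite_of_finrank_pos (by omega)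
  have hadd : ∀ d d', inO d → inO d' → inO (d + d') := fun d d' hd hd' =>
    (hO _).2 fun x y => by
      rw [LinearMap.add_apply, LinearMap.add_apply, polar_add_left, polar_add_right]
      linear_combination (hO d).1 hd x y + (hO d').1 hd' x y
  have hsmul : ∀ (c : k) d, inO d → inO (c • d) := fun c d hd =>
    (hO _).2 fun x y => by
      rw [LinearMap.smul_apply, LinearMap.smul_apply, polar_smul_left, polar_smul_right,
        ← smul_add, (hO d).1 hd, smul_zero]
  have hbracket : ∀ d d', inO d → inO d' → inO (d * d' - d' * d) := fun d d' hd hd' =>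
    (hO _).2 fun x y => by
      simp only [LinearMap.sub_apply, Module.End.mul_apply, polar_sub_left, polar_sub_right]
      linear_combination (hO d).1 hd (d' x) y - (hO d').1 hd' (d x) y
        - (hO d').1 hd' x (d y) + (hO d).1 hd x (d' y)
  refine ⟨fun T T' hT hT' => ?_, fun c T hT => ?_, fun T T' hT hT' => ?_,
    fun T T' hT hT' heq => ?_, fun d₀ hd₀ => ?_⟩
  · obtain ⟨h₀, h₁, h₂, hm⟩ := (hTri T).1 hT
    obtain ⟨h₀', h₁', h₂', hm'⟩ := (hTri T').1 hT'
    refine (hTri _).2 ⟨hadd _ _ h₀ h₀', hadd _ _ h₁ h₁', hadd _ _ h₂ h₂', fun x y => ?_⟩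
    simp only [Prod.fst_add, Prod.snd_add, LinearMap.add_apply, map_add, hm, hm']
    abel
  · obtain ⟨h₀, h₁, h₂, hm⟩ := (hTri T).1 hT
    refine (hTri _).2 ⟨hsmul _ _ h₀, hsmul _ _ h₁, hsmul _ _ h₂, fun x y => ?_⟩
    simp only [Prod.smul_fst, Prod.smul_snd, LinearMap.smul_apply, map_smul, hm, smul_add]
  · obtain ⟨h₀, h₁, h₂, hm⟩ := (hTri T).1 hT
    obtain ⟨h₀', h₁', h₂', hm'⟩ := (hTri T').1 hT'
    refine (hTri _).2
      ⟨hbracket _ _ h₀ h₀', hbracket _ _ h₁ h₁', hbracket _ _ h₂ h₂', fun x y => ?_⟩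
    simp only [LinearMap.sub_apply, Module.End.mul_apply, map_sub, map_add, hm, hm']
    abel
  · obtain ⟨h₀, h₁, h₂, hm⟩ := (hTri T).1 hT
    obtain ⟨h₀', h₁', h₂', hm'⟩ := (hTri T').1 hT'
    have hsub : ∀ d d', inO d → inO d' →
        ∀ x y, polar n ((d - d') x) y + polar n x ((d - d') y) = 0 := fun d d' hd hd' x y => by
      rw [LinearMap.sub_apply, LinearMap.sub_apply, polar_sub_left, polar_sub_right]
      linear_combination (hO d).1 hd x y - (hO d').1 hd' x y
    obtain ⟨e₁, e₂⟩ := h.triality_eq_zero h2 hdim (hsub _ _ h₁ h₁') (hsub _ _ h₂ h₂')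
      fun x y => by
        have key := hm x y
        rw [heq, hm'] at key
        simp only [LinearMap.sub_apply, map_sub]
        linear_combination (norm := module) -key
    exact Prod.ext heq (Prod.ext (sub_eq_zero.1 e₁) (sub_eq_zero.1 e₂))
  · obtain ⟨d₁, d₂, h₁, h₂, hm⟩ := h.exists_triality h2 ((hO d₀).1 hd₀)
    exact ⟨d₁, d₂, (hTri _).2 ⟨hd₀, (hO d₁).2 h₁, (hO d₂).2 h₂, hm⟩⟩
end

section
/- Let (S,*,n) be an eight-dimensional symmetric composition algebra over a field k of characteristic ≠ 2. For x, y ∈ S set t_{x,y} := (σ_{x,y}, ½n(x,y)·id − r_x∘l_y, ½n(x,y)·id − l_x∘r_y), where σ_{x,y}(z) := n(x,z)y − n(y,z)x, l_x(z) := x*z and r_x(z) := z*x. Then: (a) t_{x,y} ∈ tri(S,*,n) for all x, y ∈ S; (b) tri(S,*,n) is spanned as a k-vector space by {t_{x,y} : x, y ∈ S}; and (c) [t_{a,b}, t_{x,y}] = t_{σ_{a,b}(x), y} + t_{x, σ_{a,b}(y)} for all a, b, x, y ∈ S. -/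
open QuadraticMap

namespace SymmetricComposition

variable {k S : Type*} [Field k] [AddCommGroup S] [Module k S]

/-- The linearised identities of a symmetric composition algebra with polar form `B`. -/
structure IsSymmComp (B : S →ₗ[k] S →ₗ[k] k) (m : S →ₗ[k] S →ₗ[k] S) : Prop where
  symm : ∀ x y, B x y = B y x
  nondeg : ∀ x, (∀ y, B x y = 0) → x = 0
  assoc : ∀ x y z, B (m x y) z = B x (m y z)
  flex_left : ∀ x y z, m (m x y) z + m (m z y) x = B x z • y
  flex_right : ∀ x y z, m x (m y z) + m z (m y x) = B x z • y

/-- The triality Lie algebra, as a subspace of triples of endomorphisms. -/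
def tri (B : S →ₗ[k] S →ₗ[k] k) (m : S →ₗ[k] S →ₗ[k] S) :
    Submodule k (Module.End k S × Module.End k S × Module.End k S) where
  carrier := {T | (∀ u v : S, B (T.1 u) v + B u (T.1 v) = 0) ∧
    (∀ u v : S, B (T.2.1 u) v + B u (T.2.1 v) = 0) ∧
    (∀ u v : S, B (T.2.2 u) v + B u (T.2.2 v) = 0) ∧
    (∀ u v : S, T.1 (m u v) = m (T.2.1 u) v + m u (T.2.2 v))}
  add_mem' := by
    rintro T U ⟨h0, h1, h2, h⟩ ⟨g0, g1, g2, g⟩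
    refine ⟨fun u v => ?_, fun u v => ?_, fun u v => ?_, fun u v => ?_⟩ <;>
      simp only [Prod.fst_add, Prod.snd_add, LinearMap.add_apply, map_add]
    · linear_combination h0 u v + g0 u v
    · linear_combination h1 u v + g1 u v
    · linear_combination h2 u v + g2 u v
    · linear_combination (norm := module) h u v + g u v
  zero_mem' := by simp
  smul_mem' := by
    rintro c T ⟨h0, h1, h2, h⟩
    refine ⟨fun u v => ?_, fun u v => ?_, fun u v => ?_, fun u v => ?_⟩ <;>
      simp only [Prod.smul_fst, Prod.smul_snd, LinearMap.smul_apply, map_smul, smul_eq_mul]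
    · linear_combination c * h0 u v
    · linear_combination c * h1 u v
    · linear_combination c * h2 u v
    · linear_combination (norm := module) c • h u v

/-- The triple `t_{x,y}`. -/
def t (B : S →ₗ[k] S →ₗ[k] k) (m : S →ₗ[k] S →ₗ[k] S) (x y : S) :
    Module.End k S × Module.End k S × Module.End k S :=
  ((B x).smulRight y - (B y).smulRight x,
    ((2 : k)⁻¹ * B x y) • (LinearMap.id : Module.End k S) - (m.flip x) ∘ₗ (m y),
    ((2 : k)⁻¹ * B x y) • (LinearMap.id : Module.End k S) - (m x) ∘ₗ (m.flip y))

section apply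

variable (B : S →ₗ[k] S →ₗ[k] k) (m : S →ₗ[k] S →ₗ[k] S) (x y z : S)

@[simp] lemma t_fst_apply : (t B m x y).1 z = B x z • y - B y z • x := by simp [t]

@[simp] lemma t_snd_fst_apply :
    (t B m x y).2.1 z = ((2 : k)⁻¹ * B x y) • z - m (m y z) x := by simp [t]

@[simp] lemma t_snd_snd_apply :
    (t B m x y).2.2 z = ((2 : k)⁻¹ * B x y) • z - m x (m z y) := by simp [t]

end apply

variable {B : S →ₗ[k] S →ₗ[k] k} {m : S →ₗ[k] S →ₗ[k] S}

namespace IsSymmComp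

lemma assoc' (h : IsSymmComp B m) (x y z : S) : B (m x y) z = B y (m z x) := by
  rw [h.assoc, h.symm, h.assoc]

lemma comp_linear (h : IsSymmComp B m) (x y z w : S) :
    B (m x y) (m z w) + B (m x w) (m z y) = B x z * B y w := by
  have e := congrArg (B y) (h.flex_left z w x)
  simp only [map_add, map_smul, smul_eq_mul] at e
  rw [h.assoc' x y, h.symm (m x w), h.assoc' z y, h.symm x z, ← e]

lemma ext (h : IsSymmComp B m) {x y : S} (hxy : ∀ z, B x z = B y z) : x = y :=
  sub_eq_zero.1 (h.nondeg _ fun z => by simp [hxy z])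

lemma t_mem_tri (h : IsSymmComp B m) (h2 : (2 : k) ≠ 0) (x y : S) : t B m x y ∈ tri B m := by
  have h2' : (2 : k)⁻¹ * 2 = 1 := inv_mul_cancel₀ h2
  refine ⟨fun u v => ?_, fun u v => ?_, fun u v => ?_, fun u v => ?_⟩
  · simp only [t_fst_apply, map_sub, map_smul, LinearMap.sub_apply, LinearMap.smul_apply,
      smul_eq_mul]
    rw [h.symm u x, h.symm u y]
    ring
  · simp only [t_snd_fst_apply, map_sub, map_smul, LinearMap.sub_apply, LinearMap.smul_apply,
      smul_eq_mul]
    have e := h.comp_linear y u x v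
    rw [h.symm y x] at e
    rw [h.assoc (m y u), h.symm u (m _ _), h.assoc (m y v)]
    linear_combination B x y * B u v * h2' - e
  · simp only [t_snd_snd_apply, map_sub, map_smul, LinearMap.sub_apply, LinearMap.smul_apply,
      smul_eq_mul]
    have e := h.comp_linear u y v x
    rw [h.symm y x] at e
    rw [h.assoc' x, h.symm u (m _ _), h.assoc' x, h.symm (m v y)]
    linear_combination B x y * B u v * h2' - e
  · simp only [t_fst_apply, t_snd_fst_apply, t_snd_snd_apply, map_sub, map_smul,
      LinearMap.sub_apply, LinearMap.smul_apply]
    have e1 := h.flex_left (m y u) x v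
    have e2 := h.flex_right (m v x) y u
    have e3 := congrArg (m u) (h.flex_right y v x)
    simp only [map_add, map_smul] at e3
    rw [h.assoc] at e1
    rw [h.assoc' v x u] at e2
    rw [h.symm y x] at e3
    linear_combination (norm := module) -h2' • (B x y • m u v) + e1 - e2 + e3

lemma tri_cycle (h : IsSymmComp B m) {d₀ d₁ d₂ : Module.End k S}
    (hd : (d₀, d₁, d₂) ∈ tri B m) : (d₁, d₂, d₀) ∈ tri B m := by
  obtain ⟨h0, h1, h2, hd⟩ := hd
  dsimp only at h0 h1 h2 hd
  refine ⟨h1, h2, h0, fun y z => h.ext fun x => ?_⟩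
  have e := congrArg (fun s => B s z) (hd x y)
  simp only [map_add, LinearMap.add_apply] at e ⊢
  rw [h.assoc, h.assoc] at e
  have e1 := h0 (m x y) z
  rw [h.assoc x y] at e1
  have e2 := h1 x (m y z)
  rw [h.symm _ x, h.symm _ x, h.symm _ x]
  linear_combination e2 - e1 + e

/-- Invariance of `t` under the action of the triality Lie algebra. -/
lemma lie_t (h : IsSymmComp B m) {d₀ d₁ d₂ : Module.End k S}
    (hd : (d₀, d₁, d₂) ∈ tri B m) (x y : S) :
    (d₀ * (t B m x y).1 - (t B m x y).1 * d₀,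
      d₁ * (t B m x y).2.1 - (t B m x y).2.1 * d₁,
      d₂ * (t B m x y).2.2 - (t B m x y).2.2 * d₂) = t B m (d₀ x) y + t B m x (d₀ y) := by
  have f1 := (h.tri_cycle hd).2.2.2
  have f2 := (h.tri_cycle (h.tri_cycle hd)).2.2.2
  have h0 := hd.1
  dsimp only at f1 f2 h0
  refine Prod.ext (LinearMap.ext fun z => ?_) (Prod.ext (LinearMap.ext fun z => ?_)
    (LinearMap.ext fun z => ?_))
  · simp only [Prod.fst_add, LinearMap.sub_apply, LinearMap.add_apply, Module.End.mul_apply,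
      t_fst_apply, map_sub, map_smul]
    linear_combination (norm := module) -(h0 x z) • y + (h0 y z) • x
  · simp only [Prod.fst_add, Prod.snd_add, LinearMap.sub_apply, LinearMap.add_apply,
      Module.End.mul_apply, t_snd_fst_apply, map_sub, map_smul, f1, f2, map_add]
    linear_combination (norm := module) -((2 : k)⁻¹ * h0 x y) • z
  · simp only [Prod.snd_add, LinearMap.sub_apply, LinearMap.add_apply,
      Module.End.mul_apply, t_snd_snd_apply, map_sub, map_smul, f1, f2, map_add]
    linear_combination (norm := module) -((2 : k)⁻¹ * h0 x y) • z

end IsSymmComp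

section frame

variable {ι : Type*} [Fintype ι] (w : ι → k) (e : ι → S)

/-- Twice the second component of the triple in `tri` with first component `X`. -/
def liftFst (m : S →ₗ[k] S →ₗ[k] S) (X : Module.End k S) : Module.End k S :=
  -∑ i, w i • (m.flip (e i) ∘ₗ m (X (e i)))

/-- Twice the third component of the triple in `tri` with first component `X`. -/
def liftSnd (m : S →ₗ[k] S →ₗ[k] S) (X : Module.End k S) : Module.End k S :=
  -∑ i, w i • (m (e i) ∘ₗ m.flip (X (e i)))

lemma liftFst_apply (X : Module.End k S) (z : S) :
    liftFst w e m X z = -∑ i, w i • m (m (X (e i)) z) (e i) := by simp [liftFst]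

lemma liftSnd_apply (X : Module.End k S) (z : S) :
    liftSnd w e m X z = -∑ i, w i • m (e i) (m z (X (e i))) := by simp [liftSnd]

lemma liftFst_smul (c : k) (X : Module.End k S) :
    liftFst w e m (c • X) = c • liftFst w e m X := by
  ext z
  simp [liftFst_apply, Finset.smul_sum, smul_comm c]

lemma liftSnd_smul (c : k) (X : Module.End k S) :
    liftSnd w e m (c • X) = c • liftSnd w e m X := by
  ext z
  simp [liftSnd_apply, Finset.smul_sum, smul_comm c]

variable {w e}

lemma smul_two_eq_sum_t (h : IsSymmComp B m) (h2 : (2 : k) ≠ 0)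
    (hw : ∀ x, ∑ i, (w i * B x (e i)) • e i = x)
    {X : Module.End k S} (hX : ∀ u v, B (X u) v + B u (X v) = 0) :
    ((2 : k) • X, liftFst w e m X, liftSnd w e m X) = ∑ i, w i • t B m (e i) (X (e i)) := by
  have h0 : ∀ v, B v (X v) = 0 := fun v => by
    have := hX v v
    rw [h.symm, ← two_mul] at this
    exact (mul_eq_zero.1 this).resolve_left h2
  refine Prod.ext (LinearMap.ext fun z => ?_) (Prod.ext (LinearMap.ext fun z => ?_)
    (LinearMap.ext fun z => ?_))
  · simp only [Prod.fst_sum, Prod.smul_fst, LinearMap.sum_apply, LinearMap.smul_apply,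
      t_fst_apply, smul_sub, Finset.sum_sub_distrib]
    have e1 := congrArg X (hw z)
    have e2 := hw (X z)
    simp only [map_sum, map_smul] at e1
    have e3 : ∑ i, w i • B (X (e i)) z • e i = -X z := by
      rw [eq_neg_iff_add_eq_zero, ← e2, ← Finset.sum_add_distrib]
      refine Finset.sum_eq_zero fun i _ => ?_
      have := hX z (e i)
      rw [h.symm z] at this
      linear_combination (norm := module) (w i * this) • e i
    have e4 : ∑ i, w i • B (e i) z • X (e i) = X z := by
      conv_rhs => rw [← e1]
      refine Finset.sum_congr rfl fun i _ => ?_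
      rw [h.symm, smul_smul]
    rw [e3, e4]
    module
  · simp [Prod.fst_sum, Prod.snd_sum, liftFst_apply, h0]
  · simp [Prod.snd_sum, liftSnd_apply, h0]

lemma lift_mem_tri (h : IsSymmComp B m) (h2 : (2 : k) ≠ 0)
    (hw : ∀ x, ∑ i, (w i * B x (e i)) • e i = x)
    {X : Module.End k S} (hX : ∀ u v, B (X u) v + B u (X v) = 0) :
    ((2 : k) • X, liftFst w e m X, liftSnd w e m X) ∈ tri B m := by
  rw [smul_two_eq_sum_t h h2 hw hX]
  exact Submodule.sum_mem _ fun i _ => Submodule.smul_mem _ _ (h.t_mem_tri h2 _ _)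

lemma liftSnd_apply' (h : IsSymmComp B m)
    (hw : ∀ x, ∑ i, (w i * B x (e i)) • e i = x)
    {X : Module.End k S} (hX : ∀ u v, B (X u) v + B u (X v) = 0) (z : S) :
    liftSnd w e m X z = ∑ i, w i • m (X (m (e i) z)) (e i) := by
  have e1 : ∀ i, X (m (e i) z) = -∑ j, (w j * B (m z (X (e j))) (e i)) • e j := fun i => by
    conv_lhs => rw [← hw (X (m (e i) z))]
    rw [← Finset.sum_neg_distrib]
    refine Finset.sum_congr rfl fun j _ => ?_
    rw [eq_neg_of_add_eq_zero_left (hX (m (e i) z) (e j)), h.assoc, h.symm (e i)]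
    module
  have e2 : ∀ j, m (e j) (m z (X (e j))) =
      ∑ i, (w i * B (m z (X (e j))) (e i)) • m (e j) (e i) := fun j => by
    conv_lhs => rw [← hw (m z (X (e j)))]
    simp
  rw [liftSnd_apply]
  simp only [e1, e2, map_neg, map_sum, map_smul, LinearMap.neg_apply, LinearMap.sum_apply,
    LinearMap.smul_apply, smul_neg, Finset.sum_neg_distrib, Finset.smul_sum]
  rw [Finset.sum_comm]
  congr 1
  refine Finset.sum_congr rfl fun i _ => Finset.sum_congr rfl fun j _ => ?_
  module

lemma sum_flex (h : IsSymmComp B m) (h2 : (2 : k) ≠ 0)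
    (htr : ∑ i, w i * B (e i) (e i) = 8) (z : S) :
    ∑ i, w i • m (m (e i) z) (e i) = (4 : k) • z := by
  have key : (2 : k) • ∑ i, w i • m (m (e i) z) (e i) = (8 : k) • z := by
    rw [← htr, Finset.smul_sum, Finset.sum_smul]
    refine Finset.sum_congr rfl fun i _ => ?_
    linear_combination (norm := module) w i • h.flex_left (e i) z (e i)
  refine smul_right_injective S h2 ?_
  dsimp only
  rw [key]
  module

lemma liftSnd_of_mem_tri (h : IsSymmComp B m) (h2 : (2 : k) ≠ 0)
    (hw : ∀ x, ∑ i, (w i * B x (e i)) • e i = x)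
    (htr : ∑ i, w i * B (e i) (e i) = 8) {d₀ d₁ d₂ : Module.End k S}
    (hd : (d₀, d₁, d₂) ∈ tri B m) :
    liftSnd w e m d₂ = (4 : k) • d₁ - liftFst w e m d₀ := by
  have f := (h.tri_cycle (h.tri_cycle hd)).2.2.2
  dsimp only at f
  ext z
  rw [liftSnd_apply' h hw hd.2.2.1]
  simp only [f, map_add, LinearMap.add_apply, smul_add, Finset.sum_add_distrib,
    LinearMap.sub_apply, LinearMap.smul_apply, liftFst_apply, sum_flex h h2 htr]
  module

/-- Triality has order three: `liftFst` and `liftSnd` are mutually inverse up to a scalar. -/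
lemma liftFst_liftSnd (h : IsSymmComp B m) (h2 : (2 : k) ≠ 0)
    (hw : ∀ x, ∑ i, (w i * B x (e i)) • e i = x)
    (htr : ∑ i, w i * B (e i) (e i) = 8)
    {X : Module.End k S} (hX : ∀ u v, B (X u) v + B u (X v) = 0) :
    liftFst w e m (liftSnd w e m X) = (4 : k) • X := by
  have sq : ∀ Y : Module.End k S, (∀ u v, B (Y u) v + B u (Y v) = 0) →
      liftSnd w e m (liftSnd w e m Y) = (2 : k) • liftFst w e m Y := fun Y hY => by
    rw [liftSnd_of_mem_tri h h2 hw htr (lift_mem_tri h h2 hw hY), liftFst_smul]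
    module
  have hT := lift_mem_tri h h2 hw hX
  have e1 := sq _ hT.2.2.1
  dsimp only at e1
  rw [sq X hX, liftSnd_smul] at e1
  have e2 := liftSnd_of_mem_tri h h2 hw htr (h.tri_cycle (h.tri_cycle hT))
  rw [smul_right_injective _ h2 e1] at e2
  refine smul_right_injective _ h2 ?_
  dsimp only
  linear_combination (norm := module) e2

lemma eq_zero_of_commute (h : IsSymmComp B m) (h2 : (2 : k) ≠ 0)
    (hw : ∀ x, ∑ i, (w i * B x (e i)) • e i = x)
    (horth : ∀ i j, i ≠ j → B (e i) (e j) = 0) (hne : ∀ i, B (e i) (e i) ≠ 0)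
    (hcard : 2 < Fintype.card ι) {d : Module.End k S} (hd : ∀ u v, B (d u) v + B u (d v) = 0)
    (hcomm : ∀ x y z, d ((t B m x y).1 z) = (t B m x y).1 (d z)) : d = 0 := by
  classical
  have h0 : ∀ v, B v (d v) = 0 := fun v => by
    have := hd v v
    rw [h.symm, ← two_mul] at this
    exact (mul_eq_zero.1 this).resolve_left h2
  have key : ∀ j l, B (d (e j)) (e l) = 0 := fun j l => by
    obtain ⟨i, -, hi⟩ := Finset.exists_mem_notMem_of_card_lt_card
      (s := {j, l}) (t := Finset.univ) (Finset.card_le_two.trans_lt hcard)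
    simp only [Finset.mem_insert, Finset.mem_singleton, not_or] at hi
    have e1 := congrArg (fun s => B s (e l)) (hcomm (e i) (e j) (e i))
    simp only [t_fst_apply, map_sub, map_smul, LinearMap.sub_apply, LinearMap.smul_apply,
      smul_eq_mul, h0, horth j i (Ne.symm hi.1), horth i l hi.2] at e1
    have : B (e i) (e i) * B (d (e j)) (e l) = 0 := by linear_combination e1
    exact (mul_eq_zero.1 this).resolve_left (hne i)
  have hz : ∀ j, d (e j) = 0 := fun j => by
    rw [← hw (d (e j))]
    simp [key]
  ext z
  rw [← hw z]
  simp [hz]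

/-- The projection of the triality Lie algebra to its first component is injective. -/
lemma eq_zero_of_fst_eq_zero (h : IsSymmComp B m) (h2 : (2 : k) ≠ 0)
    (hw : ∀ x, ∑ i, (w i * B x (e i)) • e i = x)
    (horth : ∀ i j, i ≠ j → B (e i) (e j) = 0) (hne : ∀ i, B (e i) (e i) ≠ 0)
    (htr : ∑ i, w i * B (e i) (e i) = 8)
    (hcard : 2 < Fintype.card ι) {d₁ d₂ : Module.End k S}
    (hd : ((0 : Module.End k S), d₁, d₂) ∈ tri B m) : d₁ = 0 ∧ d₂ = 0 := by
  have f1 := (h.tri_cycle hd).2.2.2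
  have f2 := (h.tri_cycle (h.tri_cycle hd)).2.2.2
  simp only [LinearMap.zero_apply, map_zero, add_zero, zero_add] at f1 f2
  have hc : ∀ X : Module.End k S, ∀ z, d₁ (liftFst w e m X z) = liftFst w e m X (d₁ z) :=
    fun X z => by simp [liftFst_apply, f1, f2]
  have h4 : (4 : k) ≠ 0 := by
    rw [show (4 : k) = 2 * 2 by norm_num]
    exact mul_ne_zero h2 h2
  have hd1 : d₁ = 0 := by
    refine eq_zero_of_commute h h2 hw horth hne hcard hd.2.1 fun x y z => ?_
    have := hc (liftSnd w e m (t B m x y).1) z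
    rw [liftFst_liftSnd h h2 hw htr (h.t_mem_tri h2 x y).1] at this
    simp only [LinearMap.smul_apply, map_smul] at this
    exact smul_right_injective S h4 this
  refine ⟨hd1, ?_⟩
  obtain ⟨i⟩ : Nonempty ι := Fintype.card_pos_iff.1 (by omega)
  ext y
  have f0 := hd.2.2.2 (e i) y
  simp only [hd1, LinearMap.zero_apply, map_zero, zero_add] at f0
  have e1 := h.flex_left (e i) (d₂ y) (e i)
  rw [← f0] at e1
  simpa [hne i] using e1.symm

end frame

lemma exists_frame [FiniteDimensional k S] (h2 : (2 : k) ≠ 0) (h : IsSymmComp B m) :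
    ∃ (w : Fin (Module.finrank k S) → k) (e : Fin (Module.finrank k S) → S),
      (∀ x, ∑ i, (w i * B x (e i)) • e i = x) ∧ (∀ i j, i ≠ j → B (e i) (e j) = 0) ∧
      (∀ i, B (e i) (e i) ≠ 0) ∧ ∑ i, w i * B (e i) (e i) = Module.finrank k S := by
  have : Invertible (2 : k) := invertibleOfNonzero h2
  obtain ⟨v, hv⟩ := LinearMap.BilinForm.exists_orthogonal_basis (B := B)
    ⟨fun x y => by simpa using h.symm x y⟩
  have horth : ∀ i j, i ≠ j → B (v i) (v j) = 0 := fun i j hij => hv hij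
  have hexp : ∀ x i, B x (v i) = v.repr x i * B (v i) (v i) := fun x i => by
    conv_lhs => rw [← v.sum_repr x]
    simp only [map_sum, map_smul, LinearMap.sum_apply, LinearMap.smul_apply, smul_eq_mul]
    refine Finset.sum_eq_single i (fun j _ hj => ?_) (by simp)
    rw [horth j i hj, mul_zero]
  have hne : ∀ i, B (v i) (v i) ≠ 0 := fun i hi => by
    refine v.ne_zero i (h.nondeg _ fun y => ?_)
    rw [h.symm, hexp, hi, mul_zero]
  refine ⟨fun i => (B (v i) (v i))⁻¹, v, fun x => ?_, horth, hne, ?_⟩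
  · conv_rhs => rw [← v.sum_repr x]
    refine Finset.sum_congr rfl fun i _ => ?_
    rw [hexp]
    congr 1
    field_simp [hne i]
  · simp [inv_mul_cancel₀ (hne _)]

/-- In dimension eight the triality Lie algebra is spanned by the triples `t_{x,y}`. -/
lemma tri_eq_span (h : IsSymmComp B m) (h2 : (2 : k) ≠ 0) (hdim : Module.finrank k S = 8) :
    tri B m = Submodule.span k {T | ∃ x y : S, T = t B m x y} := by
  have : FiniteDimensional k S := Module.finite_of_finrank_pos (by omega)
  obtain ⟨w, e, hw, horth, hne, htr⟩ := exists_frame h2 h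
  simp only [hdim, Nat.cast_ofNat] at htr
  refine le_antisymm (fun T hT => ?_) (Submodule.span_le.2 ?_)
  · obtain ⟨d₀, d₁, d₂⟩ := T
    have hU := smul_two_eq_sum_t h h2 hw hT.1
    have hmem := Submodule.sub_mem _ (Submodule.smul_mem _ (2 : k) hT)
      (lift_mem_tri h h2 hw hT.1)
    have hz := eq_zero_of_fst_eq_zero h h2 hw horth hne htr
      (by simp [hdim]) (d₁ := (2 : k) • d₁ - liftFst w e m d₀)
      (d₂ := (2 : k) • d₂ - liftSnd w e m d₀) (by simpa using hmem)
    have heq : (2 : k) • (d₀, d₁, d₂) = ∑ i, w i • t B m (e i) (d₀ (e i)) := by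
      rw [← hU]
      exact Prod.ext rfl (Prod.ext (sub_eq_zero.1 hz.1) (sub_eq_zero.1 hz.2))
    rw [← inv_smul_smul₀ h2 (d₀, d₁, d₂), heq]
    exact Submodule.smul_mem _ _ (Submodule.sum_mem _ fun i _ =>
      Submodule.smul_mem _ _ (Submodule.subset_span ⟨_, _, rfl⟩))
  · rintro _ ⟨x, y, rfl⟩
    exact h.t_mem_tri h2 x y

/-- Linearising the composition law yields the flexible identities. -/
lemma isSymmComp_polarBilin (m : S →ₗ[k] S →ₗ[k] S) (n : QuadraticForm k S)
    (hnondeg : ∀ x : S, (∀ y : S, polar n x y = 0) → x = 0)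
    (hcomp : ∀ x y : S, n (m x y) = n x * n y)
    (hassoc : ∀ x y z : S, polar n (m x y) z = polar n x (m y z)) :
    IsSymmComp (polarBilin n) m := by
  have hsymm : ∀ x y, polar n x y = polar n y x := fun x y => polar_comm n x y
  have hassoc' : ∀ x y z, polar n (m x y) z = polar n y (m z x) := fun x y z => by
    rw [hassoc, hsymm, hassoc]
  have hl : ∀ x y z, polar n (m x y) (m x z) = n x * polar n y z := fun x y z => by
    simp only [polar, ← map_add, hcomp]
    ring
  have hr : ∀ x y z, polar n (m y x) (m z x) = polar n y z * n x := fun x y z => by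
    simp only [polar, ← LinearMap.add_apply, ← map_add, hcomp]
    ring
  have hext : ∀ x y, (∀ z, polar n x z = polar n y z) → x = y := fun x y hxy =>
    sub_eq_zero.1 (hnondeg _ fun z => by rw [polar_sub_left, hxy, sub_self])
  have f1 : ∀ x y, m (m x y) x = n x • y := fun x y => hext _ _ fun z => by
    rw [hassoc, hl, polar_smul_left, smul_eq_mul]
  have f2 : ∀ x y, m x (m y x) = n x • y := fun x y => hext _ _ fun z => by
    rw [hassoc', hr, polar_smul_left, smul_eq_mul, mul_comm]
  have hn : ∀ x z, n (x + z) = n x + n z + polar n x z := fun x z => by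
    simp only [polar]
    ring
  refine ⟨hsymm, hnondeg, hassoc, fun x y z => ?_, fun x y z => ?_⟩
  · have e := f1 (x + z) y
    simp only [map_add, LinearMap.add_apply, f1, hn] at e
    simp only [polarBilin_apply_apply]
    linear_combination (norm := module) e
  · have e := f2 (x + z) y
    simp only [map_add, LinearMap.add_apply, f2, hn] at e
    simp only [polarBilin_apply_apply]
    linear_combination (norm := module) e

end SymmetricComposition

/-- for an eight-dimensional symmetric composition algebra in
characteristic ≠ 2, the triples
`t_{x,y} = (σ_{x,y}, ½n(x,y)id − r_x∘l_y, ½n(x,y)id − l_x∘r_y)` belong to the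
triality Lie algebra, span it, and satisfy
`[t_{a,b}, t_{x,y}] = t_{σ_{a,b}(x),y} + t_{x,σ_{a,b}(y)}`. -/
theorem triality_spanned_by_txy
    {k : Type*} [Field k] {S : Type*} [AddCommGroup S] [Module k S]
    (hchar : ringChar k ≠ 2)
    (mul : S →ₗ[k] S →ₗ[k] S) (n : QuadraticForm k S)
    (hnondeg : ∀ x : S, (∀ y : S, polar n x y = 0) → x = 0)
    (hcomp : ∀ x y : S, n (mul x y) = n x * n y)
    (hassoc : ∀ x y z : S, polar n (mul x y) z = polar n x (mul y z))
    (hdim : Module.finrank k S = 8) :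
    ∀ tt : S → S → Module.End k S × Module.End k S × Module.End k S,
      (∀ x y : S, tt x y =
        ((polarBilin n x).smulRight y - (polarBilin n y).smulRight x,
         ((2 : k)⁻¹ * polar n x y) • (LinearMap.id : Module.End k S) -
           (mul.flip x) ∘ₗ (mul y),
         ((2 : k)⁻¹ * polar n x y) • (LinearMap.id : Module.End k S) -
           (mul x) ∘ₗ (mul.flip y))) →
      ( -- (a): each t_{x,y} lies in tri(S,*,n)
        (∀ x y : S,
          (∀ u v : S, polar n ((tt x y).1 u) v + polar n u ((tt x y).1 v) = 0) ∧
          (∀ u v : S, polar n ((tt x y).2.1 u) v + polar n u ((tt x y).2.1 v) = 0) ∧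
          (∀ u v : S, polar n ((tt x y).2.2 u) v + polar n u ((tt x y).2.2 v) = 0) ∧
          (∀ u v : S, (tt x y).1 (mul u v) =
            mul ((tt x y).2.1 u) v + mul u ((tt x y).2.2 v))) ∧
        -- (b): tri(S,*,n) is spanned by the t_{x,y}
        ({T : Module.End k S × Module.End k S × Module.End k S |
            (∀ u v : S, polar n (T.1 u) v + polar n u (T.1 v) = 0) ∧
            (∀ u v : S, polar n (T.2.1 u) v + polar n u (T.2.1 v) = 0) ∧
            (∀ u v : S, polar n (T.2.2 u) v + polar n u (T.2.2 v) = 0) ∧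
            (∀ u v : S, T.1 (mul u v) = mul (T.2.1 u) v + mul u (T.2.2 v))} =
          ↑(Submodule.span k
            {T : Module.End k S × Module.End k S × Module.End k S |
              ∃ x y : S, T = tt x y})) ∧
        -- (c): the bracket formula
        (∀ a b x y : S,
          ((tt a b).1 * (tt x y).1 - (tt x y).1 * (tt a b).1,
           (tt a b).2.1 * (tt x y).2.1 - (tt x y).2.1 * (tt a b).2.1,
           (tt a b).2.2 * (tt x y).2.2 - (tt x y).2.2 * (tt a b).2.2) =
            tt ((tt a b).1 x) y + tt x ((tt a b).1 y)) ) := by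
  intro tt htt
  have h := SymmetricComposition.isSymmComp_polarBilin mul n hnondeg hcomp hassoc
  have h2 : (2 : k) ≠ 0 := Ring.two_ne_zero hchar
  obtain rfl : tt = SymmetricComposition.t (polarBilin n) mul :=
    funext fun x => funext fun y => htt x y
  refine ⟨fun x y => h.t_mem_tri h2 x y, ?_, fun a b x y => h.lie_t (h.t_mem_tri h2 a b) x y⟩
  exact congrArg SetLike.coe (SymmetricComposition.tri_eq_span h h2 hdim)
end
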